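/- Let K be a miserly domain, centered at the origin, whose boundary is piecewise analytic, i.e., the boundary of K is a finite union of arcs each admitting a regular real-analytic parametrization. Then K is a smoothed polygon: the boundary of K is a finite union of sets, each of which is either a line segment or an arc of a hyperbola (a connected subset of the zero set {v ∈ ℝ² : Q(v) = 0} of a quadratic polynomial Q whose degree-two part is a nondegenerate indefinite quadratic form, i.e., has negative determinant). -/

import Mathlib

open MeasureTheory

noncomputable section

/-- The wedge (cross) product of two planar vectors. -/
def wedge (v w : ℝ × ℝ) : ℝ := v.1 * w.2 - v.2 * w.1

/-- A centrally symmetric convex domain in the plane. -/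
def IsCSCD (K : Set (ℝ × ℝ)) : Prop :=
  Convex ℝ K ∧ IsCompact K ∧ (interior K).Nonempty ∧ K = -K

/-- The lattice spanned over `ℤ` by the vectors `v` and `w`. -/
def latticeOf (v w : ℝ × ℝ) : Set (ℝ × ℝ) :=
  {p | ∃ m n : ℤ, p = (m : ℝ) • v + (n : ℝ) • w}

/-- `Λ + K` is a packing of `K`. -/
def IsPacking (K Λ : Set (ℝ × ℝ)) : Prop :=
  ∀ p ∈ Λ, ∀ q ∈ Λ, p ≠ q →
    interior ((fun x => p + x) '' K) ∩ interior ((fun x => q + x) '' K) = ∅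

/-- The set of densities of lattice packings of `K`. -/
def packingDensities (K : Set (ℝ × ℝ)) : Set ℝ :=
  {d | ∃ v w : ℝ × ℝ, wedge v w ≠ 0 ∧ IsPacking K (latticeOf v w) ∧
       d = (volume K).toReal / |wedge v w|}

/-- `δ_lat(K)`: the supremum of densities of lattice packings of `K`. -/
def deltaLat (K : Set (ℝ × ℝ)) : ℝ := sSup (packingDensities K)

/-- A miserly domain: a centrally symmetric convex domain minimizing `δ_lat`. -/
def IsMiserly (K : Set (ℝ × ℝ)) : Prop :=
  IsCSCD K ∧ ∀ K' : Set (ℝ × ℝ), IsCSCD K' → deltaLat K ≤ deltaLat K'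

/-- `S` is a line segment. -/
def IsSegment (S : Set (ℝ × ℝ)) : Prop :=
  ∃ p q : ℝ × ℝ, S = segment ℝ p q

/-- `S` is an arc of a hyperbola: a connected subset of the zero set of a
quadratic polynomial whose degree-two part is a nondegenerate indefinite
quadratic form (negative determinant). -/
def IsHyperbolicArc (S : Set (ℝ × ℝ)) : Prop :=
  ∃ A B C D E F : ℝ, A * C - B ^ 2 / 4 < 0 ∧ IsConnected S ∧
    S ⊆ {v : ℝ × ℝ | A * v.1 ^ 2 + B * v.1 * v.2 + C * v.2 ^ 2 +
      D * v.1 + E * v.2 + F = 0}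

lemma wedge_add_left (u v w : ℝ × ℝ) : wedge (u + v) w = wedge u w + wedge v w := by
  simp only [wedge, Prod.fst_add, Prod.snd_add]; ring

lemma wedge_add_right (u v w : ℝ × ℝ) : wedge u (v + w) = wedge u v + wedge u w := by
  simp only [wedge, Prod.fst_add, Prod.snd_add]; ring

lemma wedge_sub_right (u v w : ℝ × ℝ) : wedge u (v - w) = wedge u v - wedge u w := by
  simp only [wedge, Prod.fst_sub, Prod.snd_sub]; ring

lemma wedge_smul_left (a : ℝ) (u v : ℝ × ℝ) : wedge (a • u) v = a * wedge u v := by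
  simp only [wedge, Prod.smul_fst, Prod.smul_snd, smul_eq_mul]; ring

lemma wedge_smul_right (a : ℝ) (u v : ℝ × ℝ) : wedge u (a • v) = a * wedge u v := by
  simp only [wedge, Prod.smul_fst, Prod.smul_snd, smul_eq_mul]; ring

lemma wedge_neg_left (u v : ℝ × ℝ) : wedge (-u) v = -wedge u v := by
  simp only [wedge, Prod.fst_neg, Prod.snd_neg]; ring

lemma wedge_neg_right (u v : ℝ × ℝ) : wedge u (-v) = -wedge u v := by
  simp only [wedge, Prod.fst_neg, Prod.snd_neg]; ring

lemma wedge_self (u : ℝ × ℝ) : wedge u u = 0 := by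
  simp only [wedge]; ring

lemma wedge_zero_left (u : ℝ × ℝ) : wedge 0 u = 0 := by simp [wedge]

lemma wedge_zero_right (u : ℝ × ℝ) : wedge u 0 = 0 := by simp [wedge]

lemma wedge_swap (u v : ℝ × ℝ) : wedge u v = -wedge v u := by
  simp only [wedge]; ring

lemma continuous_wedge : Continuous (fun x : (ℝ × ℝ) × (ℝ × ℝ) => wedge x.1 x.2) := by
  unfold wedge; fun_prop

@[fun_prop]
lemma Continuous.wedge {X : Type*} [TopologicalSpace X] {f g : X → ℝ × ℝ}
    (hf : Continuous f) (hg : Continuous g) : Continuous (fun x => wedge (f x) (g x)) :=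
  continuous_wedge.comp (hf.prodMk hg)

@[fun_prop]
lemma ContinuousOn.wedge {X : Type*} [TopologicalSpace X] {f g : X → ℝ × ℝ} {s : Set X}
    (hf : ContinuousOn f s) (hg : ContinuousOn g s) :
    ContinuousOn (fun x => wedge (f x) (g x)) s :=
  continuous_wedge.comp_continuousOn (hf.prodMk hg)

@[fun_prop]
lemma ContinuousAt.wedge {X : Type*} [TopologicalSpace X] {f g : X → ℝ × ℝ} {x : X}
    (hf : ContinuousAt f x) (hg : ContinuousAt g x) :
    ContinuousAt (fun x => wedge (f x) (g x)) x :=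
  ContinuousAt.comp (x := x) (g := fun x : (ℝ × ℝ) × (ℝ × ℝ) => _root_.wedge x.1 x.2)
    continuous_wedge.continuousAt (hf.prodMk hg)

lemma Filter.Tendsto.wedge {X : Type*} {l : Filter X} {f g : X → ℝ × ℝ} {u v : ℝ × ℝ}
    (hf : Filter.Tendsto f l (nhds u)) (hg : Filter.Tendsto g l (nhds v)) :
    Filter.Tendsto (fun x => wedge (f x) (g x)) l (nhds (wedge u v)) :=
  (continuous_wedge.tendsto (u, v)).comp (hf.prodMk_nhds hg)

lemma HasDerivAt.wedge {f g : ℝ → ℝ × ℝ} {f' g' : ℝ × ℝ} {t : ℝ}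
    (hf : HasDerivAt f f' t) (hg : HasDerivAt g g' t) :
    HasDerivAt (fun s => wedge (f s) (g s)) (wedge f' (g t) + wedge (f t) g') t := by
  have hf1 : HasDerivAt (fun s => (f s).1) f'.1 t :=
    (ContinuousLinearMap.fst ℝ ℝ ℝ).hasFDerivAt.comp_hasDerivAt t hf
  have hf2 : HasDerivAt (fun s => (f s).2) f'.2 t :=
    (ContinuousLinearMap.snd ℝ ℝ ℝ).hasFDerivAt.comp_hasDerivAt t hf
  have hg1 : HasDerivAt (fun s => (g s).1) g'.1 t :=
    (ContinuousLinearMap.fst ℝ ℝ ℝ).hasFDerivAt.comp_hasDerivAt t hg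
  have hg2 : HasDerivAt (fun s => (g s).2) g'.2 t :=
    (ContinuousLinearMap.snd ℝ ℝ ℝ).hasFDerivAt.comp_hasDerivAt t hg
  refine ((hf1.mul hg2).sub (hf2.mul hg1)).congr_deriv ?_
  simp only [_root_.wedge]; ring

lemma HasDerivAt.wedge_const {f : ℝ → ℝ × ℝ} {f' : ℝ × ℝ} {t : ℝ}
    (hf : HasDerivAt f f' t) (v : ℝ × ℝ) :
    HasDerivAt (fun s => _root_.wedge (f s) v) (_root_.wedge f' v) t := by
  have := hf.wedge (hasDerivAt_const t v)
  simpa [wedge_zero_right] using this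

lemma HasDerivAt.const_wedge {f : ℝ → ℝ × ℝ} {f' : ℝ × ℝ} {t : ℝ}
    (hf : HasDerivAt f f' t) (v : ℝ × ℝ) :
    HasDerivAt (fun s => _root_.wedge v (f s)) (_root_.wedge v f') t := by
  have := (hasDerivAt_const t v).wedge hf
  simpa [wedge_zero_left] using this

/-- Coordinates of `x` with respect to a basis `u, v`. -/
lemma wedge_smul_eq (u v x : ℝ × ℝ) :
    wedge u v • x = wedge x v • u + wedge u x • v := by
  ext <;> simp [wedge] <;> ring

lemma eq_coords {u v : ℝ × ℝ} (h : wedge u v ≠ 0) (x : ℝ × ℝ) :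
    x = (wedge x v / wedge u v) • u + (wedge u x / wedge u v) • v := by
  apply smul_right_injective _ h
  simp only [smul_add, smul_smul, mul_div_cancel₀ _ h]
  exact wedge_smul_eq u v x

lemma eq_smul_of_wedge_eq_zero {u x : ℝ × ℝ} (hu : u ≠ 0) (h : wedge u x = 0) :
    ∃ a : ℝ, x = a • u := by
  have hn : 0 < u.1 ^ 2 + u.2 ^ 2 := by
    rcases eq_or_ne u.1 0 with h1 | h1
    · have h2 : u.2 ≠ 0 := fun h2 => hu (Prod.ext h1 h2)
      positivity
    · positivity
  refine ⟨(u.1 * x.1 + u.2 * x.2) / (u.1 ^ 2 + u.2 ^ 2), ?_⟩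
  simp only [wedge] at h
  ext
  · simp only [Prod.smul_fst, smul_eq_mul]; field_simp; linear_combination (-u.2) * h
  · simp only [Prod.smul_snd, smul_eq_mul]; field_simp; linear_combination u.1 * h

namespace IsCSCD

variable {K : Set (ℝ × ℝ)}

lemma neg_mem (hK : IsCSCD K) {x : ℝ × ℝ} (hx : x ∈ K) : -x ∈ K := by
  rw [hK.2.2.2]; simpa using hx

lemma neg_mem_iff (hK : IsCSCD K) {x : ℝ × ℝ} : -x ∈ K ↔ x ∈ K :=
  ⟨fun h => by simpa using hK.neg_mem h, hK.neg_mem⟩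

lemma neg_mem_interior (hK : IsCSCD K) {x : ℝ × ℝ} (hx : x ∈ interior K) : -x ∈ interior K := by
  have h : interior (-K) = -interior K := by
    have := (Homeomorph.neg (ℝ × ℝ)).preimage_interior K
    simpa using this.symm
  rw [hK.2.2.2, h]; simpa using hx

lemma isClosed (hK : IsCSCD K) : IsClosed K := hK.2.1.isClosed

lemma combo_mem (hK : IsCSCD K) {x y : ℝ × ℝ} (hx : x ∈ K) (hy : y ∈ K) {a b : ℝ}
    (ha : 0 ≤ a) (hb : 0 ≤ b) (hab : a + b = 1) : a • x + b • y ∈ K :=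
  hK.1 hx hy ha hb hab

lemma combo_interior (hK : IsCSCD K) {x y : ℝ × ℝ} (hx : x ∈ interior K) (hy : y ∈ K) {a b : ℝ}
    (ha : 0 < a) (hb : 0 ≤ b) (hab : a + b = 1) : a • x + b • y ∈ interior K :=
  hK.1.combo_interior_self_mem_interior hx hy ha hb hab

lemma zero_mem_interior (hK : IsCSCD K) : (0 : ℝ × ℝ) ∈ interior K := by
  obtain ⟨x, hx⟩ := hK.2.2.1
  have := hK.combo_interior hx (interior_subset (hK.neg_mem_interior hx))
    (a := 1/2) (b := 1/2) (by norm_num) (by norm_num) (by norm_num)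
  simpa using this

lemma zero_mem (hK : IsCSCD K) : (0 : ℝ × ℝ) ∈ K := interior_subset hK.zero_mem_interior

lemma smul_mem (hK : IsCSCD K) {x : ℝ × ℝ} (hx : x ∈ K) {a : ℝ} (ha : 0 ≤ a) (ha1 : a ≤ 1) :
    a • x ∈ K := by
  have := hK.combo_mem hx hK.zero_mem ha (sub_nonneg.2 ha1) (by ring)
  simpa using this

lemma smul_mem_abs (hK : IsCSCD K) {x : ℝ × ℝ} (hx : x ∈ K) {a : ℝ} (ha : |a| ≤ 1) :
    a • x ∈ K := by
  rcases le_total 0 a with h | h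
  · exact hK.smul_mem hx h (by rwa [abs_of_nonneg h] at ha)
  · have := hK.smul_mem (hK.neg_mem hx) (a := -a) (by linarith) (by rwa [abs_of_nonpos h] at ha)
    simpa using this

lemma smul_mem_interior (hK : IsCSCD K) {x : ℝ × ℝ} (hx : x ∈ K) {a : ℝ} (ha : 0 ≤ a)
    (ha1 : a < 1) : a • x ∈ interior K := by
  have := hK.combo_interior hK.zero_mem_interior hx (a := 1 - a) (b := a) (by linarith) ha (by ring)
  simpa using this

/-- A point between an interior point and a point of `K` is interior. -/
lemma add_smul_mem_interior (hK : IsCSCD K) {x p : ℝ × ℝ} {r s t : ℝ}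
    (hr : x + r • p ∈ interior K) (hs : x + s • p ∈ K) (h : (r ≤ t ∧ t < s) ∨ (s < t ∧ t ≤ r)) :
    x + t • p ∈ interior K := by
  have hrs : r - s ≠ 0 := by
    rcases h with h | h
    · exact ne_of_lt (by linarith [h.1, h.2])
    · exact ne_of_gt (by linarith [h.1, h.2])
  have ha : 0 < (t - s) / (r - s) := by
    rcases h with h | h
    · exact div_pos_of_neg_of_neg (by linarith [h.1, h.2]) (by linarith [h.1, h.2])
    · exact div_pos (by linarith [h.1, h.2]) (by linarith [h.1, h.2])
  have hb : 0 ≤ (r - t) / (r - s) := by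
    rcases h with h | h
    · exact div_nonneg_of_nonpos (by linarith [h.1, h.2]) (by linarith [h.1, h.2])
    · exact div_nonneg (by linarith [h.1, h.2]) (by linarith [h.1, h.2])
  have := hK.combo_interior hr hs ha hb (by field_simp; ring)
  convert this using 1
  ext <;> simp <;> field_simp <;> ring

lemma eventually_smul_mem (_hK : IsCSCD K) {x : ℝ × ℝ} (hx : x ∈ interior K) (v : ℝ × ℝ) :
    ∀ᶠ ε : ℝ in nhds 0, x + ε • v ∈ interior K := by
  have : ContinuousAt (fun ε : ℝ => x + ε • v) 0 := by fun_prop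
  apply this.eventually_mem
  simpa using isOpen_interior.mem_nhds hx

lemma exists_pos_smul_mem (hK : IsCSCD K) {x : ℝ × ℝ} (hx : x ∈ interior K) (v : ℝ × ℝ) :
    ∃ ε : ℝ, 0 < ε ∧ x + ε • v ∈ interior K := by
  have h := hK.eventually_smul_mem hx v
  have h2 : ∀ᶠ ε : ℝ in nhdsWithin 0 (Set.Ioi 0), x + ε • v ∈ interior K := nhdsWithin_le_nhds h
  have h3 : ∀ᶠ ε : ℝ in nhdsWithin 0 (Set.Ioi 0), 0 < ε := self_mem_nhdsWithin
  exact (h3.and h2).exists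

lemma mem_frontier_iff (hK : IsCSCD K) {z : ℝ × ℝ} : z ∈ frontier K ↔ z ∈ K ∧ z ∉ interior K := by
  rw [hK.isClosed.frontier_eq]; rfl

lemma mem_frontier_iff_smul (hK : IsCSCD K) {z : ℝ × ℝ} :
    z ∈ frontier K ↔ z ∈ K ∧ ∀ μ : ℝ, 1 < μ → μ • z ∉ K := by
  rw [hK.mem_frontier_iff]
  refine and_congr_right fun hz => ⟨fun h μ hμ hm => h ?_, fun h hi => ?_⟩
  · have := hK.smul_mem_interior hm (a := μ⁻¹) (by positivity) (inv_lt_one_of_one_lt₀ hμ)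
    rwa [smul_smul, inv_mul_cancel₀ (by positivity), one_smul] at this
  · obtain ⟨ε, hε, h2⟩ := hK.exists_pos_smul_mem hi z
    refine h (1 + ε) (by linarith) ?_
    rw [add_smul, one_smul]; exact interior_subset h2

lemma neg_mem_frontier (hK : IsCSCD K) {z : ℝ × ℝ} (hz : z ∈ frontier K) : -z ∈ frontier K := by
  rw [hK.mem_frontier_iff] at *
  exact ⟨hK.neg_mem hz.1, fun h => hz.2 (by simpa using hK.neg_mem_interior h)⟩

lemma frontier_ne_zero (hK : IsCSCD K) {z : ℝ × ℝ} (hz : z ∈ frontier K) : z ≠ 0 := by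
  rintro rfl
  exact (hK.mem_frontier_iff.1 hz).2 hK.zero_mem_interior

/-- A supporting functional at a boundary point. -/
lemma exists_support (hK : IsCSCD K) {z : ℝ × ℝ} (hz : z ∉ interior K) :
    ∃ f : (ℝ × ℝ) →L[ℝ] ℝ, 0 < f z ∧ (∀ x ∈ K, f x ≤ f z) ∧ ∀ x ∈ interior K, f x < f z := by
  obtain ⟨f, hf⟩ := geometric_hahn_banach_open_point hK.1.interior isOpen_interior hz
  refine ⟨f, by simpa using hf 0 hK.zero_mem_interior, fun x hx => ?_, hf⟩
  by_contra! hlt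
  have hz0 : 0 < f z := by simpa using hf 0 hK.zero_mem_interior
  have := hf _ (hK.smul_mem_interior hx (a := f z / f x) (div_nonneg hz0.le (by linarith))
    ((div_lt_one (by linarith)).2 hlt))
  rw [map_smul, smul_eq_mul, div_mul_cancel₀ _ (by linarith)] at this
  exact lt_irrefl _ this

/-- Every ray from the origin meets the boundary. -/
lemma exists_frontier_ray (hK : IsCSCD K) {x : ℝ × ℝ} (hx : x ≠ 0) :
    ∃ μ : ℝ, 0 < μ ∧ μ • x ∈ frontier K := by
  have hcl : IsClosed {μ : ℝ | μ • x ∈ K} :=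
    hK.isClosed.preimage (f := fun μ : ℝ => μ • x) (by fun_prop)
  obtain ⟨R, hR⟩ := hK.2.1.isBounded.exists_norm_le
  have hxn : 0 < ‖x‖ := norm_pos_iff.2 hx
  have hbd : BddAbove {μ : ℝ | μ • x ∈ K} := by
    refine ⟨R / ‖x‖, fun μ hμ => ?_⟩
    have := hR _ hμ
    rw [norm_smul] at this
    rw [le_div_iff₀ hxn]
    exact (mul_le_mul_of_nonneg_right (le_abs_self μ) hxn.le).trans this
  have hne : {μ : ℝ | μ • x ∈ K}.Nonempty := ⟨0, by simpa using hK.zero_mem⟩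
  obtain ⟨ε, hε, h2⟩ := hK.exists_pos_smul_mem hK.zero_mem_interior x
  have hε2 : ε ≤ sSup {μ : ℝ | μ • x ∈ K} := le_csSup hbd (by simpa using interior_subset h2)
  refine ⟨_, hε.trans_le hε2, hK.mem_frontier_iff_smul.2 ⟨hcl.csSup_mem hne hbd, fun μ hμ h => ?_⟩⟩
  rw [smul_smul] at h
  have := le_csSup hbd h
  nlinarith

end IsCSCD

/-- `w` is a companion of `p`: both `w` and `p + w` lie in `K`. -/
def IsCompanion (K : Set (ℝ × ℝ)) (p w : ℝ × ℝ) : Prop := w ∈ K ∧ p + w ∈ K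

/-- A companion spanning the largest area with `p`. -/
def IsMaxCompanion (K : Set (ℝ × ℝ)) (p w : ℝ × ℝ) : Prop :=
  IsCompanion K p w ∧ ∀ x, IsCompanion K p x → wedge p x ≤ wedge p w

/-- Every boundary point has a companion spanning area at least `c` with it. -/
def Adm (K : Set (ℝ × ℝ)) (c : ℝ) : Prop :=
  ∀ p ∈ frontier K, ∃ w, IsCompanion K p w ∧ c ≤ wedge p w

namespace IsCSCD

variable {K : Set (ℝ × ℝ)}

lemma smul_interior_mem (hK : IsCSCD K) {x : ℝ × ℝ} (hx : x ∈ interior K) {a : ℝ} (ha : |a| ≤ 1) :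
    a • x ∈ interior K := by
  have key : ∀ b : ℝ, 0 ≤ b → b ≤ 1 → ∀ y ∈ interior K, b • y ∈ interior K := fun b hb hb1 y hy => by
    rcases hb1.lt_or_eq with h | rfl
    · exact hK.smul_mem_interior (interior_subset hy) hb h
    · simpa using hy
  rcases le_total 0 a with h | h
  · exact key a h (by rwa [abs_of_nonneg h] at ha) x hx
  · have := key (-a) (by linarith) (by rwa [abs_of_nonpos h] at ha) _ (hK.neg_mem_interior hx)
    simpa using this

lemma exists_isMaxCompanion (hK : IsCSCD K) {p : ℝ × ℝ} (hp : p ∈ K) :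
    ∃ w, IsMaxCompanion K p w := by
  have hc : IsCompact {w | IsCompanion K p w} :=
    hK.2.1.inter_right (hK.isClosed.preimage (f := fun w => p + w) (by fun_prop))
  obtain ⟨w, hw, hmax⟩ := hc.exists_isMaxOn (f := fun w => wedge p w)
    ⟨-p, hK.neg_mem hp, by simpa using hK.zero_mem⟩ (by fun_prop)
  exact ⟨w, hw, fun x hx => hmax hx⟩

lemma exists_companion_gt (hK : IsCSCD K) {p w : ℝ × ℝ} (hp : p ≠ 0) (h1 : w ∈ interior K)
    (h2 : p + w ∈ interior K) : ∃ x, IsCompanion K p x ∧ wedge p w < wedge p x := by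
  have e1 := hK.eventually_smul_mem h1 (-p.2, p.1)
  have e2 := hK.eventually_smul_mem h2 (-p.2, p.1)
  have h3 : ∀ᶠ ε : ℝ in nhdsWithin 0 (Set.Ioi 0), 0 < ε := self_mem_nhdsWithin
  obtain ⟨ε, hε, h⟩ := (h3.and (nhdsWithin_le_nhds (e1.and e2))).exists
  refine ⟨_, ⟨interior_subset h.1, ?_⟩, ?_⟩
  · rw [← add_assoc]; exact interior_subset h.2
  · have hn : 0 < p.1 ^ 2 + p.2 ^ 2 := by
      rcases eq_or_ne p.1 0 with h1 | h1
      · have h2 : p.2 ≠ 0 := fun h2 => hp (Prod.ext h1 h2)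
        positivity
      · positivity
    simp only [wedge, Prod.fst_add, Prod.snd_add, Prod.smul_fst, Prod.smul_snd, smul_eq_mul]
    nlinarith

lemma not_interior_of_isMaxCompanion (hK : IsCSCD K) {p w : ℝ × ℝ} (hp : p ≠ 0)
    (hw : IsMaxCompanion K p w) (s : ℝ) (h1 : w + s • p ∈ interior K)
    (h2 : w + (s + 1) • p ∈ interior K) : False := by
  obtain ⟨x, hx, hlt⟩ := hK.exists_companion_gt hp h1
    (by rwa [show p + (w + s • p) = w + (s + 1) • p by module])
  have := hw.2 x hx
  rw [wedge_add_right, wedge_smul_right, wedge_self] at hlt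
  linarith

/-- The lattice spanned by a boundary point and a maximal companion avoids the interior. -/
lemma lattice_avoid (hK : IsCSCD K) {p w : ℝ × ℝ} (hp : p ∈ frontier K)
    (hw : IsMaxCompanion K p w) (m n : ℤ) (hmn : m ≠ 0 ∨ n ≠ 0) :
    (m : ℝ) • p + (n : ℝ) • w ∉ interior K := by
  have hp0 := hK.frontier_ne_zero hp
  have hpK := hK.mem_frontier_iff.1 hp
  have key : ∀ m n : ℤ, 0 < n → (m : ℝ) • p + (n : ℝ) • w ∉ interior K := by
    intro m n hn hx
    rcases (show n = 1 ∨ 2 ≤ n by omega) with rfl | h2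
    · obtain hm | hm : 1 ≤ m ∨ m ≤ 0 := by omega
      · have hm' : (1 : ℝ) ≤ m := by exact_mod_cast hm
        obtain ⟨ε, hε, h⟩ := hK.exists_pos_smul_mem hx p
        rw [show (m : ℝ) • p + ((1 : ℤ) : ℝ) • w + ε • p = w + ((m : ℝ) + ε) • p by
          push_cast; module] at h
        have h0 : w + (0 : ℝ) • p ∈ K := by simpa using hw.1.1
        exact hK.not_interior_of_isMaxCompanion hp0 hw (ε / 2)
          (hK.add_smul_mem_interior h h0 (Or.inr ⟨by linarith, by linarith⟩))
          (hK.add_smul_mem_interior h h0 (Or.inr ⟨by linarith, by linarith⟩))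
      · have hm' : (m : ℝ) ≤ 0 := by exact_mod_cast hm
        obtain ⟨ε, hε, h⟩ := hK.exists_pos_smul_mem hx (-p)
        rw [show (m : ℝ) • p + ((1 : ℤ) : ℝ) • w + ε • (-p) = w + ((m : ℝ) - ε) • p by
          push_cast; module] at h
        have h0 : w + (1 : ℝ) • p ∈ K := by simpa [add_comm] using hw.1.2
        exact hK.not_interior_of_isMaxCompanion hp0 hw (-(ε / 2))
          (hK.add_smul_mem_interior h h0 (Or.inl ⟨by linarith, by linarith⟩))
          (hK.add_smul_mem_interior h h0 (Or.inl ⟨by linarith, by linarith⟩))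
    · have hn' : (2 : ℝ) ≤ n := by exact_mod_cast h2
      have hn0 : (0 : ℝ) < n := by linarith
      have hn1 : (0 : ℝ) < n - 1 := by linarith
      have hc : |(n : ℝ) / (2 * (n - 1))| ≤ 1 := by
        rw [abs_of_pos (by positivity), div_le_one (by positivity)]; linarith
      have hs : (1 : ℝ) / n + (n - 1) / n = 1 := by field_simp; ring
      have h1 := hK.combo_interior hx (hK.smul_mem_abs (hK.neg_mem hpK.1) hc)
        (a := 1 / n) (b := (n - 1) / n) (by positivity) (by positivity) hs
      have h2 := hK.combo_interior hx (hK.smul_mem_abs hpK.1 hc)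
        (a := 1 / n) (b := (n - 1) / n) (by positivity) (by positivity) hs
      refine hK.not_interior_of_isMaxCompanion hp0 hw ((m : ℝ) / n - 1 / 2) ?_ ?_
      · convert h1 using 1
        ext <;> simp <;> field_simp <;> ring
      · convert h2 using 1
        ext <;> simp <;> field_simp <;> ring
  rcases lt_trichotomy n 0 with h | rfl | h
  · intro hx
    refine key (-m) (-n) (by omega) ?_
    have := hK.neg_mem_interior hx
    convert this using 1
    push_cast; module
  · intro hx
    have hm : m ≠ 0 := by simpa using hmn
    have h1 : (1 : ℝ) ≤ |(m : ℝ)| := by exact_mod_cast Int.one_le_abs hm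
    have hm' : (m : ℝ) ≠ 0 := by exact_mod_cast hm
    have := hK.smul_interior_mem hx (a := (m : ℝ)⁻¹) (by rw [abs_inv]; exact inv_le_one_of_one_le₀ h1)
    apply hpK.2
    simpa [smul_smul, hm'] using this
  · exact key m n h

/-- A chord of `K` equal to `p` at height `p ∧ m` forces longer chords at lower heights. -/
lemma exists_int_translate_mem_interior (hK : IsCSCD K) {p m x : ℝ × ℝ} (hp : p ∈ K) (hm : m ∈ K)
    (hmp : p + m ∈ K) (h0 : 0 < wedge p x) (h1 : wedge p x < wedge p m) :
    ∃ k : ℤ, x + (k : ℝ) • p ∈ interior K := by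
  have hne : 0 < wedge p m := h0.trans h1
  obtain ⟨θ, hθ⟩ : ∃ θ, θ = wedge p x / wedge p m := ⟨_, rfl⟩
  obtain ⟨s, hs⟩ : ∃ s, s = wedge x m / wedge p m := ⟨_, rfl⟩
  have hx := eq_coords hne.ne' x
  rw [← hθ, ← hs] at hx
  have hθ0 : 0 < θ := by rw [hθ]; positivity
  have hθ1 : θ < 1 := by rw [hθ]; exact (div_lt_one hne).2 h1
  refine ⟨-⌊s⌋, ?_⟩
  obtain ⟨ν, hν⟩ : ∃ ν, ν = Int.fract s := ⟨_, rfl⟩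
  have hν0 : 0 ≤ ν := hν ▸ Int.fract_nonneg s
  have hν1 : ν < 1 := hν ▸ Int.fract_lt_one s
  have hy : x + ((-⌊s⌋ : ℤ) : ℝ) • p = ν • p + θ • m := by
    have : ν = s - ⌊s⌋ := hν
    conv_lhs => rw [hx]
    rw [this]
    push_cast
    module
  rw [hy]
  have trap : ∀ θ ν : ℝ, 0 ≤ θ → θ ≤ 1 → 0 ≤ ν → ν ≤ 1 → ν • p + θ • m ∈ K := by
    intro θ ν h1 h2 h3 h4
    obtain ⟨t, ht⟩ : ∃ t, t = (ν + 1 - θ) / (2 - θ) := ⟨_, rfl⟩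
    have h5 : 0 < 2 - θ := by linarith
    have ht0 : 0 ≤ t := by rw [ht]; apply div_nonneg <;> linarith
    have ht1 : t ≤ 1 := by rw [ht, div_le_one h5]; linarith
    have htm : (1 - t) • m + t • (p + m) ∈ K := hK.combo_mem hm hmp (by linarith) ht0 (by ring)
    have htp : (2 * t - 1) • p ∈ K :=
      hK.smul_mem_abs hp (abs_le.2 ⟨by linarith, by linarith⟩)
    have := hK.combo_mem htm htp (a := θ) (b := 1 - θ) h1 (by linarith) (by ring)
    convert this using 1
    have hν : ν = θ * t + (1 - θ) * (2 * t - 1) := by rw [ht]; field_simp; ring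
    rw [hν]; module
  obtain ⟨M, hM⟩ : ∃ M, M = max θ ν := ⟨_, rfl⟩
  have hM1 : M < 1 := by rw [hM]; exact max_lt hθ1 hν1
  have hMθ : θ ≤ M := by rw [hM]; exact le_max_left _ _
  have hMν : ν ≤ M := by rw [hM]; exact le_max_right _ _
  have hM0 : 0 < M := hθ0.trans_le hMθ
  have := hK.smul_mem_interior (trap (θ / M) (ν / M) (by positivity) ((div_le_one hM0).2 hMθ)
    (by positivity) ((div_le_one hM0).2 hMν)) hM0.le hM1
  rwa [smul_add, smul_smul, smul_smul, mul_div_cancel₀ _ hM0.ne', mul_div_cancel₀ _ hM0.ne'] at this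

lemma isPacking_iff (hK : IsCSCD K) (v w : ℝ × ℝ) :
    IsPacking K (latticeOf v w) ↔ ∀ m n : ℤ, (m : ℝ) • v + (n : ℝ) • w ≠ 0 →
      (1 / 2 : ℝ) • ((m : ℝ) • v + (n : ℝ) • w) ∉ interior K := by
  have himg : ∀ p z : ℝ × ℝ, z ∈ interior ((fun x => p + x) '' K) ↔ z - p ∈ interior K := by
    intro p z
    have := (Homeomorph.addLeft p).image_interior K
    rw [show ((fun x => p + x) '' K) = (Homeomorph.addLeft p) '' K from rfl, ← this]
    constructor
    · rintro ⟨y, hy, rfl⟩; simpa using hy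
    · intro h; exact ⟨z - p, h, by simp⟩
  constructor
  · intro h m n hne hx
    have h1 := h _ ⟨m, n, rfl⟩ 0 ⟨0, 0, by simp⟩ hne
    have : (1 / 2 : ℝ) • ((m : ℝ) • v + (n : ℝ) • w) ∈ (∅ : Set (ℝ × ℝ)) := by
      rw [← h1, Set.mem_inter_iff, himg, himg]
      refine ⟨?_, by simpa using hx⟩
      have := hK.neg_mem_interior hx
      convert this using 1
      module
    exact this
  · rintro h p ⟨m, n, rfl⟩ q ⟨m', n', rfl⟩ hne
    rw [Set.eq_empty_iff_forall_notMem]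
    rintro z ⟨h1, h2⟩
    rw [himg] at h1 h2
    refine h (m - m') (n - n') ?_ ?_
    · intro h0; apply hne; rw [← sub_eq_zero, ← h0]; push_cast; module
    · have := hK.combo_interior h2 (interior_subset (hK.neg_mem_interior h1)) (a := 1 / 2) (b := 1 / 2)
        (by norm_num) (by norm_num) (by norm_num)
      convert this using 1
      push_cast; module

lemma mem_nhds_zero (hK : IsCSCD K) : K ∈ nhds (0 : ℝ × ℝ) :=
  mem_interior_iff_mem_nhds.1 hK.zero_mem_interior

open Pointwise in
lemma four_mul_le_of_packing (hK : IsCSCD K) {c : ℝ} (hA : Adm K c) {v w : ℝ × ℝ}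
    (hvw : wedge v w ≠ 0) (hP : IsPacking K (latticeOf v w)) : 4 * c ≤ |wedge v w| := by
  rw [hK.isPacking_iff] at hP
  by_contra! hlt
  set L : ℤ × ℤ → ℝ × ℝ := fun a => (1 / 2 : ℝ) • ((a.1 : ℝ) • v + (a.2 : ℝ) • w) with hL
  have hLw : ∀ a, wedge (L a) w = a.1 * wedge v w / 2 := fun a => by
    simp only [hL, wedge_smul_left, wedge_add_left, wedge_self]; ring
  have hLv : ∀ a, wedge v (L a) = a.2 * wedge v w / 2 := fun a => by
    simp only [hL, wedge_smul_right, wedge_add_right, wedge_self]; ring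
  have hL0 : ∀ a, L a = 0 → a = 0 := by
    intro a ha
    have h1 := hLw a; have h2 := hLv a
    rw [ha, wedge_zero_left] at h1
    rw [ha, wedge_zero_right] at h2
    have h3 : (a.1 : ℝ) = 0 := by
      rcases mul_eq_zero.1 (show (a.1 : ℝ) * wedge v w = 0 by linarith) with h | h
      exacts [h, absurd h hvw]
    have h4 : (a.2 : ℝ) = 0 := by
      rcases mul_eq_zero.1 (show (a.2 : ℝ) * wedge v w = 0 by linarith) with h | h
      exacts [h, absurd h hvw]
    exact Prod.ext (by exact_mod_cast h3) (by exact_mod_cast h4)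
  have habs : Absorbent ℝ K := absorbent_nhds_zero hK.mem_nhds_zero
  have hbd : Bornology.IsVonNBounded ℝ K := hK.2.1.isVonNBounded ℝ
  have hgpos : ∀ {x : ℝ × ℝ}, x ≠ 0 → 0 < gauge K x := fun {x} hx => (gauge_pos habs hbd).2 hx
  have hgK : ∀ x, gauge K x ≤ 1 ↔ x ∈ K := fun x => by
    rw [gauge_le_one_iff_mem_closure hK.1 hK.mem_nhds_zero, hK.isClosed.closure_eq]
  set S : Set (ℤ × ℤ) := {a | a ≠ 0 ∧ gauge K (L a) ≤ gauge K (L (1, 0))} with hS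
  have hS0 : S.Nonempty := ⟨(1, 0), by simp, le_rfl⟩
  have hSf : S.Finite := by
    set G := gauge K (L (1, 0)) with hG
    have hGpos : 0 < G := hgpos (fun h => by simpa using hL0 _ h)
    have hcmp : IsCompact (G • K) := hK.2.1.smul G
    have hmem : ∀ a ∈ S, L a ∈ G • K := by
      intro a ha
      rw [Set.mem_smul_set_iff_inv_smul_mem₀ hGpos.ne', ← hgK,
        gauge_smul_of_nonneg (by positivity), smul_eq_mul, inv_mul_le_one₀ hGpos]
      exact ha.2
    obtain ⟨R1, hR1⟩ := hcmp.exists_bound_of_continuousOn (f := fun x => wedge x w) (by fun_prop)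
    obtain ⟨R2, hR2⟩ := hcmp.exists_bound_of_continuousOn (f := fun x => wedge v x) (by fun_prop)
    have hv : 0 < |wedge v w| := abs_pos.2 hvw
    set N1 := ⌈2 * R1 / |wedge v w|⌉
    set N2 := ⌈2 * R2 / |wedge v w|⌉
    refine ((Set.finite_Icc (-N1) N1).prod (Set.finite_Icc (-N2) N2)).subset fun a ha => ?_
    have h1 := hR1 _ (hmem a ha)
    have h2 := hR2 _ (hmem a ha)
    simp only [hLw, hLv, Real.norm_eq_abs, abs_div, abs_mul, abs_two] at h1 h2
    have h3 : |(a.1 : ℝ)| ≤ N1 := (show |(a.1 : ℝ)| ≤ 2 * R1 / |wedge v w| by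
      rw [le_div_iff₀ hv]; linarith).trans (Int.le_ceil _)
    have h4 : |(a.2 : ℝ)| ≤ N2 := (show |(a.2 : ℝ)| ≤ 2 * R2 / |wedge v w| by
      rw [le_div_iff₀ hv]; linarith).trans (Int.le_ceil _)
    have h3' : |a.1| ≤ N1 := by exact_mod_cast h3
    have h4' : |a.2| ≤ N2 := by exact_mod_cast h4
    exact ⟨⟨(abs_le.1 h3').1, (abs_le.1 h3').2⟩, ⟨(abs_le.1 h4').1, (abs_le.1 h4').2⟩⟩
  obtain ⟨a, haS, hmin'⟩ := Set.exists_min_image S (fun a => gauge K (L a)) hSf hS0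
  have hmin : ∀ b : ℤ × ℤ, b ≠ 0 → gauge K (L a) ≤ gauge K (L b) := by
    intro b hb
    by_cases h : gauge K (L b) ≤ gauge K (L (1, 0))
    · exact hmin' b ⟨hb, h⟩
    · exact haS.2.trans (le_of_not_ge h)
  have hLa : L a ≠ 0 := fun h => haS.1 (hL0 a h)
  set lam := gauge K (L a) with hlam
  have hlam0 : 0 < lam := hgpos hLa
  have hlam1 : 1 ≤ lam := by
    by_contra! h
    rw [hlam, gauge_lt_one_iff_mem_interior hK.1 hK.mem_nhds_zero] at h
    exact hP a.1 a.2 (fun h0 => hLa (by rw [hL]; simp [h0])) h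
  -- the minimal vector is primitive
  have hgcd : (Int.gcd a.1 a.2 : ℤ) = 1 := by
    have hg0 : (Int.gcd a.1 a.2 : ℤ) ≠ 0 := by
      intro h
      have := Int.gcd_eq_zero_iff.1 (by exact_mod_cast h)
      exact haS.1 (Prod.ext this.1 this.2)
    obtain ⟨m', hm'⟩ := Int.gcd_dvd_left a.1 a.2
    obtain ⟨n', hn'⟩ := Int.gcd_dvd_right a.1 a.2
    set g := (Int.gcd a.1 a.2 : ℤ) with hg
    have hgp : 0 < g := lt_of_le_of_ne (by positivity) (Ne.symm hg0)
    have hgr : (0 : ℝ) < g := by exact_mod_cast hgp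
    have hb : ((m', n') : ℤ × ℤ) ≠ 0 := by
      intro h
      rw [Prod.mk_eq_zero] at h
      exact haS.1 (Prod.ext (by rw [hm', h.1]; simp) (by rw [hn', h.2]; simp))
    have h1 := hmin _ hb
    have hLL : L a = (g : ℝ) • L (m', n') := by
      have h1 : (a.1 : ℝ) = g * m' := by exact_mod_cast hm'
      have h2 : (a.2 : ℝ) = g * n' := by exact_mod_cast hn'
      simp only [hL, h1, h2]; module
    rw [hlam, hLL, gauge_smul_of_nonneg hgr.le, smul_eq_mul] at h1
    have h2 : 0 < gauge K (L (m', n')) := hgpos (fun h => hb (hL0 _ h))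
    have h3 : (g : ℝ) ≤ 1 := by by_contra! h; nlinarith
    have h4 : g ≤ 1 := by exact_mod_cast h3
    omega
  have hbez := Int.gcd_eq_gcd_ab a.1 a.2
  rw [hgcd] at hbez
  set α := Int.gcdA a.1 a.2
  set β := Int.gcdB a.1 a.2
  have hbezr : (1 : ℝ) = a.1 * α + a.2 * β := by exact_mod_cast hbez
  obtain ⟨b, hb⟩ : ∃ b : ℤ × ℤ, wedge (L a) (L b) = |wedge v w| / 4 := by
    have h : wedge (L a) (L (-β, α)) = wedge v w / 4 := by
      simp only [hL, wedge_smul_right, wedge_smul_left, wedge_add_left, wedge_add_right, wedge_self,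
        wedge_swap w v]
      push_cast
      linear_combination (-wedge v w / 4) * hbezr
    rcases le_total 0 (wedge v w) with h0 | h0
    · exact ⟨_, by rw [h, abs_of_nonneg h0]⟩
    · refine ⟨(β, -α), ?_⟩
      rw [abs_of_nonpos h0, show L (β, -α) = -L (-β, α) by simp only [hL]; push_cast; module,
        wedge_neg_right, h]
      ring
  set p := lam⁻¹ • L a with hp
  have hpf : p ∈ frontier K := by
    rw [← gauge_eq_one_iff_mem_frontier hK.1 hK.mem_nhds_zero, hp,
      gauge_smul_of_nonneg (by positivity), smul_eq_mul, ← hlam, inv_mul_cancel₀ hlam0.ne']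
  obtain ⟨m, hm, hcm⟩ := hA p hpf
  have hpx : wedge p (lam⁻¹ • L b) = |wedge v w| / 4 / lam ^ 2 := by
    rw [hp, wedge_smul_left, wedge_smul_right, hb]; field_simp
  have hv : 0 < |wedge v w| := abs_pos.2 hvw
  obtain ⟨k, hk⟩ := hK.exists_int_translate_mem_interior (x := lam⁻¹ • L b)
    (hK.mem_frontier_iff.1 hpf).1 hm.1 hm.2
    (by rw [hpx]; positivity)
    (by
      rw [hpx]
      have : |wedge v w| / 4 / lam ^ 2 ≤ |wedge v w| / 4 :=
        div_le_self (by positivity) (one_le_pow₀ hlam1)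
      linarith)
  have hLadd : L (b + k • a) = L b + (k : ℝ) • L a := by
    have h1 : (b + k • a).1 = b.1 + k * a.1 := by simp
    have h2 : (b + k • a).2 = b.2 + k * a.2 := by simp
    simp only [hL, h1, h2]
    push_cast
    module
  have hLs : lam⁻¹ • L b + (k : ℝ) • p = lam⁻¹ • L (b + k • a) := by
    rw [hp, hLadd]; module
  rw [hLs, ← gauge_lt_one_iff_mem_interior hK.1 hK.mem_nhds_zero,
    gauge_smul_of_nonneg (by positivity), smul_eq_mul, inv_mul_lt_one₀ hlam0] at hk
  have hne : b + k • a ≠ 0 := by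
    intro h
    have : wedge (L a) (L (b + k • a)) = |wedge v w| / 4 := by
      rw [hLadd, wedge_add_right, wedge_smul_right _ (L a) (L a), wedge_self, hb]; ring
    rw [h] at this
    have hz : L 0 = 0 := by simp [hL]
    rw [hz, wedge_zero_right] at this
    linarith
  exact absurd (hmin _ hne) (not_le.2 hk)

lemma adm_pos (hK : IsCSCD K) : ∃ c, 0 < c ∧ Adm K c := by
  obtain ⟨δ, hδ, hb⟩ := Metric.mem_nhds_iff.1 hK.mem_nhds_zero
  refine ⟨δ ^ 2 / 8, by positivity, fun p hp => ?_⟩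
  have hpK := hK.mem_frontier_iff.1 hp
  have hpn : δ ≤ ‖p‖ := by
    by_contra! h
    refine hpK.2 (interior_mono hb ?_)
    rw [Metric.isOpen_ball.interior_eq]; simpa using h
  have hpp : 0 < ‖p‖ := hδ.trans_le hpn
  set n : ℝ × ℝ := (-p.2, p.1) with hn
  have hnn : ‖n‖ = ‖p‖ := by
    rw [Prod.norm_def, Prod.norm_def, hn]; simp [max_comm]
  have hnK : (δ / (2 * ‖p‖)) • n ∈ K := by
    apply hb
    rw [mem_ball_zero_iff, norm_smul, hnn, Real.norm_of_nonneg (by positivity)]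
    rw [show δ / (2 * ‖p‖) * ‖p‖ = δ / 2 by field_simp]; linarith
  have hpn2 : ‖p‖ ^ 2 ≤ p.1 ^ 2 + p.2 ^ 2 := by
    rw [Prod.norm_def]
    rcases max_choice ‖p.1‖ ‖p.2‖ with h | h <;> rw [h, Real.norm_eq_abs, sq_abs]
    · nlinarith [sq_nonneg p.2]
    · nlinarith [sq_nonneg p.1]
  refine ⟨(1 / 2 : ℝ) • (-p) + (1 / 2 : ℝ) • ((δ / (2 * ‖p‖)) • n),
    ⟨hK.combo_mem (hK.neg_mem hpK.1) hnK (by norm_num) (by norm_num) (by norm_num), ?_⟩, ?_⟩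
  · have := hK.combo_mem hpK.1 hnK (a := 1 / 2) (b := 1 / 2) (by norm_num) (by norm_num)
      (by norm_num)
    convert this using 1
    module
  · have : wedge p n = p.1 ^ 2 + p.2 ^ 2 := by rw [hn]; simp only [wedge]; ring
    simp only [wedge_add_right, wedge_smul_right, wedge_neg_right, wedge_self, this]
    have h1 : δ ^ 2 / 8 ≤ δ / (4 * ‖p‖) * ‖p‖ ^ 2 := by
      rw [show δ / (4 * ‖p‖) * ‖p‖ ^ 2 = δ * ‖p‖ / 4 by field_simp]
      nlinarith
    have h2 : δ / (4 * ‖p‖) * ‖p‖ ^ 2 ≤ δ / (4 * ‖p‖) * (p.1 ^ 2 + p.2 ^ 2) :=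
      mul_le_mul_of_nonneg_left hpn2 (by positivity)
    have h3 : δ / (2 * ‖p‖) = 2 * (δ / (4 * ‖p‖)) := by field_simp; ring
    rw [h3]; linarith

lemma volume_pos (hK : IsCSCD K) : 0 < (volume K).toReal := by
  refine ENNReal.toReal_pos (Measure.measure_pos_of_mem_nhds volume hK.mem_nhds_zero).ne' ?_
  exact hK.2.1.measure_lt_top.ne

lemma deltaLat_le (hK : IsCSCD K) {c : ℝ} (hc : 0 < c) (hA : Adm K c) :
    deltaLat K ≤ (volume K).toReal / (4 * c) := by
  refine Real.sSup_le ?_ (by have := hK.volume_pos; positivity)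
  rintro d ⟨v, w, hvw, hP, rfl⟩
  have := hK.volume_pos
  exact div_le_div_of_nonneg_left this.le (by positivity) (hK.four_mul_le_of_packing hA hvw hP)

lemma bddAbove_packingDensities (hK : IsCSCD K) : BddAbove (packingDensities K) := by
  obtain ⟨c, hc, hA⟩ := hK.adm_pos
  refine ⟨(volume K).toReal / (4 * c), ?_⟩
  rintro d ⟨v, w, hvw, hP, rfl⟩
  have := hK.volume_pos
  exact div_le_div_of_nonneg_left this.le (by positivity) (hK.four_mul_le_of_packing hA hvw hP)

lemma le_deltaLat (hK : IsCSCD K) {p w : ℝ × ℝ} (hp : p ∈ frontier K) (hw : IsMaxCompanion K p w)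
    (h : 0 < wedge p w) : (volume K).toReal / (4 * wedge p w) ≤ deltaLat K := by
  refine le_csSup hK.bddAbove_packingDensities ⟨(2 : ℝ) • p, (2 : ℝ) • w, ?_, ?_, ?_⟩
  · rw [wedge_smul_left, wedge_smul_right]; positivity
  · rw [hK.isPacking_iff]
    intro m n hne
    have : (1 / 2 : ℝ) • ((m : ℝ) • (2 : ℝ) • p + (n : ℝ) • (2 : ℝ) • w)
        = (m : ℝ) • p + (n : ℝ) • w := by module
    rw [this]
    refine hK.lattice_avoid hp hw m n ?_
    by_contra! h0
    exact hne (by simp [h0.1, h0.2])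
  · rw [wedge_smul_left, wedge_smul_right, abs_of_pos (by positivity)]; ring_nf

end IsCSCD

/-- `K` satisfies `Adm K c` and has the least area among all domains with that property. -/
def IsAreaMin (K : Set (ℝ × ℝ)) (c : ℝ) : Prop :=
  IsCSCD K ∧ 0 < c ∧ Adm K c ∧
    ∀ K', IsCSCD K' → Adm K' c → (volume K).toReal ≤ (volume K').toReal

lemma IsMiserly.exists_isAreaMin {K : Set (ℝ × ℝ)} (h : IsMiserly K) : ∃ c, IsAreaMin K c := by
  obtain ⟨hK, hmin⟩ := h
  have hV := hK.volume_pos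
  obtain ⟨c0, hc0, hA0⟩ := hK.adm_pos
  have hmax : ∀ p w, p ∈ frontier K → IsMaxCompanion K p w → 0 < wedge p w := by
    intro p w hp hw
    obtain ⟨x, hx, hcx⟩ := hA0 p hp
    exact hc0.trans_le (hcx.trans (hw.2 x hx))
  have hD : 0 < deltaLat K := by
    obtain ⟨μ, _, hp⟩ := hK.exists_frontier_ray (x := (1, 0)) (by simp)
    obtain ⟨w, hw⟩ := hK.exists_isMaxCompanion (hK.mem_frontier_iff.1 hp).1
    have h1 := hmax _ w hp hw
    exact (by positivity : 0 < (volume K).toReal / (4 * wedge (μ • (1, 0)) w)).trans_le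
      (hK.le_deltaLat hp hw h1)
  refine ⟨(volume K).toReal / (4 * deltaLat K), hK, by positivity, fun p hp => ?_,
    fun K' hK' hA' => ?_⟩
  · obtain ⟨w, hw⟩ := hK.exists_isMaxCompanion (hK.mem_frontier_iff.1 hp).1
    have h1 := hmax _ w hp hw
    have h2 := hK.le_deltaLat hp hw h1
    refine ⟨w, hw.1, ?_⟩
    rw [div_le_iff₀ (by positivity)] at h2 ⊢
    linarith
  · have h1 := (hmin K' hK').trans (hK'.deltaLat_le (by positivity) hA')
    rw [show (volume K').toReal / (4 * ((volume K).toReal / (4 * deltaLat K)))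
      = (volume K').toReal * deltaLat K / (volume K).toReal by field_simp, le_div_iff₀ hV] at h1
    nlinarith

/-- `p` is a point of strict convexity of `K`. -/
def StrictAt (K : Set (ℝ × ℝ)) (p : ℝ × ℝ) : Prop :=
  ∀ x ∈ K, x ≠ p → (1 / 2 : ℝ) • (p + x) ∈ interior K

lemma IsCompanion.neg {K : Set (ℝ × ℝ)} (hK : IsCSCD K) {p w : ℝ × ℝ} (h : IsCompanion K p w) :
    IsCompanion K (-p) (-w) :=
  ⟨hK.neg_mem h.1, by rw [← neg_add]; exact hK.neg_mem h.2⟩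

lemma IsCSCD.exists_ultrafilter_limit {K : Set (ℝ × ℝ)} (hK : IsCSCD K) (U : Ultrafilter ℕ)
    {x : ℕ → ℝ × ℝ} (hx : ∀ n, x n ∈ K) : ∃ y ∈ K, Filter.Tendsto x U (nhds y) :=
  hK.2.1.ultrafilter_le_nhds' (U.map x) (Filter.univ_mem' (f := (U : Filter ℕ)) hx)

/-- Cutting off a strictly convex boundary point keeps admissibility when that point has a
companion spanning area more than `c`; this contradicts minimality. -/
lemma IsAreaMin.wedge_le {K : Set (ℝ × ℝ)} {c : ℝ} (h : IsAreaMin K c) {p : ℝ × ℝ}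
    (hp : p ∈ frontier K) (hs : StrictAt K p) {w : ℝ × ℝ} (hw : IsCompanion K p w) :
    wedge p w ≤ c := by
  obtain ⟨hK, hc, hA, hmin⟩ := h
  by_contra! hlt
  have hpK := hK.mem_frontier_iff.1 hp
  obtain ⟨f, hf0, hfle, hfi⟩ := hK.exists_support hpK.2
  set h := f p with hh
  have hle : ∀ x ∈ K, |f x| ≤ h := fun x hx => abs_le.2
    ⟨by have := hfle _ (hK.neg_mem hx); rw [map_neg] at this; linarith, hfle x hx⟩
  have hlti : ∀ x ∈ interior K, |f x| < h := fun x hx => abs_lt.2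
    ⟨by have := hfi _ (hK.neg_mem_interior hx); rw [map_neg] at this; linarith, hfi x hx⟩
  have hstr : ∀ x ∈ K, x ≠ p → f x < h := by
    intro x hx hne
    have := hfi _ (hs x hx hne)
    rw [map_smul, map_add, smul_eq_mul, ← hh] at this
    linarith
  have hstr' : ∀ x ∈ K, h ≤ |f x| → x = p ∨ x = -p := by
    intro x hx h1
    by_contra! hne
    have h2 := hstr x hx hne.1
    have h3 := hstr (-x) (hK.neg_mem hx) (fun h => hne.2 (by rw [← h]; simp))
    rw [map_neg] at h3
    exact absurd h1 (not_le.2 (abs_lt.2 ⟨by linarith, h2⟩))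
  -- the truncated domains
  set δ : ℕ → ℝ := fun n => 1 / ((n : ℝ) + 2) with hδ
  have hδ0 : ∀ n, 0 < δ n := fun n => by simp only [hδ]; positivity
  have hδ1 : ∀ n, δ n < 1 := fun n => by
    simp only [hδ]; rw [div_lt_one (by positivity)]
    have : (0 : ℝ) ≤ n := by positivity
    linarith
  set Kd : ℕ → Set (ℝ × ℝ) := fun n => K ∩ {x | |f x| ≤ (1 - δ n) * h} with hKd
  have h_int : ∀ n x, x ∈ interior K → |f x| < (1 - δ n) * h → x ∈ interior (Kd n) := by
    intro n x hx hfx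
    rw [hKd, interior_inter]
    refine ⟨hx, ?_⟩
    refine interior_mono (s := {x | |f x| < (1 - δ n) * h}) (fun y hy => ?_) ?_
    · simp only [Set.mem_ofPred_eq] at hy ⊢; exact hy.le
    rw [(isOpen_lt (by fun_prop) (by fun_prop)).interior_eq]
    exact hfx
  have hKd' : ∀ n, IsCSCD (Kd n) := by
    intro n
    refine ⟨hK.1.inter ?_, hK.2.1.inter_right (isClosed_le (by fun_prop) (by fun_prop)),
      ⟨0, h_int n 0 hK.zero_mem_interior ?_⟩, ?_⟩
    · have h1 : Convex ℝ {x | f x ≤ (1 - δ n) * h} := convex_halfSpace_le f.toLinearMap.isLinear _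
      have h2 : Convex ℝ {x | -((1 - δ n) * h) ≤ f x} := convex_halfSpace_ge f.toLinearMap.isLinear _
      convert h1.inter h2 using 1
      ext x
      simp only [Set.mem_ofPred_eq, Set.mem_inter_iff, abs_le]
      tauto
    · rw [map_zero, abs_zero]; exact mul_pos (by linarith [hδ1 n]) hf0
    · ext x
      simp [hKd, hK.neg_mem_iff]
  have hvol : ∀ n, (volume (Kd n)).toReal < (volume K).toReal := by
    intro n
    have hfin : volume K ≠ ⊤ := hK.2.1.measure_lt_top.ne
    have hsub : Kd n ⊆ K := Set.inter_subset_left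
    set O : Set (ℝ × ℝ) := interior K ∩ {x | (1 - δ n) * h < f x} with hO
    have hOo : IsOpen O := isOpen_interior.inter (isOpen_lt (by fun_prop) (by fun_prop))
    have hOne : O.Nonempty := by
      refine ⟨(1 - δ n / 2) • p, hK.smul_mem_interior hpK.1 (by linarith [hδ1 n])
        (by linarith [hδ0 n]), ?_⟩
      simp only [Set.mem_ofPred_eq, map_smul, smul_eq_mul, ← hh]
      nlinarith [hδ0 n]
    have hpos := hOo.measure_pos volume hOne
    have hdisj : Disjoint (Kd n) O := by
      rw [Set.disjoint_left]
      rintro x ⟨_, hx⟩ ⟨_, hx2⟩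
      simp only [Set.mem_ofPred_eq] at hx hx2
      linarith [le_abs_self (f x)]
    have hsum : volume (Kd n) + volume O ≤ volume K := by
      rw [← measure_union hdisj hOo.measurableSet]
      exact measure_mono (Set.union_subset hsub (Set.inter_subset_left.trans interior_subset))
    have hfin1 : volume (Kd n) ≠ ⊤ := ne_top_of_le_ne_top hfin (measure_mono hsub)
    refine ENNReal.toReal_strict_mono hfin (lt_of_lt_of_le ?_ hsum)
    exact ENNReal.lt_add_right hfin1 hpos.ne'
  have hnA : ∀ n, ∃ q ∈ frontier (Kd n), ∀ w, IsCompanion (Kd n) q w → wedge q w < c := by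
    intro n
    by_contra! hcon
    exact absurd (hmin (Kd n) (hKd' n) hcon) (not_le.2 (hvol n))
  choose q hqf hq using hnA
  have hqK : ∀ n, q n ∈ Kd n := fun n => ((hKd' n).mem_frontier_iff.1 (hqf n)).1
  have hqni : ∀ n, q n ∉ interior (Kd n) := fun n => ((hKd' n).mem_frontier_iff.1 (hqf n)).2
  set U : Ultrafilter ℕ := Filter.hyperfilter ℕ with hU
  have hUt : (U : Filter ℕ) ≤ Filter.atTop := Nat.hyperfilter_le_atTop
  have hδt : Filter.Tendsto (fun n => (1 - δ n) * h) U (nhds h) := by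
    have h1 : Filter.Tendsto (fun n : ℕ => (1 : ℝ) / ((n : ℝ) + 2)) Filter.atTop (nhds 0) := by
      have := (Filter.tendsto_add_atTop_iff_nat 2).2
        (tendsto_one_div_atTop_nhds_zero_nat (𝕜 := ℝ))
      simpa using this
    have h2 := ((tendsto_const_nhds (x := (1 : ℝ))).sub h1).mul_const h
    simp only [sub_zero, one_mul] at h2
    exact h2.mono_left hUt
  obtain ⟨p', hp'K, hp't⟩ := hK.exists_ultrafilter_limit U (fun n => (hqK n).1)
  have evint : ∀ (x : ℕ → ℝ × ℝ) (y : ℝ × ℝ), Filter.Tendsto x U (nhds y) → y ∈ interior K →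
      ∀ᶠ n in U, x n ∈ interior (Kd n) := by
    intro x y hx hy
    have h1 := hx.eventually_mem (isOpen_interior.mem_nhds hy)
    have h2 : Filter.Tendsto (fun n => |f (x n)|) U (nhds |f y|) :=
      ((continuous_abs.comp f.continuous).tendsto y).comp hx
    filter_upwards [h1, h2.eventually_lt hδt (hlti y hy)] with n h3 h4
    exact h_int n _ h3 h4
  have hp'f : p' ∈ frontier K := by
    refine hK.mem_frontier_iff.2 ⟨hp'K, fun hi => ?_⟩
    obtain ⟨n, hn⟩ := (evint _ _ hp't hi).exists
    exact hqni n hn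
  have hclaim : ∀ w', IsCompanion K p' w' → wedge p' w' ≤ c := by
    intro w' hw'
    by_contra! hgt
    have hpos : 0 < wedge p' w' := hc.trans hgt
    obtain ⟨κ, hκ⟩ : ∃ κ, κ = (wedge p' w' - c) / (2 * wedge p' w') := ⟨_, rfl⟩
    have hκ0 : 0 < κ := by rw [hκ]; exact div_pos (by linarith) (by linarith)
    have hκ1 : κ < 1 := by rw [hκ, div_lt_one (by linarith)]; linarith
    have hκc : c < (1 - κ) * wedge p' w' := by
      have : κ * wedge p' w' = (wedge p' w' - c) / 2 := by rw [hκ]; field_simp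
      nlinarith
    set M := w' + (1 / 2 : ℝ) • p' with hM
    have t1 : Filter.Tendsto (fun n => (1 - κ) • M - (1 / 2 : ℝ) • q n) U
        (nhds ((1 - κ) • M - (1 / 2 : ℝ) • p')) := tendsto_const_nhds.sub (hp't.const_smul _)
    have t2 : Filter.Tendsto (fun n => q n + ((1 - κ) • M - (1 / 2 : ℝ) • q n)) U
        (nhds (p' + ((1 - κ) • M - (1 / 2 : ℝ) • p'))) := hp't.add t1
    have i1 : (1 - κ) • M - (1 / 2 : ℝ) • p' ∈ interior K := by
      have h1 := hK.combo_interior (hK.smul_mem_interior (hK.neg_mem hp'K) (a := 1 / 2) (by norm_num)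
        (by norm_num)) hw'.1 hκ0 (b := 1 - κ) (by linarith) (by ring)
      convert h1 using 1
      rw [hM]; module
    have i2 : p' + ((1 - κ) • M - (1 / 2 : ℝ) • p') ∈ interior K := by
      have h1 := hK.combo_interior (hK.smul_mem_interior hp'K (a := 1 / 2) (by norm_num)
        (by norm_num)) hw'.2 hκ0 (b := 1 - κ) (by linarith) (by ring)
      convert h1 using 1
      rw [hM]; module
    have t3 : Filter.Tendsto (fun n => wedge (q n) ((1 - κ) • M - (1 / 2 : ℝ) • q n)) U
        (nhds (wedge p' ((1 - κ) • M - (1 / 2 : ℝ) • p'))) := hp't.wedge t1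
    have hval : wedge p' ((1 - κ) • M - (1 / 2 : ℝ) • p') = (1 - κ) * wedge p' w' := by
      rw [hM]
      simp only [wedge_sub_right, wedge_smul_right, wedge_add_right, wedge_self]; ring
    rw [hval] at t3
    obtain ⟨n, ⟨h1, h2⟩, h3⟩ := (((evint _ _ t1 i1).and (evint _ _ t2 i2)).and
      (t3.eventually_const_lt hκc)).exists
    exact absurd (hq n _ ⟨interior_subset h1, interior_subset h2⟩) (not_lt.2 h3.le)
  have hne : p' ≠ p ∧ p' ≠ -p := by
    constructor
    · rintro rfl; exact absurd (hclaim w hw) (not_le.2 hlt)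
    · rintro rfl
      have := hclaim (-w) (hw.neg hK)
      rw [wedge_neg_left, wedge_neg_right, neg_neg] at this
      linarith
  have hfp' : |f p'| < h := by
    by_contra! h1
    rcases hstr' p' hp'K h1 with h2 | h2
    exacts [hne.1 h2, hne.2 h2]
  have hqfK : ∀ᶠ n in U, q n ∈ frontier K := by
    have h2 : Filter.Tendsto (fun n => |f (q n)|) U (nhds |f p'|) :=
      ((continuous_abs.comp f.continuous).tendsto p').comp hp't
    filter_upwards [h2.eventually_lt hδt hfp'] with n hn
    exact hK.mem_frontier_iff.2 ⟨(hqK n).1, fun hi => hqni n (h_int n _ hi hn)⟩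
  have hex : ∀ n, ∃ w ∈ K, q n ∈ frontier K → IsCompanion K (q n) w ∧ c ≤ wedge (q n) w := by
    intro n
    by_cases hn : q n ∈ frontier K
    · obtain ⟨w, hw, hcw⟩ := hA _ hn
      exact ⟨w, hw.1, fun _ => ⟨hw, hcw⟩⟩
    · exact ⟨0, hK.zero_mem, fun h => absurd h hn⟩
  choose v hvK hv using hex
  obtain ⟨w', hw'K, hw't⟩ := hK.exists_ultrafilter_limit U hvK
  have hadd : Filter.Tendsto (fun n => q n + v n) U (nhds (p' + w')) := hp't.add hw't
  have hcomp : IsCompanion K p' w' := by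
    refine ⟨hw'K, hK.isClosed.mem_of_tendsto hadd ?_⟩
    filter_upwards [hqfK] with n hn
    exact (hv n hn).1.2
  have hcw' : c ≤ wedge p' w' := by
    refine ge_of_tendsto (hp't.wedge hw't) ?_
    filter_upwards [hqfK] with n hn
    exact (hv n hn).2
  have hmaxw : IsMaxCompanion K p' w' := ⟨hcomp, fun x hx => (hclaim x hx).trans hcw'⟩
  have hceq : wedge p' w' = c := le_antisymm (hclaim w' hcomp) hcw'
  have hmax : h ≤ max |f w'| |f (p' + w')| := by
    have t1 : Filter.Tendsto (fun n => max |f (v n)| |f (q n + v n)|) U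
        (nhds (max |f w'| |f (p' + w')|)) :=
      (((continuous_abs.comp f.continuous).tendsto w').comp hw't).max
        (((continuous_abs.comp f.continuous).tendsto _).comp hadd)
    refine le_of_tendsto_of_tendsto hδt t1 ?_
    filter_upwards [hqfK] with n hn
    by_contra! hlt'
    rw [max_lt_iff] at hlt'
    obtain ⟨h1, h2⟩ := hv n hn
    exact absurd (hq n (v n) ⟨⟨h1.1, hlt'.1.le⟩, ⟨h1.2, hlt'.2.le⟩⟩) (not_lt.2 h2)
  have hav := hK.lattice_avoid hp'f hmaxw
  have hfour : (w' = p ∨ w' = -p) ∨ (p' + w' = p ∨ p' + w' = -p) := by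
    rcases le_max_iff.1 hmax with h1 | h1
    · exact Or.inl (hstr' _ hcomp.1 h1)
    · exact Or.inr (hstr' _ hcomp.2 h1)
  have chord : ∀ x, wedge p x = c → ∃ k : ℤ, x + (k : ℝ) • p ∈ interior K := fun x hx =>
    hK.exists_int_translate_mem_interior hpK.1 hw.1 hw.2 (by rw [hx]; exact hc) (by rw [hx]; exact hlt)
  rcases hfour with (h1 | h1) | (h1 | h1)
  · obtain ⟨k, hk⟩ := chord (-p') (by rw [wedge_neg_right, ← wedge_swap, ← h1, hceq])
    refine hav (-1) k (by simp) ?_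
    convert hk using 1
    rw [h1]; push_cast; module
  · obtain ⟨k, hk⟩ := chord p' (by
      rw [show p = -w' by rw [h1, neg_neg], wedge_neg_left, ← wedge_swap, hceq])
    refine hav 1 (-k) (by simp) ?_
    convert hk using 1
    rw [h1]; push_cast; module
  · obtain ⟨k, hk⟩ := chord (-p') (by
      rw [← h1, wedge_neg_right, ← wedge_swap, wedge_add_right, wedge_self, hceq, zero_add])
    refine hav (k - 1) k (by omega) ?_
    convert hk using 1
    rw [← h1]; push_cast; module
  · obtain ⟨k, hk⟩ := chord p' (by
      rw [show p = -(p' + w') by rw [h1, neg_neg], wedge_neg_left, ← wedge_swap, wedge_add_right,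
        wedge_self, hceq, zero_add])
    refine hav (1 - k) (-k) (by omega) ?_
    convert hk using 1
    rw [show p = -(p' + w') by rw [h1, neg_neg]]; push_cast; module

namespace IsCSCD

variable {K : Set (ℝ × ℝ)} {σ : ℝ → ℝ × ℝ} {d : ℝ × ℝ} {t : ℝ}

lemma support_deriv_eq_zero {f : (ℝ × ℝ) →L[ℝ] ℝ} (hσ : HasDerivAt σ d t)
    (hev : ∀ᶠ s in nhds t, σ s ∈ K) (hf : ∀ x ∈ K, f x ≤ f (σ t)) : f d = 0 := by
  have h1 : HasDerivAt (fun s => f (σ s)) (f d) t := f.hasFDerivAt.comp_hasDerivAt t hσ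
  have h2 : IsLocalMax (fun s => f (σ s)) t := by
    filter_upwards [hev] with s hs using hf _ hs
  exact h2.hasDerivAt_eq_zero h1

lemma wedge_deriv_ne_zero (hK : IsCSCD K) (hσ : HasDerivAt σ d t)
    (hev : ∀ᶠ s in nhds t, σ s ∈ K) (h0 : σ t ∉ interior K) (hd : d ≠ 0) :
    wedge (σ t) d ≠ 0 := by
  obtain ⟨f, hf0, hf, -⟩ := hK.exists_support h0
  intro h
  have hz : σ t ≠ 0 := fun h => by rw [h, map_zero] at hf0; exact lt_irrefl _ hf0
  obtain ⟨a, rfl⟩ := eq_smul_of_wedge_eq_zero hz h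
  have := support_deriv_eq_zero hσ hev hf
  rw [map_smul, smul_eq_mul, mul_eq_zero] at this
  rcases this with rfl | h
  · simp at hd
  · exact hf0.ne' h

lemma support_apply {f : (ℝ × ℝ) →L[ℝ] ℝ} {z d : ℝ × ℝ} (hfd : f d = 0) (x : ℝ × ℝ) :
    wedge z d * f x = wedge x d * f z := by
  have := congrArg f (wedge_smul_eq z d x)
  simpa [hfd] using this

lemma tangent_nonneg (hK : IsCSCD K) (hσ : HasDerivAt σ d t)
    (hev : ∀ᶠ s in nhds t, σ s ∈ K) (h0 : σ t ∉ interior K) (hd : 0 < wedge (σ t) d)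
    {x : ℝ × ℝ} (hx : x ∈ K) : 0 ≤ wedge d (x - σ t) := by
  obtain ⟨f, hf0, hf, -⟩ := hK.exists_support h0
  have h1 := support_apply (support_deriv_eq_zero hσ hev hf) (z := σ t) x
  have h2 := hf x hx
  rw [wedge_sub_right, wedge_swap d x, wedge_swap d (σ t)]
  have : wedge x d * f (σ t) ≤ wedge (σ t) d * f (σ t) := by
    rw [← h1]; exact mul_le_mul_of_nonneg_left h2 hd.le
  have := le_of_mul_le_mul_right this hf0
  linarith

lemma tangent_pos (hK : IsCSCD K) (hσ : HasDerivAt σ d t)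
    (hev : ∀ᶠ s in nhds t, σ s ∈ K) (h0 : σ t ∉ interior K) (hd : 0 < wedge (σ t) d)
    {x : ℝ × ℝ} (hx : x ∈ interior K) : 0 < wedge d (x - σ t) := by
  obtain ⟨f, hf0, hf, hf'⟩ := hK.exists_support h0
  have h1 := support_apply (support_deriv_eq_zero hσ hev hf) (z := σ t) x
  have h2 := hf' x hx
  rw [wedge_sub_right, wedge_swap d x, wedge_swap d (σ t)]
  have : wedge x d * f (σ t) < wedge (σ t) d * f (σ t) := by
    rw [← h1]; exact mul_lt_mul_of_pos_left h2 hd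
  have := lt_of_mul_lt_mul_right this hf0.le
  linarith

end IsCSCD

/-- A twice continuously differentiable boundary arc, positively oriented. -/
structure Arc (K : Set (ℝ × ℝ)) (σ : ℝ → ℝ × ℝ) (a b : ℝ) : Prop where
  smooth : ContDiffOn ℝ 2 σ (Set.Ioo a b)
  mem : ∀ t ∈ Set.Ioo a b, σ t ∈ frontier K
  pos : ∀ t ∈ Set.Ioo a b, 0 < wedge (σ t) (deriv σ t)

section smooth

variable {σ : ℝ → ℝ × ℝ} {a b t : ℝ}

lemma ContDiffOn.contDiffOn_deriv_Ioo (h : ContDiffOn ℝ 2 σ (Set.Ioo a b)) :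
    ContDiffOn ℝ 1 (deriv σ) (Set.Ioo a b) :=
  ((contDiffOn_succ_iff_deriv_of_isOpen (n := 1) isOpen_Ioo).1 h).2.2

lemma ContDiffOn.hasDerivAt_Ioo (h : ContDiffOn ℝ 2 σ (Set.Ioo a b)) (ht : t ∈ Set.Ioo a b) :
    HasDerivAt σ (deriv σ t) t :=
  (((h t ht).contDiffAt (isOpen_Ioo.mem_nhds ht)).differentiableAt (by norm_num)).hasDerivAt

lemma ContDiffOn.hasDerivAt_deriv_Ioo (h : ContDiffOn ℝ 2 σ (Set.Ioo a b))
    (ht : t ∈ Set.Ioo a b) : HasDerivAt (deriv σ) (deriv (deriv σ) t) t :=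
  (((h.contDiffOn_deriv_Ioo t ht).contDiffAt (isOpen_Ioo.mem_nhds ht)).differentiableAt
    (by norm_num)).hasDerivAt

lemma ContDiffOn.continuousOn_deriv_deriv_Ioo (h : ContDiffOn ℝ 2 σ (Set.Ioo a b)) :
    ContinuousOn (deriv (deriv σ)) (Set.Ioo a b) :=
  (h.contDiffOn_deriv_Ioo).continuousOn_deriv_of_isOpen isOpen_Ioo (by norm_num)

end smooth

namespace Arc

variable {K : Set (ℝ × ℝ)} {σ : ℝ → ℝ × ℝ} {a b t : ℝ}

lemma mono (h : Arc K σ a b) {a' b' : ℝ} (hs : Set.Ioo a' b' ⊆ Set.Ioo a b) : Arc K σ a' b' :=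
  ⟨h.smooth.mono hs, fun t ht => h.mem t (hs ht), fun t ht => h.pos t (hs ht)⟩

lemma eventually_mem (h : Arc K σ a b) (hK : IsCSCD K) (ht : t ∈ Set.Ioo a b) :
    ∀ᶠ s in nhds t, σ s ∈ K := by
  filter_upwards [isOpen_Ioo.mem_nhds ht] with s hs
  exact (hK.mem_frontier_iff.1 (h.mem s hs)).1

lemma tangent_nonneg (h : Arc K σ a b) (hK : IsCSCD K) (ht : t ∈ Set.Ioo a b) {x : ℝ × ℝ}
    (hx : x ∈ K) : 0 ≤ wedge (deriv σ t) (x - σ t) :=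
  hK.tangent_nonneg (h.smooth.hasDerivAt_Ioo ht) (h.eventually_mem hK ht)
    (hK.mem_frontier_iff.1 (h.mem t ht)).2 (h.pos t ht) hx

lemma tangent_pos (h : Arc K σ a b) (hK : IsCSCD K) (ht : t ∈ Set.Ioo a b) {x : ℝ × ℝ}
    (hx : x ∈ interior K) : 0 < wedge (deriv σ t) (x - σ t) :=
  hK.tangent_pos (h.smooth.hasDerivAt_Ioo ht) (h.eventually_mem hK ht)
    (hK.mem_frontier_iff.1 (h.mem t ht)).2 (h.pos t ht) hx

lemma tangent_pos_of_strictAt (h : Arc K σ a b) (hK : IsCSCD K) (ht : t ∈ Set.Ioo a b)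
    (hs : StrictAt K (σ t)) {x : ℝ × ℝ} (hx : x ∈ K) (hne : x ≠ σ t) :
    0 < wedge (deriv σ t) (x - σ t) := by
  have := h.tangent_pos hK ht (hs x hx hne)
  rw [show (1 / 2 : ℝ) • (σ t + x) - σ t = (1 / 2 : ℝ) • (x - σ t) by module,
    wedge_smul_right] at this
  linarith

lemma strictAt (h : Arc K σ a b) (hK : IsCSCD K) (ht : t ∈ Set.Ioo a b)
    (hc : wedge (deriv σ t) (deriv (deriv σ) t) ≠ 0) : StrictAt K (σ t) := by
  intro x hx hne
  by_contra hni
  obtain ⟨f, hf0, hf, -⟩ := hK.exists_support hni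
  have hσK := (hK.mem_frontier_iff.1 (h.mem t ht)).1
  have h1 := hf _ hσK
  have h2 := hf x hx
  rw [map_smul, map_add, smul_eq_mul] at h1 h2 hf0
  have h3 : f x = f (σ t) := by linarith
  have hd : f (deriv σ t) = 0 := by
    refine IsCSCD.support_deriv_eq_zero (h.smooth.hasDerivAt_Ioo ht) (h.eventually_mem hK ht) ?_
    intro y hy
    have := hf y hy
    rw [map_smul, map_add, smul_eq_mul] at this
    linarith
  have h4 := IsCSCD.support_apply hd (z := σ t) (x - σ t)
  rw [map_sub, h3, sub_self, mul_zero] at h4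
  have h5 : wedge (deriv σ t) (x - σ t) = 0 := by
    rw [wedge_swap]
    rcases mul_eq_zero.1 h4.symm with h | h
    · rw [h, neg_zero]
    · linarith
  have hd0 : deriv σ t ≠ 0 := by
    intro h0
    have := h.pos t ht
    rw [h0, wedge_zero_right] at this
    exact lt_irrefl _ this
  obtain ⟨l, hl⟩ := eq_smul_of_wedge_eq_zero hd0 h5
  have hl0 : l ≠ 0 := by
    rintro rfl
    rw [zero_smul, sub_eq_zero] at hl
    exact hne hl
  have hg : HasDerivAt (fun s => wedge (deriv σ s) (x - σ s))
      (wedge (deriv (deriv σ) t) (x - σ t) + wedge (deriv σ t) (-deriv σ t)) t :=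
    (h.smooth.hasDerivAt_deriv_Ioo ht).wedge ((h.smooth.hasDerivAt_Ioo ht).const_sub x)
  have hmin : IsLocalMin (fun s => wedge (deriv σ s) (x - σ s)) t := by
    filter_upwards [isOpen_Ioo.mem_nhds ht] with s hs
    simp only [h5]
    exact h.tangent_nonneg hK hs hx
  have := hmin.hasDerivAt_eq_zero hg
  rw [hl, wedge_neg_right, wedge_self, wedge_smul_right, wedge_swap] at this
  simp only [neg_zero, add_zero, mul_neg, neg_eq_zero, mul_eq_zero] at this
  rcases this with h | h
  exacts [hl0 h, hc h]

lemma curvature_nonneg (h : Arc K σ a b) (hK : IsCSCD K) (ht : t ∈ Set.Ioo a b) :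
    0 ≤ wedge (deriv σ t) (deriv (deriv σ) t) := by
  by_contra! hneg
  have h1 : HasDerivAt (fun s => wedge (deriv σ t) (deriv σ s))
    (wedge (deriv σ t) (deriv (deriv σ) t)) t := (h.smooth.hasDerivAt_deriv_Ioo ht).const_wedge _
  have h2 := (hasDerivAt_iff_tendsto_slope.1 h1).eventually_lt_const hneg
  have h3 : ∀ᶠ s in nhdsWithin t (Set.Ioi t), wedge (deriv σ t) (deriv σ s) < 0 := by
    have h4 : ∀ᶠ s in nhdsWithin t (Set.Ioi t), t < s := self_mem_nhdsWithin
    filter_upwards [nhdsWithin_mono t (fun s (hs : t < s) => (ne_of_gt hs : s ≠ t)) h2, h4]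
      with s hs hts
    rw [slope_def_field, wedge_self, sub_zero, div_neg_iff] at hs
    rcases hs with hs | hs
    · linarith [hs.2]
    · exact hs.1
  obtain ⟨u, hu, hsub⟩ := (mem_nhdsGT_iff_exists_Ioo_subset).1 h3
  simp only [Set.mem_Ioi] at hu
  set u' := min u b with hu'
  have htu : t < u' := lt_min hu ht.2
  set v := (t + u') / 2 with hv
  have hv1 : t < v := by rw [hv]; linarith
  have hv2 : v < u' := by rw [hv]; linarith
  have hin : ∀ s, t ≤ s → s ≤ v → s ∈ Set.Ioo a b := fun s h1 h2 =>
    ⟨ht.1.trans_le h1, (h2.trans_lt hv2).trans_le (min_le_right _ _)⟩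
  have hder : ∀ s, t ≤ s → s ≤ v →
      HasDerivAt (fun s => wedge (deriv σ t) (σ s)) (wedge (deriv σ t) (deriv σ s)) s :=
    fun s h1 h2 => (h.smooth.hasDerivAt_Ioo (hin s h1 h2)).const_wedge _
  obtain ⟨ξ, hξ, hξ'⟩ := exists_hasDerivAt_eq_slope _ _ hv1
    (fun s hs => (hder s hs.1 hs.2).continuousAt.continuousWithinAt)
    (fun s hs => hder s hs.1.le hs.2.le)
  have h5 : wedge (deriv σ t) (deriv σ ξ) < 0 :=
    hsub ⟨hξ.1, (hξ.2.trans hv2).trans_le (min_le_left _ _)⟩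
  have h6 := h.tangent_nonneg hK ht (hK.mem_frontier_iff.1 (h.mem v (hin v hv1.le le_rfl))).1
  rw [wedge_sub_right] at h6
  rw [hξ', div_neg_iff] at h5
  rcases h5 with h5 | h5
  · linarith [h5.2]
  · linarith [h5.1]

end Arc

lemma ContDiffAt.wedge {E : Type*} [NormedAddCommGroup E] [NormedSpace ℝ E] {f g : E → ℝ × ℝ}
    {x : E} {n : WithTop ℕ∞} (hf : ContDiffAt ℝ n f x) (hg : ContDiffAt ℝ n g x) :
    ContDiffAt ℝ n (fun y => _root_.wedge (f y) (g y)) x := by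
  unfold _root_.wedge
  exact (hf.fst.mul hg.snd).sub (hf.snd.mul hg.fst)

/-- The implicit function theorem for the equation `p t ∧ g u = const`. -/
lemma exists_implicit_wedge {p g : ℝ → ℝ × ℝ} {t u : ℝ} (hp : ContDiffAt ℝ 2 p t)
    (hg : ContDiffAt ℝ 2 g u) (hne : wedge (p t) (deriv g u) ≠ 0) :
    ∃ ψ : ℝ → ℝ, ContDiffAt ℝ 2 ψ t ∧ ψ t = u ∧
      ∀ᶠ v : ℝ × ℝ in nhds (t, u), wedge (p v.1) (g v.2) = wedge (p t) (g u) → v.2 = ψ v.1 := by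
  set F : ℝ × ℝ → ℝ := fun v => wedge (p v.1) (g v.2) with hF
  have cdf : ContDiffAt ℝ 2 F (t, u) :=
    ContDiffAt.wedge (ContDiffAt.comp (t, u) (g := p) (by exact hp) contDiffAt_fst)
      (ContDiffAt.comp (t, u) (g := g) (by exact hg) contDiffAt_snd)
  have hd : HasFDerivAt F (fderiv ℝ F (t, u)) (t, u) :=
    (cdf.differentiableAt (by norm_num)).hasFDerivAt
  have hval : fderiv ℝ F (t, u) (0, 1) = wedge (p t) (deriv g u) := by
    have h1 : HasDerivAt (fun s : ℝ => ((t, s) : ℝ × ℝ)) ((0 : ℝ), (1 : ℝ)) u :=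
      (hasDerivAt_const u t).prodMk (hasDerivAt_id u)
    have h2 : HasDerivAt (fun s : ℝ => F (t, s)) (fderiv ℝ F (t, u) (0, 1)) u :=
      HasFDerivAt.comp_hasDerivAt u (f := fun s : ℝ => ((t, s) : ℝ × ℝ)) hd h1
    have h3 : HasDerivAt (fun s : ℝ => F (t, s)) (wedge (p t) (deriv g u)) u :=
      (hg.differentiableAt (by norm_num)).hasDerivAt.const_wedge (p t)
    exact h2.unique h3
  have if₂ : (fderiv ℝ F (t, u) ∘L ContinuousLinearMap.inr ℝ ℝ ℝ).IsInvertible := by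
    refine ⟨ContinuousLinearEquiv.unitsEquivAut ℝ (Units.mk0 _ hne), ?_⟩
    ext
    simp [hval]
  refine ⟨cdf.implicitFunction (by norm_num) if₂, cdf.contDiffAt_implicitFunction (by norm_num) if₂,
    cdf.implicitFunction_apply_self (by norm_num) if₂, ?_⟩
  filter_upwards [cdf.eventually_apply_eq_iff_implicitFunction (by norm_num) if₂] with v hv h
  exact (hv.1 h).symm

namespace IsCSCD

variable {K : Set (ℝ × ℝ)}

lemma eq_of_smul_mem_frontier (hK : IsCSCD K) {z : ℝ × ℝ} {a : ℝ} (hz : z ∈ frontier K)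
    (h : a • z ∈ frontier K) (ha : 0 < a) : a = 1 := by
  rcases lt_trichotomy a 1 with h1 | h1 | h1
  · exact absurd (hK.smul_mem_interior (hK.mem_frontier_iff.1 hz).1 ha.le h1)
      (hK.mem_frontier_iff.1 h).2
  · exact h1
  · exact absurd (hK.mem_frontier_iff.1 h).1 ((hK.mem_frontier_iff_smul.1 hz).2 a h1)

/-- A regular boundary curve covers a neighbourhood of its points in the boundary. -/
lemma eventually_mem_curve (hK : IsCSCD K) {g : ℝ → ℝ × ℝ} {u : ℝ} (hg : ContDiffAt ℝ 2 g u)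
    (hd : deriv g u ≠ 0) (hgK : ∀ᶠ s in nhds u, g s ∈ frontier K) {V : Set ℝ} (hV : V ∈ nhds u) :
    ∀ᶠ z in nhds (g u), z ∈ frontier K → ∃ s ∈ V, z = g s := by
  have hu := hK.mem_frontier_iff.1 hgK.self_of_nhds
  have hder := (hg.differentiableAt (by norm_num)).hasDerivAt
  have hD : wedge (g u) (deriv g u) ≠ 0 :=
    hK.wedge_deriv_ne_zero hder (hgK.mono fun s hs => (hK.mem_frontier_iff.1 hs).1) hu.2 hd
  obtain ⟨f, hf0, -, -⟩ := hK.exists_support hu.2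
  have hcont : ∀ᶠ s in nhds u, ContinuousAt g s :=
    (hg.eventually (by simp)).mono fun s hs => hs.continuousAt
  have hfpos : ∀ᶠ s in nhds u, 0 < f (g s) :=
    (f.continuous.continuousAt.comp hg.continuousAt).eventually_const_lt hf0
  have hall := ((Filter.eventually_iff.2 hV : ∀ᶠ s in nhds u, s ∈ V).and hgK).and
    (hcont.and hfpos)
  obtain ⟨ε, hε, hball⟩ := Metric.eventually_nhds_iff_ball.1 hall
  set D := wedge (g u) (deriv g u) with hDdef
  have hφ : HasDerivAt (fun s => D * wedge (g u) (g s)) (D * D) u :=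
    (hder.const_wedge (g u)).const_mul D
  have hslope := (hasDerivAt_iff_tendsto_slope.1 hφ).eventually_const_lt
    (show (0 : ℝ) < D * D from mul_self_pos.2 hD)
  rw [eventually_nhdsWithin_iff, Metric.eventually_nhds_iff_ball] at hslope
  obtain ⟨ε', hε', hs⟩ := hslope
  set r := min ε ε' / 2 with hr
  have hr0 : 0 < r := by rw [hr]; have := lt_min hε hε'; linarith
  have hr1 : r < ε := by rw [hr]; have := lt_min hε hε'; have := min_le_left ε ε'; linarith
  have hr2 : r < ε' := by rw [hr]; have := lt_min hε hε'; have := min_le_right ε ε'; linarith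
  have h1 : D * wedge (g u) (g (u - r)) < 0 := by
    have := hs (u - r) (by rw [Metric.mem_ball, Real.dist_eq]; simpa [abs_of_pos hr0])
      (by simp [hr0.ne'])
    rw [slope_def_field, wedge_self, mul_zero, sub_zero,
      show u - r - u = -r by ring, div_neg, lt_neg, neg_zero, div_neg_iff] at this
    rcases this with h | h
    · linarith [h.2]
    · exact h.1
  have h2 : 0 < D * wedge (g u) (g (u + r)) := by
    have := hs (u + r) (by rw [Metric.mem_ball, Real.dist_eq]; simpa [abs_of_pos hr0])
      (by simp [hr0.ne'])
    rw [slope_def_field, wedge_self, mul_zero, sub_zero,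
      show u + r - u = r by ring, div_pos_iff] at this
    rcases this with h | h
    · exact h.1
    · linarith [h.2]
  have c1 : Continuous (fun z => D * wedge z (g (u - r))) := by fun_prop
  have c2 : Continuous (fun z => D * wedge z (g (u + r))) := by fun_prop
  filter_upwards [c1.continuousAt.eventually_lt_const h1, c2.continuousAt.eventually_const_lt h2,
    f.continuous.continuousAt.eventually_const_lt hf0] with z hz1 hz2 hz3 hzf
  have hin : ∀ s ∈ Set.Icc (u - r) (u + r), s ∈ Metric.ball u ε := by
    intro s hs
    rw [Metric.mem_ball, Real.dist_eq, abs_lt]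
    exact ⟨by linarith [hs.1], by linarith [hs.2]⟩
  have hco : ContinuousOn (fun s => D * wedge z (g s)) (Set.Icc (u - r) (u + r)) := by
    have : ContinuousOn g (Set.Icc (u - r) (u + r)) := fun s hs =>
      (hball s (hin s hs)).2.1.continuousWithinAt
    fun_prop
  obtain ⟨s, hs, hs0⟩ := intermediate_value_Icc (by linarith) hco ⟨hz1.le, hz2.le⟩
  have hw : wedge z (g s) = 0 := (mul_eq_zero.1 hs0).resolve_left hD
  obtain ⟨a, ha⟩ := eq_smul_of_wedge_eq_zero (hK.frontier_ne_zero hzf) hw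
  obtain ⟨⟨hsV, hsf⟩, -, hsp⟩ := hball s (hin s hs)
  refine ⟨s, hsV, ?_⟩
  rw [ha] at hsf hsp
  rw [map_smul, smul_eq_mul] at hsp
  have ha0 : 0 < a := by by_contra! h; nlinarith
  rw [ha, hK.eq_of_smul_mem_frontier hzf hsf ha0, one_smul]

/-- Uniqueness of the extremal companion when the chord midpoint is interior. -/
lemma companion_unique (hK : IsCSCD K) {z w x : ℝ × ℝ} (hz : z ≠ 0) (hw : w ∉ interior K)
    (hzw : z + w ∉ interior K) (hmid : w + (1 / 2 : ℝ) • z ∈ interior K) (hx : IsCompanion K z x)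
    (h : wedge z x = wedge z w) : x = w := by
  obtain ⟨s, hs⟩ := eq_smul_of_wedge_eq_zero (x := x - w) hz (by rw [wedge_sub_right, h, sub_self])
  have hxs : x = w + s • z := by rw [← hs]; abel
  rcases lt_trichotomy s 0 with h0 | h0 | h0
  · exfalso
    have := hK.add_smul_mem_interior hmid (s := s) (t := 0) (hxs ▸ hx.1)
      (Or.inr ⟨h0, by norm_num⟩)
    exact hw (by simpa using this)
  · rw [hxs, h0, zero_smul, add_zero]
  · exfalso
    have h1 : w + (1 + s) • z ∈ K := by
      have := hx.2
      rw [hxs] at this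
      convert this using 1
      module
    have := hK.add_smul_mem_interior hmid (s := 1 + s) (t := 1) h1
      (Or.inl ⟨by norm_num, by linarith⟩)
    exact hzw (by rw [add_comm]; simpa using this)

lemma companion_unique_abs (hK : IsCSCD K) {z w x : ℝ × ℝ} {c : ℝ} (hz : z ≠ 0)
    (hmax : ∀ y, IsCompanion K z y → wedge z y ≤ c) (hc : wedge z w = c)
    (hw : w ∉ interior K) (hzw : z + w ∉ interior K) (hmid : w + (1 / 2 : ℝ) • z ∈ interior K)
    (hx : IsCompanion K z x) (h : c ≤ |wedge z x|) : x = w ∨ x = -(z + w) := by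
  have key : ∀ y, IsCompanion K z y → c ≤ wedge z y → y = w := fun y hy hcy =>
    hK.companion_unique hz hw hzw hmid hy (by rw [hc]; exact le_antisymm (hmax y hy) hcy)
  rcases le_total 0 (wedge z x) with h0 | h0
  · rw [abs_of_nonneg h0] at h
    exact Or.inl (key x hx h)
  · rw [abs_of_nonpos h0] at h
    have := key (-(z + x)) ⟨hK.neg_mem hx.2, by
      rw [show z + -(z + x) = -x by abel]; exact hK.neg_mem hx.1⟩
      (by rw [wedge_neg_right, wedge_add_right, wedge_self]; linarith)
    right
    rw [← this]; abel

end IsCSCD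

/-- Three boundary arcs forming, with their negatives, inscribed hexagons all of whose
triangles have doubled area `c`, carrying all extremal companions. -/
structure HexArc (K : Set (ℝ × ℝ)) (c : ℝ) (σ : Fin 3 → ℝ → ℝ × ℝ) (a b : ℝ) : Prop where
  arc : ∀ j, Arc K (σ j) a b
  sum : ∀ t ∈ Set.Ioo a b, σ 0 t + σ 1 t + σ 2 t = 0
  wedge : ∀ j, ∀ t ∈ Set.Ioo a b, wedge (σ j t) (σ (j + 1) t) = c
  uniq : ∀ j, ∀ t ∈ Set.Ioo a b, ∀ w, IsCompanion K (σ j t) w → c ≤ |_root_.wedge (σ j t) w| →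
    ∃ k, w = σ k t ∨ w = -σ k t

lemma HexArc.mono {K : Set (ℝ × ℝ)} {c : ℝ} {σ : Fin 3 → ℝ → ℝ × ℝ} {a b a' b' : ℝ}
    (h : HexArc K c σ a b) (hs : Set.Ioo a' b' ⊆ Set.Ioo a b) : HexArc K c σ a' b' :=
  ⟨fun j => (h.arc j).mono hs, fun t ht => h.sum t (hs ht), fun j t ht => h.wedge j t (hs ht),
    fun j t ht => h.uniq j t (hs ht)⟩

lemma exists_Ioo_of_eventually {a b t : ℝ} {P : ℝ → Prop} (ht : t ∈ Set.Ioo a b)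
    (h : ∀ᶠ s in nhds t, P s) :
    ∃ a' b', a' < t ∧ t < b' ∧ Set.Ioo a' b' ⊆ Set.Ioo a b ∧ ∀ s ∈ Set.Ioo a' b', P s := by
  obtain ⟨l, u, hlu, hsub⟩ := mem_nhds_iff_exists_Ioo_subset.1
    (Filter.inter_mem (isOpen_Ioo.mem_nhds ht) h)
  exact ⟨l, u, hlu.1, hlu.2, hsub.trans Set.inter_subset_left, fun s hs => (hsub hs).2⟩

/-- Around some parameter of a strictly curved arc the extremal companion is unique. -/
lemma IsAreaMin.exists_good {K : Set (ℝ × ℝ)} {c : ℝ} (hM : IsAreaMin K c) {p : ℝ → ℝ × ℝ}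
    {a b : ℝ} (hab : a < b) (hp : Arc K p a b) :
    ∃ t ∈ Set.Ioo a b, ∃ x ∈ K, c < wedge (p t) x := by
  by_contra! hcon
  obtain ⟨hK, -, hA, -⟩ := hM
  obtain ⟨t, ht⟩ := Set.nonempty_Ioo.2 hab
  obtain ⟨w, hw, hcw⟩ := hA (p t) (hp.mem t ht)
  have key : ∀ x ∈ K, wedge (p t) x = c → wedge (deriv p t) x = 0 := by
    intro x hx hxc
    have hmax : IsLocalMax (fun s => wedge (p s) x) t := by
      filter_upwards [isOpen_Ioo.mem_nhds ht] with s hs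
      rw [hxc]; exact hcon s hs x hx
    exact hmax.hasDerivAt_eq_zero ((hp.smooth.hasDerivAt_Ioo ht).wedge_const x)
  have hwc : wedge (p t) w = c := le_antisymm (hcon t ht w hw.1) hcw
  have h1 := key w hw.1 hwc
  have h2 := key _ hw.2 (by rw [wedge_add_right, wedge_self, hwc, zero_add])
  rw [wedge_add_right, h1, add_zero, wedge_swap] at h2
  linarith [hp.pos t ht]

lemma IsCSCD.mid_mem_interior {K : Set (ℝ × ℝ)} (hK : IsCSCD K) {z w x : ℝ × ℝ}
    (hw : IsCompanion K z w) (hpos : 0 < wedge z w) (hx : x ∈ K) (hlt : wedge z w < wedge z x) :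
    w + (1 / 2 : ℝ) • z ∈ interior K := by
  by_contra hni
  obtain ⟨f, hf0, hf, -⟩ := hK.exists_support hni
  have h1 := hf _ hw.1
  have h2 := hf _ hw.2
  have h3 := hf x hx
  rw [map_add, map_smul, smul_eq_mul] at hf0
  rw [map_add, map_smul, smul_eq_mul] at h1
  rw [map_add, map_add, map_smul, smul_eq_mul] at h2
  have hz : f z = 0 := by linarith
  have h4 := IsCSCD.support_apply hz (z := w) x
  rw [map_add, map_smul, hz, smul_zero, add_zero] at h3
  rw [hz, mul_zero, add_zero] at hf0
  rw [wedge_swap w z, wedge_swap x z] at h4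
  nlinarith

/-- A strictly curved arc in the boundary of a minimal domain extends, after shrinking, to a
hexagon of arcs. -/
lemma IsAreaMin.exists_hexArc {K : Set (ℝ × ℝ)} {c : ℝ} (hM : IsAreaMin K c) {p : ℝ → ℝ × ℝ}
    {a b : ℝ} (hab : a < b) (hp : Arc K p a b)
    (hcurv : ∀ t ∈ Set.Ioo a b, wedge (deriv p t) (deriv (deriv p) t) ≠ 0)
    {E : Set (ℝ × ℝ)} (hE : E.Finite)
    (hcov : ∀ z ∈ frontier K, z ∉ E → ∃ (g : ℝ → ℝ × ℝ) (u : ℝ), g u = z ∧ ContDiffAt ℝ 2 g u ∧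
      deriv g u ≠ 0 ∧ ∀ᶠ s in nhds u, g s ∈ frontier K) :
    ∃ a' b', a' < b' ∧ Set.Ioo a' b' ⊆ Set.Ioo a b ∧ ∃ σ, σ 0 = p ∧ HexArc K c σ a' b' := by
  have hK := hM.1
  have hc := hM.2.1
  have hstrict : ∀ t ∈ Set.Ioo a b, StrictAt K (p t) := fun t ht =>
    hp.strictAt hK ht (hcurv t ht)
  have hle : ∀ t ∈ Set.Ioo a b, ∀ w, IsCompanion K (p t) w → wedge (p t) w ≤ c := fun t ht w hw =>
    hM.wedge_le (hp.mem t ht) (hstrict t ht) hw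
  obtain ⟨tg, htg, x0, hx0, hgood⟩ := hM.exists_good hab hp
  have hcontp : ∀ t ∈ Set.Ioo a b, ContinuousAt p t := fun t ht =>
    (hp.smooth.hasDerivAt_Ioo ht).continuousAt
  obtain ⟨a1, b1, ha1, hb1, hsub1, hgood1⟩ := exists_Ioo_of_eventually htg
    (Filter.Tendsto.eventually_const_lt hgood ((hcontp tg htg).wedge continuousAt_const))
  -- the companion curve
  have hex : ∀ t, ∃ w, t ∈ Set.Ioo a1 b1 → IsCompanion K (p t) w ∧ wedge (p t) w = c := by
    intro t
    by_cases ht : t ∈ Set.Ioo a1 b1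
    · obtain ⟨w, hw, hcw⟩ := hM.2.2.1 (p t) (hp.mem t (hsub1 ht))
      exact ⟨w, fun _ => ⟨hw, le_antisymm (hle t (hsub1 ht) w hw) hcw⟩⟩
    · exact ⟨0, fun h => absurd h ht⟩
  choose q hq using hex
  have hp0 : ∀ t ∈ Set.Ioo a1 b1, p t ≠ 0 := fun t ht => hK.frontier_ne_zero (hp.mem t (hsub1 ht))
  have hq0 : ∀ t ∈ Set.Ioo a1 b1, q t ≠ 0 := fun t ht h0 => by
    have := (hq t ht).2
    rw [h0, wedge_zero_right] at this
    linarith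
  have hmax : ∀ t ∈ Set.Ioo a1 b1, IsMaxCompanion K (p t) (q t) := fun t ht =>
    ⟨(hq t ht).1, fun x hx => (hle t (hsub1 ht) x hx).trans (hq t ht).2.ge⟩
  have havoid : ∀ t ∈ Set.Ioo a1 b1, ∀ m n : ℤ, (m ≠ 0 ∨ n ≠ 0) →
      (m : ℝ) • p t + (n : ℝ) • q t ∉ interior K := fun t ht =>
    hK.lattice_avoid (hp.mem t (hsub1 ht)) (hmax t ht)
  have hqni : ∀ t ∈ Set.Ioo a1 b1, q t ∉ interior K := fun t ht => by
    simpa using havoid t ht 0 1 (by simp)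
  have hpqni : ∀ t ∈ Set.Ioo a1 b1, p t + q t ∉ interior K := fun t ht => by
    simpa using havoid t ht 1 1 (by simp)
  have hqf : ∀ t ∈ Set.Ioo a1 b1, q t ∈ frontier K := fun t ht =>
    hK.mem_frontier_iff.2 ⟨(hq t ht).1.1, hqni t ht⟩
  have hpqf : ∀ t ∈ Set.Ioo a1 b1, p t + q t ∈ frontier K := fun t ht =>
    hK.mem_frontier_iff.2 ⟨(hq t ht).1.2, hpqni t ht⟩
  have hmid : ∀ t ∈ Set.Ioo a1 b1, q t + (1 / 2 : ℝ) • p t ∈ interior K := fun t ht =>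
    hK.mid_mem_interior (hq t ht).1 (by rw [(hq t ht).2]; exact hc) hx0
      (by rw [(hq t ht).2]; exact hgood1 t ht)
  have huniq : ∀ t ∈ Set.Ioo a1 b1, ∀ x, IsCompanion K (p t) x → wedge (p t) x = c → x = q t :=
    fun t ht x hx hxc => hK.companion_unique (hp0 t ht) (hqni t ht) (hpqni t ht) (hmid t ht) hx
      (by rw [hxc, (hq t ht).2])
  have hqcont : ∀ t ∈ Set.Ioo a1 b1, ContinuousAt q t := by
    intro t ht
    rw [ContinuousAt, Filter.tendsto_iff_ultrafilter]
    intro U hU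
    have hin : ∀ᶠ s in (U : Filter ℝ), s ∈ Set.Ioo a1 b1 := hU (isOpen_Ioo.mem_nhds ht)
    have hpt : Filter.Tendsto p U (nhds (p t)) := (hcontp t (hsub1 ht)).tendsto.mono_left hU
    obtain ⟨y, hy, hyt⟩ := hK.2.1.ultrafilter_le_nhds' (U.map q)
      (Filter.mem_map.2 (hin.mono fun s hs => (hq s hs).1.1))
    have hyt' : Filter.Tendsto q U (nhds y) := hyt
    have h1 : IsCompanion K (p t) y := ⟨hy, hK.isClosed.mem_of_tendsto (hpt.add hyt')
      (hin.mono fun s hs => (hq s hs).1.2)⟩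
    have h2 : wedge (p t) y = c := by
      refine tendsto_nhds_unique (hpt.wedge hyt') ?_
      refine tendsto_const_nhds.congr' ?_
      exact hin.mono fun s hs => (hq s hs).2.symm
    rw [← huniq t ht y h1 h2]
    exact hyt'
  have hneg : ∀ t ∈ Set.Ioo a1 b1, wedge (deriv p t) (q t) < wedge (p t) (deriv p t) := by
    intro t ht
    have h1 := hp.tangent_pos_of_strictAt hK (hsub1 ht) (hstrict t (hsub1 ht))
      (hK.neg_mem (hq t ht).1.1) (by
        intro h
        have := (hq t ht).2
        rw [← h, wedge_neg_left, wedge_self] at this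
        linarith)
    rw [wedge_sub_right, wedge_neg_right, wedge_swap (deriv p t) (p t)] at h1
    linarith
  have hpos : ∀ t ∈ Set.Ioo a1 b1, 0 < wedge (deriv p t) (q t) := by
    intro t ht
    have h1 := hp.tangent_pos_of_strictAt hK (hsub1 ht) (hstrict t (hsub1 ht))
      (hq t ht).1.2 (by simpa using hq0 t ht)
    simpa [wedge_sub_right, wedge_add_right] using h1
  obtain ⟨ts, hts, htsE⟩ : ∃ t ∈ Set.Ioo a1 b1, q t ∉ E := by
    by_contra! hcon
    have hconst : ∀ s ∈ Set.Ioo a1 b1, q s = q tg := by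
      intro s hs
      have hpre : IsPreconnected (q '' Set.Ioo a1 b1) :=
        isPreconnected_Ioo.image q fun t ht => (hqcont t ht).continuousWithinAt
      have hfin : (q '' Set.Ioo a1 b1).Finite := hE.subset (by rintro _ ⟨t, ht, rfl⟩; exact hcon t ht)
      exact hfin.countable.isTotallyDisconnected _ subset_rfl hpre ⟨s, hs, rfl⟩ ⟨tg, ⟨ha1, hb1⟩, rfl⟩
    have h1 := ((hp.smooth.hasDerivAt_Ioo htg).wedge_const (q tg))
    have h2 : HasDerivAt (fun s => wedge (p s) (q tg)) 0 tg := by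
      refine (hasDerivAt_const tg c).congr_of_eventuallyEq ?_
      filter_upwards [isOpen_Ioo.mem_nhds (⟨ha1, hb1⟩ : tg ∈ Set.Ioo a1 b1)] with s hs
      rw [← hconst s hs, (hq s hs).2]
    have := hpos tg ⟨ha1, hb1⟩
    rw [h1.unique h2] at this
    exact lt_irrefl _ this
  obtain ⟨g, u, hgu, hg, hgd, hgK⟩ := hcov _ (hqf ts hts) htsE
  have hgne : wedge (p ts) (deriv g u) ≠ 0 := by
    intro h0
    obtain ⟨l, hl⟩ := eq_smul_of_wedge_eq_zero (hp0 ts hts) h0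
    obtain ⟨f, hf0, hf, hf'⟩ := hK.exists_support (hqni ts hts)
    have h1 : f (deriv g u) = 0 := by
      refine IsCSCD.support_deriv_eq_zero (hg.differentiableAt (by norm_num)).hasDerivAt
        (hgK.mono fun s hs => (hK.mem_frontier_iff.1 hs).1) ?_
      rw [hgu]; exact hf
    rw [hl, map_smul, smul_eq_mul, mul_eq_zero] at h1
    rcases h1 with rfl | h1
    · rw [zero_smul] at hl; exact hgd hl
    · have := hf' _ (hmid ts hts)
      rw [map_add, map_smul, h1, smul_zero, add_zero] at this
      exact lt_irrefl _ this
  have hpC : ContDiffAt ℝ 2 p ts := hp.smooth.contDiffAt (isOpen_Ioo.mem_nhds (hsub1 hts))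
  obtain ⟨ψ, hψ, hψu, hψeq⟩ := exists_implicit_wedge hpC hg hgne
  have hqψ : ∀ᶠ t in nhds ts, q t = g (ψ t) := by
    obtain ⟨A, hA, B, hB, hAB⟩ := Filter.eventually_prod_iff.1 (nhds_prod_eq (x := ts) (y := u) ▸ hψeq)
    have h1 := hK.eventually_mem_curve hg hgd hgK hB
    rw [hgu] at h1
    filter_upwards [hA, (hqcont ts hts).eventually h1, isOpen_Ioo.mem_nhds hts] with t h2 h3 h4
    obtain ⟨s, hs, hqs⟩ := h3 (hqf t h4)
    have := hAB h2 hs (by rw [hgu, ← hqs, (hq t h4).2, (hq ts hts).2])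
    simp only at this
    rw [hqs, this]
  have hqC : ContDiffAt ℝ 2 q ts := by
    refine ContDiffAt.congr_of_eventuallyEq ?_ hqψ
    exact ContDiffAt.comp ts (by rw [hψu]; exact hg) hψ
  obtain ⟨a2, b2, ha2, hb2, hsub2, hq2⟩ := exists_Ioo_of_eventually hts (hqC.eventually (by simp))
  have hsub12 := hsub2.trans hsub1
  have hqC2 : ContDiffOn ℝ 2 q (Set.Ioo a2 b2) := fun t ht => (hq2 t ht).contDiffWithinAt
  have hqder : ∀ t ∈ Set.Ioo a2 b2, wedge (p t) (deriv q t) = -wedge (deriv p t) (q t) := by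
    intro t ht
    have h1 := (hp.smooth.hasDerivAt_Ioo (hsub12 ht)).wedge (hqC2.hasDerivAt_Ioo ht)
    have h2 : HasDerivAt (fun s => wedge (p s) (q s)) 0 t := by
      refine (hasDerivAt_const t c).congr_of_eventuallyEq ?_
      filter_upwards [isOpen_Ioo.mem_nhds ht] with s hs
      exact (hq s (hsub2 hs)).2
    linarith [h1.unique h2]
  set r : ℝ → ℝ × ℝ := fun t => -(p t + q t) with hr
  have hpC2 : ContDiffOn ℝ 2 p (Set.Ioo a2 b2) := hp.smooth.mono hsub12
  have hrC2 : ContDiffOn ℝ 2 r (Set.Ioo a2 b2) := (hpC2.add hqC2).neg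
  have hrf : ∀ t ∈ Set.Ioo a2 b2, r t ∈ frontier K := fun t ht =>
    hK.neg_mem_frontier (hpqf t (hsub2 ht))
  have hrder : ∀ t ∈ Set.Ioo a2 b2, deriv r t = -(deriv p t + deriv q t) := fun t ht =>
    (((hpC2.hasDerivAt_Ioo ht).add (hqC2.hasDerivAt_Ioo ht)).neg).deriv
  have arcq : Arc K q a2 b2 := by
    refine ⟨hqC2, fun t ht => hqf t (hsub2 ht), fun t ht => ?_⟩
    obtain ⟨f, hf0, hf, hf'⟩ := hK.exists_support (hqni t (hsub2 ht))
    have h1 := IsCSCD.support_deriv_eq_zero (hqC2.hasDerivAt_Ioo ht) (by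
      filter_upwards [isOpen_Ioo.mem_nhds ht] with s hs using (hq s (hsub2 hs)).1.1) hf
    have h2 := hf' _ (hmid t (hsub2 ht))
    rw [map_add, map_smul, smul_eq_mul] at h2
    have h3 := IsCSCD.support_apply h1 (z := q t) (p t)
    rw [hqder t ht] at h3
    have h4 := hpos t (hsub2 ht)
    have h5 : wedge (q t) (deriv q t) * f (p t) < 0 := by rw [h3]; nlinarith
    by_contra! h6
    nlinarith
  have arcr : Arc K r a2 b2 := by
    refine ⟨hrC2, hrf, fun t ht => ?_⟩
    obtain ⟨f, hf0, hf, hf'⟩ := hK.exists_support (hK.mem_frontier_iff.1 (hrf t ht)).2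
    have h1 := IsCSCD.support_deriv_eq_zero (hrC2.hasDerivAt_Ioo ht) (by
      filter_upwards [isOpen_Ioo.mem_nhds ht] with s hs
      exact (hK.mem_frontier_iff.1 (hrf s hs)).1) hf
    have h2 := hf' _ (hK.neg_mem_interior (hmid t (hsub2 ht)))
    have h2' : f (p t) < 0 := by
      simp only [hr, map_neg, map_add, map_smul, smul_eq_mul] at h2
      linarith
    have h3 := IsCSCD.support_apply h1 (z := r t) (p t)
    have h7 : wedge (p t) (deriv r t) < 0 := by
      rw [hrder t ht, wedge_neg_right, wedge_add_right, hqder t ht]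
      linarith [hneg t (hsub2 ht)]
    have h5 : wedge (r t) (deriv r t) * f (p t) < 0 := by rw [h3]; nlinarith
    by_contra! h6
    nlinarith
  have hpr : ∀ t ∈ Set.Ioo a2 b2, p t + q t = -r t := fun t _ => by simp [hr]
  have hqr : ∀ t ∈ Set.Ioo a2 b2, q t + r t = -p t := fun t _ => by simp [hr]
  have hrp : ∀ t ∈ Set.Ioo a2 b2, r t + p t = -q t := fun t _ => by simp [hr]
  have wqr : ∀ t ∈ Set.Ioo a2 b2, wedge (q t) (r t) = c := fun t ht => by
    simp only [hr]
    rw [wedge_neg_right, wedge_add_right, wedge_self, wedge_swap, (hq t (hsub2 ht)).2]; ring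
  have wrp : ∀ t ∈ Set.Ioo a2 b2, wedge (r t) (p t) = c := fun t ht => by
    simp only [hr]
    rw [wedge_neg_left, wedge_add_left, wedge_self, wedge_swap, (hq t (hsub2 ht)).2]; ring
  have hKf : ∀ z, z ∈ frontier K → z ∈ K := fun z hz => (hK.mem_frontier_iff.1 hz).1
  have hKi : ∀ z, z ∈ frontier K → z ∉ interior K := fun z hz => (hK.mem_frontier_iff.1 hz).2
  have hqle : ∀ t ∈ Set.Ioo a2 b2, ∀ x, IsCompanion K (q t) x → wedge (q t) x ≤ c := by
    intro t ht x hx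
    by_contra! hlt
    have hv : wedge (q t) (-p t) = c := by
      rw [wedge_neg_right, ← wedge_swap, (hq t (hsub2 ht)).2]
    obtain ⟨k, hk⟩ := hK.exists_int_translate_mem_interior (x := -p t) (hq t (hsub2 ht)).1.1 hx.1 hx.2
      (by rw [hv]; exact hc) (by rw [hv]; exact hlt)
    refine havoid t (hsub2 ht) (-1) k (by simp) ?_
    simpa using hk
  have hrle : ∀ t ∈ Set.Ioo a2 b2, ∀ x, IsCompanion K (r t) x → wedge (r t) x ≤ c := by
    intro t ht x hx
    by_contra! hlt
    obtain ⟨k, hk⟩ := hK.exists_int_translate_mem_interior (x := p t) (hKf _ (hrf t ht)) hx.1 hx.2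
      (by rw [wrp t ht]; exact hc) (by rw [wrp t ht]; exact hlt)
    refine havoid t (hsub2 ht) (1 - k) (-k) (by omega) ?_
    convert hk using 1
    simp only [hr]; push_cast; module
  have midq : ∀ t ∈ Set.Ioo a2 b2, r t + (1 / 2 : ℝ) • q t ∈ interior K := by
    intro t ht
    have := hstrict t (hsub12 ht) (p t + q t) (hq t (hsub2 ht)).1.2 (by simpa using hq0 t (hsub2 ht))
    convert hK.neg_mem_interior this using 1
    simp only [hr]; module
  have midr : ∀ t ∈ Set.Ioo a2 b2, p t + (1 / 2 : ℝ) • r t ∈ interior K := by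
    intro t ht
    have := hstrict t (hsub12 ht) (-q t) (hK.neg_mem (hq t (hsub2 ht)).1.1) (by
        intro h
        have := (hq t (hsub2 ht)).2
        rw [← h, wedge_neg_left, wedge_self] at this
        linarith)
    convert this using 1
    simp only [hr]; module
  refine ⟨a2, b2, ha2.trans hb2, hsub12, ![p, q, r], rfl, ?_, ?_, ?_, ?_⟩
  · intro j
    fin_cases j
    exacts [hp.mono hsub12, arcq, arcr]
  · intro t ht
    simp [hr]
  · intro j t ht
    fin_cases j
    exacts [(hq t (hsub2 ht)).2, wqr t ht, wrp t ht]
  · intro j t ht x hx hcx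
    fin_cases j
    · rcases hK.companion_unique_abs (hp0 t (hsub2 ht)) (hle t (hsub12 ht)) (hq t (hsub2 ht)).2
        (hqni t (hsub2 ht)) (hpqni t (hsub2 ht)) (hmid t (hsub2 ht)) hx hcx with h | h
      · exact ⟨1, Or.inl h⟩
      · exact ⟨2, Or.inl h⟩
    · rcases hK.companion_unique_abs (hq0 t (hsub2 ht)) (hqle t ht) (wqr t ht)
        (hKi _ (hrf t ht)) (by
          rw [hqr t ht]; exact hKi _ (hK.neg_mem_frontier (hp.mem t (hsub12 ht))))
        (midq t ht) hx hcx with h | h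
      · exact ⟨2, Or.inl h⟩
      · exact ⟨0, Or.inl (by rw [h, hqr t ht, neg_neg]; rfl)⟩
    · rcases hK.companion_unique_abs (hK.frontier_ne_zero (hrf t ht)) (hrle t ht) (wrp t ht)
        (hKi _ (hp.mem t (hsub12 ht))) (by
          rw [hrp t ht]; exact hKi _ (hK.neg_mem_frontier (hqf t (hsub2 ht))))
        (midr t ht) hx hcx with h | h
      · exact ⟨0, Or.inl h⟩
      · exact ⟨1, Or.inl (by rw [h, hrp t ht, neg_neg]; rfl)⟩

/-- A continuously differentiable arc around the origin on a compact parameter interval, whose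
positions all make a positive angle with all its directions. -/
structure Turning (τ : ℝ → ℝ × ℝ) (s₀ s₁ : ℝ) : Prop where
  lt : s₀ < s₁
  deriv : ∀ t ∈ Set.Icc s₀ s₁, HasDerivAt τ (deriv τ t) t
  cont : ContinuousOn (_root_.deriv τ) (Set.Icc s₀ s₁)
  pos : ∀ s ∈ Set.Icc s₀ s₁, ∀ t ∈ Set.Icc s₀ s₁, 0 < wedge (τ s) (_root_.deriv τ t)

/-- The closed cone between two vectors. -/
def Cone (u v : ℝ × ℝ) : Set (ℝ × ℝ) := {x | 0 ≤ wedge u x ∧ 0 ≤ wedge x v}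

/-- The sector spanned by an arc. -/
def Sector (τ : ℝ → ℝ × ℝ) (s₀ s₁ : ℝ) : Set (ℝ × ℝ) :=
  {x | ∃ l ∈ Set.Icc (0 : ℝ) 1, ∃ t ∈ Set.Icc s₀ s₁, x = l • τ t}

lemma isClosed_cone (u v : ℝ × ℝ) : IsClosed (Cone u v) :=
  (isClosed_le (f := fun _ => (0 : ℝ)) (g := fun x => wedge u x) continuous_const
    (continuous_const.wedge continuous_id)).inter
  (isClosed_le (f := fun _ => (0 : ℝ)) (g := fun x => wedge x v) continuous_const
    (continuous_id.wedge continuous_const))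

namespace Turning

variable {τ : ℝ → ℝ × ℝ} {s₀ s₁ : ℝ} (h : Turning τ s₀ s₁)

include h

lemma continuousOn : ContinuousOn τ (Set.Icc s₀ s₁) := fun t ht =>
  (h.deriv t ht).continuousAt.continuousWithinAt

lemma left_mem : s₀ ∈ Set.Icc s₀ s₁ := Set.left_mem_Icc.2 h.lt.le

lemma right_mem : s₁ ∈ Set.Icc s₀ s₁ := Set.right_mem_Icc.2 h.lt.le

lemma wedge_pos {s t : ℝ} (hs : s ∈ Set.Icc s₀ s₁) (ht : t ∈ Set.Icc s₀ s₁) (hst : s < t) :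
    0 < wedge (τ s) (τ t) := by
  have hm : StrictMonoOn (fun x => wedge (τ s) (τ x)) (Set.Icc s₀ s₁) := by
    refine strictMonoOn_of_deriv_pos (convex_Icc _ _) (continuousOn_const.wedge h.continuousOn) ?_
    intro x hx
    have hx' := interior_subset hx
    rw [((h.deriv x hx').const_wedge (τ s)).deriv]
    exact h.pos s hs x hx'
  have := hm hs ht hst
  simpa [wedge_self] using this

lemma wedge_nonneg {s t : ℝ} (hs : s ∈ Set.Icc s₀ s₁) (ht : t ∈ Set.Icc s₀ s₁) (hst : s ≤ t) :
    0 ≤ wedge (τ s) (τ t) := by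
  rcases hst.eq_or_lt with rfl | hlt
  · rw [wedge_self]
  · exact (h.wedge_pos hs ht hlt).le

lemma mem_cone {t l : ℝ} (ht : t ∈ Set.Icc s₀ s₁) (hl : 0 ≤ l) :
    l • τ t ∈ Cone (τ s₀) (τ s₁) := by
  constructor
  · rw [wedge_smul_right]; exact mul_nonneg hl (h.wedge_nonneg h.left_mem ht ht.1)
  · rw [wedge_smul_left]; exact mul_nonneg hl (h.wedge_nonneg ht h.right_mem ht.2)

lemma ne_zero {t : ℝ} (ht : t ∈ Set.Icc s₀ s₁) : τ t ≠ 0 := by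
  intro h0
  have := h.pos t ht t ht
  rw [h0, wedge_zero_left] at this
  exact lt_irrefl _ this

lemma exists_of_mem_cone {x : ℝ × ℝ} (hx : x ∈ Cone (τ s₀) (τ s₁)) :
    ∃ l : ℝ, 0 ≤ l ∧ ∃ t ∈ Set.Icc s₀ s₁, x = l • τ t := by
  have hc : ContinuousOn (fun t => wedge x (τ t)) (Set.Icc s₀ s₁) :=
    continuousOn_const.wedge h.continuousOn
  obtain ⟨t, ht, hxt⟩ := intermediate_value_Icc h.lt.le hc
    (show (0 : ℝ) ∈ Set.Icc _ _ from ⟨by rw [wedge_swap]; linarith [hx.1], hx.2⟩)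
  simp only at hxt
  obtain ⟨l, hl⟩ := eq_smul_of_wedge_eq_zero (h.ne_zero ht) (x := x) (by rw [wedge_swap, hxt, neg_zero])
  refine ⟨l, ?_, t, ht, hl⟩
  by_contra! hneg
  have h1 := hx.1
  have h2 := hx.2
  rw [hl, wedge_smul_right] at h1
  rw [hl, wedge_smul_left] at h2
  rcases ht.1.eq_or_lt with he | hlt
  · have := h.wedge_pos ht h.right_mem (he ▸ h.lt)
    nlinarith
  · have := h.wedge_pos h.left_mem ht hlt
    nlinarith

lemma sector_subset_cone : Sector τ s₀ s₁ ⊆ Cone (τ s₀) (τ s₁) := by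
  rintro _ ⟨l, hl, t, ht, rfl⟩
  exact h.mem_cone ht hl.1

lemma cone_inter_neg {x : ℝ × ℝ} (hx : x ∈ Cone (τ s₀) (τ s₁)) (hx' : -x ∈ Cone (τ s₀) (τ s₁)) :
    x = 0 := by
  have h1 : wedge (τ s₀) x = 0 := by
    have := hx'.1; rw [wedge_neg_right] at this; linarith [hx.1]
  have h2 : wedge x (τ s₁) = 0 := by
    have := hx'.2; rw [wedge_neg_left] at this; linarith [hx.2]
  have h3 := eq_coords (h.wedge_pos h.left_mem h.right_mem h.lt).ne' x
  rw [h3, h1, h2]; simp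

lemma smul_inj {l m s t : ℝ} (hl : 0 < l) (hm : 0 < m) (hs : s ∈ Set.Icc s₀ s₁)
    (ht : t ∈ Set.Icc s₀ s₁) (he : l • τ s = m • τ t) : l = m ∧ s = t := by
  have hst : s = t := by
    rcases lt_trichotomy s t with hlt | heq | hlt
    · have h1 := h.wedge_pos hs ht hlt
      have h2 : wedge (l • τ s) (m • τ t) = 0 := by rw [he, wedge_self]
      rw [wedge_smul_left, wedge_smul_right] at h2
      have := mul_pos hl (mul_pos hm h1)
      linarith
    · exact heq
    · have h1 := h.wedge_pos ht hs hlt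
      have h2 : wedge (m • τ t) (l • τ s) = 0 := by rw [he, wedge_self]
      rw [wedge_smul_left, wedge_smul_right] at h2
      have := mul_pos hm (mul_pos hl h1)
      linarith
  subst hst
  exact ⟨smul_left_injective ℝ (h.ne_zero hs) he, rfl⟩

lemma isCompact_sector : IsCompact (Sector τ s₀ s₁) := by
  have h1 : Sector τ s₀ s₁ = (fun y : ℝ × ℝ => y.1 • τ y.2) '' (Set.Icc 0 1 ×ˢ Set.Icc s₀ s₁) := by
    ext x
    constructor
    · rintro ⟨l, hl, t, ht, rfl⟩; exact ⟨(l, t), ⟨hl, ht⟩, rfl⟩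
    · rintro ⟨⟨l, t⟩, ⟨hl, ht⟩, rfl⟩; exact ⟨l, hl, t, ht, rfl⟩
  rw [h1]
  refine (isCompact_Icc.prod isCompact_Icc).image_of_continuousOn ?_
  exact continuousOn_fst.smul (h.continuousOn.comp continuousOn_snd fun y hy => hy.2)

/-- The area of a sector. -/
lemma volume_sector : (volume (Sector τ s₀ s₁)).toReal
    = 1 / 2 * ∫ t in s₀..s₁, wedge (τ t) (_root_.deriv τ t) := by
  set S : Set (ℝ × ℝ) := Set.Ioc 0 1 ×ˢ Set.Icc s₀ s₁ with hS
  set Φ : ℝ × ℝ → ℝ × ℝ := fun y => y.1 • τ y.2 with hΦ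
  set Φ' : ℝ × ℝ → (ℝ × ℝ →L[ℝ] ℝ × ℝ) := fun y =>
    (Matrix.toLin (.finTwoProd ℝ) (.finTwoProd ℝ)
      !![(τ y.2).1, y.1 * (_root_.deriv τ y.2).1;
        (τ y.2).2, y.1 * (_root_.deriv τ y.2).2]).toContinuousLinearMap with hΦ'
  have hSm : MeasurableSet S := measurableSet_Ioc.prod measurableSet_Icc
  have hder : ∀ y ∈ S, HasFDerivWithinAt Φ (Φ' y) S y := by
    intro y hy
    have h1 : HasFDerivAt (fun z : ℝ × ℝ => τ z.2)
        (ContinuousLinearMap.smulRight (ContinuousLinearMap.snd ℝ ℝ ℝ) (_root_.deriv τ y.2)) y := by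
      have := (h.deriv y.2 hy.2).hasFDerivAt.comp y (hasFDerivAt_snd (𝕜 := ℝ) (p := y))
      refine this.congr_fderiv ?_
      ext <;> simp
    have h2 := (hasFDerivAt_fst (𝕜 := ℝ) (p := y)).smul h1
    refine (h2.congr_fderiv ?_).hasFDerivWithinAt
    simp only [hΦ']
    rw [Matrix.toLin_finTwoProd_toContinuousLinearMap]
    ext <;> simp
  have hinj : Set.InjOn Φ S := by
    rintro ⟨l, s⟩ ⟨hl, hs⟩ ⟨m, t⟩ ⟨hm, ht⟩ he
    obtain ⟨h1, h2⟩ := h.smul_inj hl.1 hm.1 hs ht he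
    exact Prod.ext h1 h2
  have hdet : ∀ y, (Φ' y).det = y.1 * wedge (τ y.2) (_root_.deriv τ y.2) := by
    intro y
    simp only [hΦ', LinearMap.det_toContinuousLinearMap, LinearMap.det_toLin,
      Matrix.det_fin_two_of, wedge]
    ring
  have himg : Φ '' S = Sector τ s₀ s₁ \ {0} := by
    ext x
    constructor
    · rintro ⟨⟨l, t⟩, ⟨hl, ht⟩, rfl⟩
      exact ⟨⟨l, ⟨hl.1.le, hl.2⟩, t, ht, rfl⟩, smul_ne_zero hl.1.ne' (h.ne_zero ht)⟩
    · rintro ⟨⟨l, hl, t, ht, rfl⟩, h0⟩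
      refine ⟨(l, t), ⟨⟨hl.1.lt_of_ne ?_, hl.2⟩, ht⟩, rfl⟩
      rintro rfl
      simp at h0
  have hvol : volume (Sector τ s₀ s₁) = volume (Φ '' S) := by
    rw [himg]; exact (measure_sdiff_null (by simp)).symm
  have key := integral_image_eq_integral_abs_det_fderiv_smul volume hSm hder hinj (fun _ => (1 : ℝ))
  rw [setIntegral_const, smul_eq_mul, mul_one, measureReal_def, ← hvol] at key
  rw [key]
  have h3 : ∫ y in S, |(Φ' y).det| • (1 : ℝ)
      = ∫ y in S, y.1 * wedge (τ y.2) (_root_.deriv τ y.2) := by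
    refine setIntegral_congr_fun hSm fun y hy => ?_
    simp only [hdet, smul_eq_mul, mul_one]
    exact abs_of_nonneg (mul_nonneg hy.1.1.le (h.pos _ hy.2 _ hy.2).le)
  rw [h3, hS, Measure.volume_eq_prod, setIntegral_prod_mul (fun l : ℝ => l)
    (fun t => wedge (τ t) (_root_.deriv τ t)), intervalIntegral.integral_of_le h.lt.le,
    integral_Icc_eq_integral_Ioc, ← intervalIntegral.integral_of_le zero_le_one, integral_id]
  norm_num

end Turning

lemma isCSCD_of_separated {M : Set (ℝ × ℝ)} {u v : ℝ × ℝ} (hb : Bornology.IsBounded M)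
    (hneg : ∀ x ∈ M, -x ∈ M) (hu : u ∈ M) (hv : v ∈ M) (huv : wedge u v ≠ 0)
    (hsep : ∀ x, x ∉ M → ∃ f : (ℝ × ℝ) →L[ℝ] ℝ, (∀ y ∈ M, f y ≤ 1) ∧ 1 < f x) : IsCSCD M := by
  have hclosed : IsClosed M := by
    rw [← isOpen_compl_iff, isOpen_iff_mem_nhds]
    intro x hx
    obtain ⟨f, hf, hfx⟩ := hsep x hx
    filter_upwards [(f.continuous.continuousAt (x := x)).eventually_const_lt hfx] with y hy hyM
    exact absurd (hf y hyM) (not_le.2 hy)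
  refine ⟨?_, Metric.isCompact_of_isClosed_isBounded hclosed hb, ⟨0, ?_⟩, ?_⟩
  · intro x hx y hy a b ha hb hab
    by_contra hz
    obtain ⟨f, hf, hfz⟩ := hsep _ hz
    rw [map_add, map_smul, map_smul, smul_eq_mul, smul_eq_mul] at hfz
    have h1 := mul_le_mul_of_nonneg_left (hf x hx) ha
    have h2 := mul_le_mul_of_nonneg_left (hf y hy) hb
    linarith
  · rw [mem_interior_iff_mem_nhds]
    have hc : ContinuousAt (fun x => |wedge x v / wedge u v| + |wedge u x / wedge u v|) 0 := by
      have h1 : Continuous fun x => wedge x v := continuous_id.wedge continuous_const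
      have h2 : Continuous fun x => wedge u x := continuous_const.wedge continuous_id
      fun_prop
    have h0 : |wedge 0 v / wedge u v| + |wedge u 0 / wedge u v| < 1 := by
      simp [wedge_zero_left, wedge_zero_right]
    filter_upwards [hc.eventually_lt_const h0] with x hx
    by_contra hxM
    obtain ⟨f, hf, hfx⟩ := hsep _ hxM
    rw [eq_coords huv x, map_add, map_smul, map_smul, smul_eq_mul, smul_eq_mul] at hfx
    have habs : ∀ y ∈ M, |f y| ≤ 1 := fun y hy => abs_le.2 ⟨by
      have := hf _ (hneg y hy); rw [map_neg] at this; linarith, hf y hy⟩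
    have h1 : wedge x v / wedge u v * f u ≤ |wedge x v / wedge u v| := by
      refine (le_abs_self _).trans ?_
      rw [abs_mul]
      exact mul_le_of_le_one_right (abs_nonneg _) (habs u hu)
    have h2 : wedge u x / wedge u v * f v ≤ |wedge u x / wedge u v| := by
      refine (le_abs_self _).trans ?_
      rw [abs_mul]
      exact mul_le_of_le_one_right (abs_nonneg _) (habs v hv)
    linarith
  · ext x
    rw [Set.mem_neg]
    exact ⟨hneg x, fun h => by simpa using hneg _ h⟩

lemma wedge_mul_apply (f : (ℝ × ℝ) →L[ℝ] ℝ) (a b x : ℝ × ℝ) :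
    wedge a b * f x = wedge x b * f a + wedge a x * f b := by
  have := congrArg f (wedge_smul_eq a b x)
  simpa only [map_add, map_smul, smul_eq_mul] using this

lemma apply_tangent_nonneg {f : (ℝ × ℝ) →L[ℝ] ℝ} {u d z : ℝ × ℝ} (hz : 0 < wedge u z)
    (hzd : |wedge z d| ≤ wedge u d) (hu : |f u| ≤ 1) (hfz : f z = 1) : 0 ≤ f d := by
  have h1 := wedge_mul_apply f u d z
  have h2 : wedge z d * f u ≤ wedge u d := by
    refine (le_abs_self _).trans ?_
    rw [abs_mul]
    exact (mul_le_of_le_one_right (abs_nonneg _) hu).trans hzd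
  rw [hfz] at h1
  by_contra! h
  have := mul_neg_of_pos_of_neg hz h
  linarith

/-- A turning arc which turns to the left. -/
structure LeftTurning (τ : ℝ → ℝ × ℝ) (s₀ s₁ : ℝ) : Prop extends Turning τ s₀ s₁ where
  left : ∀ s ∈ Set.Icc s₀ s₁, ∀ t ∈ Set.Icc s₀ s₁, s ≤ t →
    0 ≤ wedge (_root_.deriv τ s) (_root_.deriv τ t)

/-- Replace the part of a centrally symmetric domain in a cone and its negative by a sector. -/
def recut (K : Set (ℝ × ℝ)) (τ : ℝ → ℝ × ℝ) (s₀ s₁ : ℝ) : Set (ℝ × ℝ) :=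
  {x | (x ∉ Cone (τ s₀) (τ s₁) ∧ -x ∉ Cone (τ s₀) (τ s₁) ∧ x ∈ K) ∨
    x ∈ Sector τ s₀ s₁ ∨ -x ∈ Sector τ s₀ s₁}

lemma not_mem_cone_cases {u v z : ℝ × ℝ} (h1 : z ∉ Cone u v) (h2 : -z ∉ Cone u v) :
    (0 < wedge u z ∧ 0 < wedge v z) ∨ (wedge u z < 0 ∧ wedge v z < 0) := by
  simp only [Cone, Set.mem_ofPred_eq, wedge_neg_left, wedge_neg_right, not_and_or, not_le] at h1 h2
  have := wedge_swap z v
  rcases h1 with h1 | h1 <;> rcases h2 with h2 | h2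
  · linarith
  · right; constructor <;> linarith
  · left; constructor <;> linarith
  · linarith

namespace LeftTurning

variable {τ : ℝ → ℝ × ℝ} {s₀ s₁ : ℝ} (h : LeftTurning τ s₀ s₁) {K : Set (ℝ × ℝ)}

include h

lemma monotoneOn_apply {f : (ℝ × ℝ) →L[ℝ] ℝ} (hf : ∀ t ∈ Set.Icc s₀ s₁, 0 ≤ f (_root_.deriv τ t)) :
    MonotoneOn (fun t => f (τ t)) (Set.Icc s₀ s₁) := by
  refine monotoneOn_of_deriv_nonneg (convex_Icc _ _)
    (f.continuous.comp_continuousOn h.continuousOn) ?_ ?_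
  · intro t ht
    exact (f.hasFDerivAt.comp_hasDerivAt t
      (h.deriv t (interior_subset ht))).differentiableAt.differentiableWithinAt
  · intro t ht
    have := f.hasFDerivAt.comp_hasDerivAt t (h.deriv t (interior_subset ht))
    have h2 := this.deriv
    rw [show (⇑f ∘ τ) = fun t => f (τ t) from rfl] at h2
    rw [h2]
    exact hf t (interior_subset ht)

/-- The tangent functional at a point of the arc is maximal there among points of the arc. -/
lemma wedge_deriv_le {s t : ℝ} (hs : s ∈ Set.Icc s₀ s₁) (ht : t ∈ Set.Icc s₀ s₁) :
    wedge (τ s) (_root_.deriv τ t) ≤ wedge (τ t) (_root_.deriv τ t) := by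
  have hd : ∀ x ∈ Set.Icc s₀ s₁, HasDerivAt (fun x => wedge (τ x) (_root_.deriv τ t))
      (wedge (_root_.deriv τ x) (_root_.deriv τ t)) x := fun x hx => (h.deriv x hx).wedge_const _
  rcases le_total s t with hst | hst
  · have hsub : Set.Icc s t ⊆ Set.Icc s₀ s₁ := Set.Icc_subset_Icc hs.1 ht.2
    have hm : MonotoneOn (fun x => wedge (τ x) (_root_.deriv τ t)) (Set.Icc s t) := by
      refine monotoneOn_of_deriv_nonneg (convex_Icc _ _)
        (fun x hx => (hd x (hsub hx)).continuousAt.continuousWithinAt)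
        (fun x hx => (hd x (hsub (interior_subset hx))).differentiableAt.differentiableWithinAt) ?_
      intro x hx
      have hx := interior_subset hx
      rw [(hd x (hsub hx)).deriv]
      exact h.left x (hsub hx) t ht hx.2
    exact hm ⟨le_rfl, hst⟩ ⟨hst, le_rfl⟩ hst
  · have hsub : Set.Icc t s ⊆ Set.Icc s₀ s₁ := Set.Icc_subset_Icc ht.1 hs.2
    have hm : AntitoneOn (fun x => wedge (τ x) (_root_.deriv τ t)) (Set.Icc t s) := by
      refine antitoneOn_of_deriv_nonpos (convex_Icc _ _)
        (fun x hx => (hd x (hsub hx)).continuousAt.continuousWithinAt)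
        (fun x hx => (hd x (hsub (interior_subset hx))).differentiableAt.differentiableWithinAt) ?_
      intro x hx
      have hx := interior_subset hx
      rw [(hd x (hsub hx)).deriv, wedge_swap]
      linarith [h.left t ht x (hsub hx) hx.1]
    exact hm ⟨le_rfl, hst⟩ ⟨hst, le_rfl⟩ hst

lemma abs_apply_le_one (hK : IsCSCD K) (h0 : τ s₀ ∈ K) (h1 : τ s₁ ∈ K)
    (ht0 : ∀ x ∈ K, 0 ≤ wedge (_root_.deriv τ s₀) (x - τ s₀))
    (ht1 : ∀ x ∈ K, 0 ≤ wedge (_root_.deriv τ s₁) (x - τ s₁)) {z : ℝ × ℝ} (hz : z ∈ K)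
    {f : (ℝ × ℝ) →L[ℝ] ℝ} (hfz : f z = 1) (hf : ∀ y ∈ K, f y ≤ 1)
    (hz0 : 0 < wedge (τ s₀) z) (hz1 : 0 < wedge (τ s₁) z) {s : ℝ} (hs : s ∈ Set.Icc s₀ s₁) :
    |f (τ s)| ≤ 1 := by
  have fabs : ∀ y ∈ K, |f y| ≤ 1 := fun y hy => abs_le.2 ⟨by
      have := hf _ (hK.neg_mem hy); rw [map_neg] at this; linarith, hf y hy⟩
  have htan : ∀ u d, (∀ x ∈ K, 0 ≤ wedge d (x - u)) → |wedge z d| ≤ wedge u d := by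
    intro u d hud
    have e1 := hud z hz
    have e2 := hud _ (hK.neg_mem hz)
    rw [wedge_sub_right, wedge_swap d z, wedge_swap d u] at e1
    rw [wedge_sub_right, wedge_neg_right, wedge_swap d z, wedge_swap d u] at e2
    exact abs_le.2 ⟨by linarith, by linarith⟩
  have hfD0 := apply_tangent_nonneg hz0 (htan _ _ ht0) (fabs _ h0) hfz
  have hfD1 := apply_tangent_nonneg hz1 (htan _ _ ht1) (fabs _ h1) hfz
  have huv := h.wedge_pos h.left_mem h.right_mem h.lt
  have hzuv := wedge_mul_apply f (τ s₀) (τ s₁) z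
  rw [hfz, wedge_swap z] at hzuv
  have hsuv := wedge_mul_apply f (τ s₀) (τ s₁) (τ s)
  have c1 := h.wedge_nonneg hs h.right_mem hs.2
  have c2 := h.wedge_nonneg h.left_mem hs hs.1
  have b0 := abs_le.1 (fabs _ h0)
  have b1 := abs_le.1 (fabs _ h1)
  rw [abs_le]
  constructor
  · rcases le_or_gt (f (τ s₀)) 0 with hneg | hpos
    · have hm := h.monotoneOn_apply (f := f) (fun t ht => by
        have e := wedge_mul_apply f (τ s₀) (_root_.deriv τ s₀) (_root_.deriv τ t)
        have p1 := h.pos _ h.left_mem _ h.left_mem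
        have p2 := h.pos _ h.left_mem _ ht
        have p3 := h.left _ h.left_mem _ ht ht.1
        rw [wedge_swap (_root_.deriv τ t)] at e
        have q1 := mul_nonneg p2.le hfD0
        have q2 := mul_nonneg p3 (neg_nonneg.2 hneg)
        by_contra! hlt
        have q3 := mul_neg_of_pos_of_neg p1 hlt
        linarith)
      have := hm h.left_mem hs hs.1
      simp only at this
      linarith
    · have hv : 0 < f (τ s₁) := by
        by_contra! hle
        have := mul_pos hz1 hpos
        have := mul_nonneg hz0.le (neg_nonneg.2 hle)
        linarith
      have q1 := mul_nonneg c1 hpos.le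
      have q2 := mul_nonneg c2 hv.le
      by_contra! hlt
      have := mul_neg_of_pos_of_neg huv (show f (τ s) < 0 by linarith)
      linarith
  · rcases le_or_gt 0 (f (τ s₁)) with hnn | hneg
    · have hm := h.monotoneOn_apply (f := f) (fun t ht => by
        have e := wedge_mul_apply f (τ s₁) (_root_.deriv τ s₁) (_root_.deriv τ t)
        have p1 := h.pos _ h.right_mem _ h.right_mem
        have p2 := h.pos _ h.right_mem _ ht
        have p3 := h.left _ ht _ h.right_mem ht.2
        have q1 := mul_nonneg p2.le hfD1
        have q2 := mul_nonneg p3 hnn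
        by_contra! hlt
        have q3 := mul_neg_of_pos_of_neg p1 hlt
        linarith)
      have := hm hs h.right_mem hs.2
      simp only at this
      linarith
    · have hu : f (τ s₀) < 0 := by
        by_contra! hle
        have := mul_nonneg hz1.le hle
        have := mul_neg_of_pos_of_neg hz0 hneg
        linarith
      have q1 := mul_nonneg c1 (neg_nonneg.2 hu.le)
      have q2 := mul_nonneg c2 (neg_nonneg.2 hneg.le)
      by_contra! hlt
      have := mul_pos huv (show 0 < f (τ s) by linarith)
      linarith

/-- Outside the cone, a domain stays behind the tangent lines of the arc. -/
lemma wedge_deriv_le_of_mem (ht0 : ∀ x ∈ K, 0 ≤ wedge (_root_.deriv τ s₀) (x - τ s₀))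
    (ht1 : ∀ x ∈ K, 0 ≤ wedge (_root_.deriv τ s₁) (x - τ s₁)) {y : ℝ × ℝ} (hy : y ∈ K)
    (hyC : y ∉ Cone (τ s₀) (τ s₁)) (hyC' : -y ∉ Cone (τ s₀) (τ s₁)) {t : ℝ}
    (ht : t ∈ Set.Icc s₀ s₁) :
    wedge y (_root_.deriv τ t) ≤ wedge (τ t) (_root_.deriv τ t) := by
  have key : ∀ u d D : ℝ × ℝ, 0 < wedge u d → 0 < wedge u D → 0 ≤ wedge D d * wedge u y →
      0 ≤ wedge d (y - u) → wedge y D ≤ wedge u D := by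
    intro u d D h1 h2 h3 h4
    have e : wedge u d * wedge y D = wedge u D * wedge y d - wedge D d * wedge u y := by
      simp only [wedge]; ring
    rw [wedge_sub_right, wedge_swap d y, wedge_swap d u] at h4
    have h5 : wedge u d * wedge y D ≤ wedge u d * wedge u D := by
      rw [e]
      have := mul_le_mul_of_nonneg_left (show wedge y d ≤ wedge u d by linarith) h2.le
      linarith
    exact le_of_mul_le_mul_left h5 h1
  rcases not_mem_cone_cases hyC hyC' with ⟨hc0, hc1⟩ | ⟨hc0, hc1⟩
  · exact (key _ _ _ (h.pos _ h.right_mem _ h.right_mem) (h.pos _ h.right_mem _ ht)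
      (mul_nonneg (h.left _ ht _ h.right_mem ht.2) hc1.le) (ht1 y hy)).trans
      (h.wedge_deriv_le h.right_mem ht)
  · refine (key _ _ _ (h.pos _ h.left_mem _ h.left_mem) (h.pos _ h.left_mem _ ht)
      ?_ (ht0 y hy)).trans (h.wedge_deriv_le h.left_mem ht)
    rw [wedge_swap (_root_.deriv τ t)]
    have := mul_nonneg (h.left _ h.left_mem _ ht ht.1) (neg_nonneg.2 hc0.le)
    linarith

lemma recut_cone {x : ℝ × ℝ} (hx : x ∈ Cone (τ s₀) (τ s₁)) :
    x ∈ recut K τ s₀ s₁ ↔ x ∈ Sector τ s₀ s₁ := by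
  refine ⟨?_, fun hs => Or.inr (Or.inl hs)⟩
  rintro (h1 | h1 | h1)
  · exact absurd hx h1.1
  · exact h1
  · rw [h.cone_inter_neg hx (h.sector_subset_cone h1)]
    exact ⟨0, by simp, s₀, h.left_mem, by simp⟩

omit h in
lemma neg_mem_recut (hK : IsCSCD K) {x : ℝ × ℝ} (hx : x ∈ recut K τ s₀ s₁) :
    -x ∈ recut K τ s₀ s₁ := by
  rcases hx with h1 | h1 | h1
  · exact Or.inl ⟨h1.2.1, by simpa using h1.1, hK.neg_mem h1.2.2⟩
  · exact Or.inr (Or.inr (by simpa using h1))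
  · exact Or.inr (Or.inl h1)

lemma recut_outside {x : ℝ × ℝ} (hx : x ∉ Cone (τ s₀) (τ s₁))
    (hx' : -x ∉ Cone (τ s₀) (τ s₁)) : x ∈ recut K τ s₀ s₁ ↔ x ∈ K := by
  refine ⟨?_, fun h1 => Or.inl ⟨hx, hx', h1⟩⟩
  rintro (h1 | h1 | h1)
  · exact h1.2.2
  · exact absurd (h.sector_subset_cone h1) hx
  · exact absurd (h.sector_subset_cone h1) hx'

omit h in
lemma arc_mem_recut {t : ℝ} (ht : t ∈ Set.Icc s₀ s₁) : τ t ∈ recut K τ s₀ s₁ :=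
  Or.inr (Or.inl ⟨1, by simp, t, ht, by simp⟩)

/-- Convexity of the modified domain. -/
lemma isCSCD_recut (hK : IsCSCD K) (h0 : τ s₀ ∈ K) (h1 : τ s₁ ∈ K)
    (ht0 : ∀ x ∈ K, 0 ≤ wedge (_root_.deriv τ s₀) (x - τ s₀))
    (ht1 : ∀ x ∈ K, 0 ≤ wedge (_root_.deriv τ s₁) (x - τ s₁)) : IsCSCD (recut K τ s₀ s₁) := by
  refine isCSCD_of_separated ?_ (fun x => neg_mem_recut hK) (arc_mem_recut h.left_mem)
    (arc_mem_recut h.right_mem) (h.wedge_pos h.left_mem h.right_mem h.lt).ne' ?_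
  · have hS := h.isCompact_sector.isBounded
    refine (hK.2.1.isBounded.union (hS.union hS.neg)).subset ?_
    rintro x (hx | hx | hx)
    · exact Or.inl hx.2.2
    · exact Or.inr (Or.inl hx)
    · exact Or.inr (Or.inr hx)
  · have hcone : ∀ x, x ∉ recut K τ s₀ s₁ → x ∈ Cone (τ s₀) (τ s₁) →
        ∃ f : (ℝ × ℝ) →L[ℝ] ℝ, (∀ y ∈ recut K τ s₀ s₁, f y ≤ 1) ∧ 1 < f x := by
      intro x hx hxC
      obtain ⟨l, hl, t, ht, rfl⟩ := h.exists_of_mem_cone hxC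
      have hl1 : 1 < l := by
        by_contra! hle
        exact hx (Or.inr (Or.inl ⟨l, ⟨hl, hle⟩, t, ht, rfl⟩))
      set D := _root_.deriv τ t with hD
      have hpos : 0 < wedge (τ t) D := h.pos t ht t ht
      let f : (ℝ × ℝ) →L[ℝ] ℝ := (wedge (τ t) D)⁻¹ •
        (D.2 • ContinuousLinearMap.fst ℝ ℝ ℝ - D.1 • ContinuousLinearMap.snd ℝ ℝ ℝ)
      have hf : ∀ y, f y = wedge y D / wedge (τ t) D := by
        intro y
        have : f y = (wedge (τ t) D)⁻¹ * (D.2 * y.1 - D.1 * y.2) := by simp [f]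
        rw [this]
        simp only [wedge]; ring
      have hsec : ∀ y ∈ Sector τ s₀ s₁, 0 ≤ f y ∧ f y ≤ 1 := by
        rintro _ ⟨m, hm, s, hs, rfl⟩
        rw [hf, wedge_smul_left]
        have a1 := h.pos s hs t ht
        have a2 := h.wedge_deriv_le hs ht
        refine ⟨div_nonneg (mul_nonneg hm.1 a1.le) hpos.le, (div_le_one hpos).2 ?_⟩
        exact (mul_le_of_le_one_left a1.le hm.2).trans a2
      refine ⟨f, ?_, ?_⟩
      · rintro y (hy | hy | hy)
        · rw [hf, div_le_one hpos]
          exact h.wedge_deriv_le_of_mem ht0 ht1 hy.2.2 hy.1 hy.2.1 ht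
        · exact (hsec y hy).2
        · have := (hsec _ hy).1
          rw [map_neg] at this
          linarith
      · rw [hf, wedge_smul_left, mul_div_assoc, div_self hpos.ne', mul_one]
        exact hl1
    have hout : ∀ x, x ∉ recut K τ s₀ s₁ → x ∉ Cone (τ s₀) (τ s₁) → -x ∉ Cone (τ s₀) (τ s₁) →
        0 < wedge (τ s₀) x → 0 < wedge (τ s₁) x →
        ∃ f : (ℝ × ℝ) →L[ℝ] ℝ, (∀ y ∈ recut K τ s₀ s₁, f y ≤ 1) ∧ 1 < f x := by
      intro x hx hxC hxC' hx0 hx1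
      have hxK : x ∉ K := fun hxK => hx (Or.inl ⟨hxC, hxC', hxK⟩)
      obtain ⟨μ, hμ, hz⟩ := hK.exists_frontier_ray (x := x) (by
        rintro rfl; exact hxK hK.zero_mem)
      have hzK := hK.mem_frontier_iff.1 hz
      have hμ1 : μ < 1 := by
        by_contra! hle
        apply hxK
        have := hK.smul_mem hzK.1 (a := μ⁻¹) (by positivity) (inv_le_one_of_one_le₀ hle)
        rwa [smul_smul, inv_mul_cancel₀ hμ.ne', one_smul] at this
      obtain ⟨g, hg0, hg, -⟩ := hK.exists_support hzK.2
      set f : (ℝ × ℝ) →L[ℝ] ℝ := (g (μ • x))⁻¹ • g with hf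
      have hfa : ∀ y, f y = g y / g (μ • x) := fun y => by simp [hf]; ring
      have hfz : f (μ • x) = 1 := by rw [hfa, div_self hg0.ne']
      have hf1 : ∀ y ∈ K, f y ≤ 1 := fun y hy => by
        rw [hfa, div_le_one hg0]; exact hg y hy
      have hab : ∀ s ∈ Set.Icc s₀ s₁, |f (τ s)| ≤ 1 := fun s hs =>
        h.abs_apply_le_one hK h0 h1 ht0 ht1 hzK.1 hfz hf1
          (by rw [wedge_smul_right]; positivity) (by rw [wedge_smul_right]; positivity) hs
      have hsec : ∀ y ∈ Sector τ s₀ s₁, |f y| ≤ 1 := by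
        rintro _ ⟨m, hm, s, hs, rfl⟩
        rw [map_smul, smul_eq_mul, abs_mul, abs_of_nonneg hm.1]
        exact mul_le_one₀ hm.2 (abs_nonneg _) (hab s hs)
      refine ⟨f, ?_, ?_⟩
      · rintro y (hy | hy | hy)
        · exact hf1 y hy.2.2
        · exact (abs_le.1 (hsec y hy)).2
        · have := (abs_le.1 (hsec _ hy)).1
          rw [map_neg] at this
          linarith
      · rw [map_smul, smul_eq_mul] at hfz
        by_contra! hle
        nlinarith
    have hflip : ∀ x, (∃ f : (ℝ × ℝ) →L[ℝ] ℝ, (∀ y ∈ recut K τ s₀ s₁, f y ≤ 1) ∧ 1 < f (-x)) →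
        ∃ f : (ℝ × ℝ) →L[ℝ] ℝ, (∀ y ∈ recut K τ s₀ s₁, f y ≤ 1) ∧ 1 < f x := by
      rintro x ⟨f, hf, hfx⟩
      refine ⟨-f, fun y hy => ?_, by simpa using hfx⟩
      have := hf _ (neg_mem_recut hK hy)
      simpa using this
    intro x hx
    have hx' : -x ∉ recut K τ s₀ s₁ := fun hm => hx (by simpa using neg_mem_recut hK hm)
    by_cases hC : x ∈ Cone (τ s₀) (τ s₁)
    · exact hcone x hx hC
    by_cases hC' : -x ∈ Cone (τ s₀) (τ s₁)
    · exact hflip x (hcone _ hx' hC')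
    rcases not_mem_cone_cases hC hC' with ⟨a1, a2⟩ | ⟨a1, a2⟩
    · exact hout x hx hC hC' a1 a2
    · exact hflip x (hout _ hx' hC' (by simpa using hC)
        (by rw [wedge_neg_right]; linarith) (by rw [wedge_neg_right]; linarith))

lemma mem_frontier_recut_of_not_mem (hK : IsCSCD K) (hM : IsCSCD (recut K τ s₀ s₁)) {x : ℝ × ℝ}
    (hx : x ∉ Cone (τ s₀) (τ s₁)) (hx' : -x ∉ Cone (τ s₀) (τ s₁)) :
    x ∈ frontier (recut K τ s₀ s₁) ↔ x ∈ frontier K := by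
  have hsc : ∀ y : ℝ × ℝ, ∀ μ : ℝ, 1 < μ → y ∉ Cone (τ s₀) (τ s₁) → μ • y ∉ Cone (τ s₀) (τ s₁) := by
    intro y μ hμ hy hyμ
    apply hy
    have h1 := hyμ.1
    have h2 := hyμ.2
    rw [wedge_smul_right] at h1
    rw [wedge_smul_left] at h2
    exact ⟨(mul_nonneg_iff_of_pos_left (by linarith)).1 h1,
      (mul_nonneg_iff_of_pos_left (by linarith)).1 h2⟩
  rw [hM.mem_frontier_iff_smul, hK.mem_frontier_iff_smul, h.recut_outside hx hx']
  refine and_congr_right fun _ => forall₂_congr fun μ hμ => ?_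
  rw [h.recut_outside (hsc x μ hμ hx) (by rw [← smul_neg]; exact hsc _ μ hμ hx')]

end LeftTurning

lemma Turning.volume_split {σ : ℝ → ℝ × ℝ} {s₀ s₁ : ℝ} (h : Turning σ s₀ s₁) {M : Set (ℝ × ℝ)}
    (hM : IsCSCD M)
    (hC : ∀ x ∈ Cone (σ s₀) (σ s₁), x ∈ M ↔ x ∈ Sector σ s₀ s₁) :
    (volume M).toReal = (volume {x | x ∈ M ∧ x ∉ Cone (σ s₀) (σ s₁) ∧ -x ∉ Cone (σ s₀) (σ s₁)}).toReal
      + ∫ t in s₀..s₁, wedge (σ t) (_root_.deriv σ t) := by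
  set C := Cone (σ s₀) (σ s₁) with hCdef
  set T := Sector σ s₀ s₁ with hT
  have hTC : T ⊆ C := h.sector_subset_cone
  have hTc : IsCompact T := h.isCompact_sector
  have hCm : MeasurableSet (C ∪ -C) :=
    (isClosed_cone _ _).measurableSet.union (isClosed_cone _ _).neg.measurableSet
  have hfin : volume M ≠ ⊤ := hM.2.1.measure_lt_top.ne
  have e1 : M ∩ (C ∪ -C) = T ∪ -T := by
    ext x
    constructor
    · rintro ⟨hx, hxC | hxC⟩
      · exact Or.inl ((hC x hxC).1 hx)
      · exact Or.inr ((hC _ hxC).1 (hM.neg_mem hx))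
    · rintro (hx | hx)
      · exact ⟨(hC x (hTC hx)).2 hx, Or.inl (hTC hx)⟩
      · exact ⟨hM.neg_mem_iff.1 ((hC _ (hTC hx)).2 hx), Or.inr (hTC hx)⟩
  have e2 : M \ (C ∪ -C) = {x | x ∈ M ∧ x ∉ C ∧ -x ∉ C} := by
    ext x
    simp only [Set.mem_sdiff, Set.mem_union, Set.mem_neg, not_or, Set.mem_ofPred_eq]
  have e3 : volume (T ∪ -T) = volume T + volume T := by
    have hTm := hTc.neg.measurableSet
    rw [measure_union₀ hTm.nullMeasurableSet, Measure.measure_neg]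
    refine measure_mono_null (t := {0}) ?_ (by simp)
    rintro x ⟨hx, hx'⟩
    exact h.cone_inter_neg (hTC hx) (hTC hx')
  have e4 := measure_inter_add_sdiff (μ := volume) M hCm
  rw [← e4, e1, e2, e3]
  have hT1 : volume T ≠ ⊤ := hTc.measure_lt_top.ne
  have hR : volume {x | x ∈ M ∧ x ∉ C ∧ -x ∉ C} ≠ ⊤ :=
    ne_top_of_le_ne_top hfin (measure_mono fun x hx => hx.1)
  rw [ENNReal.toReal_add (by simp [hT1]) hR, ENNReal.toReal_add hT1 hT1, h.volume_sector]
  ring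

/-- The change of area under a modification. -/
lemma LeftTurning.volume_recut {σ τ : ℝ → ℝ × ℝ} {s₀ s₁ : ℝ} {K : Set (ℝ × ℝ)}
    (h : LeftTurning τ s₀ s₁) (hσ : Turning σ s₀ s₁) (hK : IsCSCD K)
    (hM : IsCSCD (recut K τ s₀ s₁)) (hσK : ∀ t ∈ Set.Icc s₀ s₁, σ t ∈ frontier K)
    (h0 : σ s₀ = τ s₀) (h1 : σ s₁ = τ s₁) :
    (volume (recut K τ s₀ s₁)).toReal = (volume K).toReal
      + (∫ t in s₀..s₁, wedge (τ t) (_root_.deriv τ t))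
      - ∫ t in s₀..s₁, wedge (σ t) (_root_.deriv σ t) := by
  rw [h.toTurning.volume_split hM fun x hx => h.recut_cone hx, hσ.volume_split hK]
  · have : {x | x ∈ recut K τ s₀ s₁ ∧ x ∉ Cone (τ s₀) (τ s₁) ∧ -x ∉ Cone (τ s₀) (τ s₁)}
        = {x | x ∈ K ∧ x ∉ Cone (σ s₀) (σ s₁) ∧ -x ∉ Cone (σ s₀) (σ s₁)} := by
      ext x
      rw [h0, h1]
      exact ⟨fun hx => ⟨(h.recut_outside hx.2.1 hx.2.2).1 hx.1, hx.2⟩,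
        fun hx => ⟨(h.recut_outside hx.2.1 hx.2.2).2 hx.1, hx.2⟩⟩
    rw [this]; ring
  · intro x hx
    obtain ⟨l, hl, t, ht, rfl⟩ := hσ.exists_of_mem_cone hx
    have hf := hK.mem_frontier_iff_smul.1 (hσK t ht)
    constructor
    · intro hm
      refine ⟨l, ⟨hl, ?_⟩, t, ht, rfl⟩
      by_contra! hlt
      exact hf.2 l hlt hm
    · rintro ⟨m, hm, s, hs, he⟩
      rw [he]
      exact hK.smul_mem (hK.mem_frontier_iff_smul.1 (hσK s hs)).1 hm.1 hm.2

/-- A hexagon of arcs together with an admissible replacement with the same end data. -/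
structure HexVariation (K : Set (ℝ × ℝ)) (c : ℝ) (σ τ : Fin 3 → ℝ → ℝ × ℝ) (a b s₀ s₁ : ℝ) :
    Prop where
  hex : HexArc K c σ a b
  cross : ∀ j, ∀ s ∈ Set.Ioo a b, ∀ t ∈ Set.Ioo a b, 0 < _root_.wedge (σ j s) (σ (j + 1) t)
  sub : Set.Icc s₀ s₁ ⊆ Set.Ioo a b
  old : ∀ j, Turning (σ j) s₀ s₁
  new : ∀ j, LeftTurning (τ j) s₀ s₁
  left : ∀ j, τ j s₀ = σ j s₀
  right : ∀ j, τ j s₁ = σ j s₁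
  deriv_left : ∀ j, deriv (τ j) s₀ = deriv (σ j) s₀
  deriv_right : ∀ j, deriv (τ j) s₁ = deriv (σ j) s₁
  sum : ∀ t ∈ Set.Icc s₀ s₁, τ 0 t + τ 1 t + τ 2 t = 0
  wedge : ∀ j, ∀ t ∈ Set.Icc s₀ s₁, wedge (τ j t) (τ (j + 1) t) = c

namespace HexVariation

variable {K : Set (ℝ × ℝ)} {c : ℝ} {σ τ : Fin 3 → ℝ → ℝ × ℝ} {a b s₀ s₁ : ℝ}
  (h : HexVariation K c σ τ a b s₀ s₁)

include h

lemma exists_old {j : Fin 3} {x : ℝ × ℝ} (hx : x ∈ Cone (τ j s₀) (τ j s₁)) :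
    ∃ l : ℝ, 0 ≤ l ∧ ∃ t ∈ Set.Icc s₀ s₁, x = l • σ j t := by
  rw [h.left, h.right] at hx
  exact (h.old j).exists_of_mem_cone hx

lemma arc_outside {j k : Fin 3} (hjk : j ≠ k) {t : ℝ} (ht : t ∈ Set.Ioo a b) :
    σ j t ∉ Cone (τ k s₀) (τ k s₁) ∧ -σ j t ∉ Cone (τ k s₀) (τ k s₁) := by
  have m0 := h.sub (h.old k).left_mem
  have m1 := h.sub (h.old k).right_mem
  have hk : k = j + 1 ∨ j = k + 1 := by
    fin_cases j <;> fin_cases k <;> simp_all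
  rw [h.left, h.right]
  rcases hk with rfl | rfl
  · have e0 := h.cross j t ht _ m0
    have e1 := h.cross j t ht _ m1
    refine ⟨fun hc => ?_, fun hc => ?_⟩
    · have := hc.1; rw [wedge_swap] at this; linarith
    · have := hc.2; rw [wedge_neg_left] at this; linarith
  · have e0 := h.cross k _ m0 t ht
    have e1 := h.cross k _ m1 t ht
    refine ⟨fun hc => ?_, fun hc => ?_⟩
    · have := hc.2; rw [wedge_swap] at this; linarith
    · have := hc.1; rw [wedge_neg_right] at this; linarith

lemma cone_outside {j k : Fin 3} (hjk : j ≠ k) {x : ℝ × ℝ} (hx : x ∈ Cone (τ j s₀) (τ j s₁))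
    (hx0 : x ≠ 0) : x ∉ Cone (τ k s₀) (τ k s₁) ∧ -x ∉ Cone (τ k s₀) (τ k s₁) := by
  obtain ⟨l, hl, t, ht, rfl⟩ := h.exists_old hx
  have hl0 : 0 < l := hl.lt_of_ne (by rintro rfl; simp at hx0)
  have hsc : ∀ y : ℝ × ℝ, y ∉ Cone (τ k s₀) (τ k s₁) → l • y ∉ Cone (τ k s₀) (τ k s₁) := by
    intro y hy hly
    apply hy
    have h1 := hly.1
    have h2 := hly.2
    rw [wedge_smul_right] at h1
    rw [wedge_smul_left] at h2
    exact ⟨(mul_nonneg_iff_of_pos_left hl0).1 h1, (mul_nonneg_iff_of_pos_left hl0).1 h2⟩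
  have := h.arc_outside hjk (h.sub ht)
  exact ⟨hsc _ this.1, by rw [← smul_neg]; exact hsc _ this.2⟩

lemma step {L : Set (ℝ × ℝ)} (hL : IsCSCD L) {j : Fin 3} (hA : Arc L (σ j) a b) :
    IsCSCD (recut L (τ j) s₀ s₁) ∧ (∀ k, k ≠ j → Arc L (σ k) a b →
      Arc (recut L (τ j) s₀ s₁) (σ k) a b) ∧
    (volume (recut L (τ j) s₀ s₁)).toReal = (volume L).toReal
      + (∫ t in s₀..s₁, _root_.wedge (τ j t) (deriv (τ j) t))
      - ∫ t in s₀..s₁, _root_.wedge (σ j t) (deriv (σ j) t) := by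
  have m0 := h.sub (h.old j).left_mem
  have m1 := h.sub (h.old j).right_mem
  have hLm : ∀ t ∈ Set.Ioo a b, σ j t ∈ L := fun t ht => (hL.mem_frontier_iff.1 (hA.mem t ht)).1
  have hC : IsCSCD (recut L (τ j) s₀ s₁) := by
    refine (h.new j).isCSCD_recut hL (by rw [h.left]; exact hLm _ m0)
      (by rw [h.right]; exact hLm _ m1) (fun x hx => ?_) (fun x hx => ?_)
    · rw [h.left, h.deriv_left]; exact hA.tangent_nonneg hL m0 hx
    · rw [h.right, h.deriv_right]; exact hA.tangent_nonneg hL m1 hx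
  refine ⟨hC, fun k hk hAk => ⟨hAk.smooth, fun t ht => ?_, hAk.pos⟩, ?_⟩
  · have := h.arc_outside hk ht
    exact ((h.new j).mem_frontier_recut_of_not_mem hL hC this.1 this.2).2 (hAk.mem t ht)
  · exact (h.new j).volume_recut (h.old j) hL hC (fun t ht => hA.mem t (h.sub ht))
      (h.left j).symm (h.right j).symm

/-- Minimality of the area forces the first-order change of area of a variation to be
nonnegative. -/
theorem area_le (hM : IsAreaMin K c) :
    ∑ j, ∫ t in s₀..s₁, _root_.wedge (σ j t) (deriv (σ j) t)
      ≤ ∑ j, ∫ t in s₀..s₁, _root_.wedge (τ j t) (deriv (τ j) t) := by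
  have hK := hM.1
  obtain ⟨c1, a1, v1⟩ := h.step hK (h.hex.arc 0)
  set K1 := recut K (τ 0) s₀ s₁ with hK1
  have a11 := a1 1 (by decide) (h.hex.arc 1)
  have a12 := a1 2 (by decide) (h.hex.arc 2)
  obtain ⟨c2, a2, v2⟩ := h.step c1 a11
  set K2 := recut K1 (τ 1) s₀ s₁ with hK2
  have a22 := a2 2 (by decide) a12
  obtain ⟨c3, -, v3⟩ := h.step c2 a22
  set K3 := recut K2 (τ 2) s₀ s₁ with hK3
  set Out : ℝ × ℝ → Prop := fun x =>
    ∀ j, x ∉ Cone (τ j s₀) (τ j s₁) ∧ -x ∉ Cone (τ j s₀) (τ j s₁) with hOut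
  have hout : ∀ x, Out x → (x ∈ K3 ↔ x ∈ K) := by
    intro x hx
    rw [hK3, (h.new 2).recut_outside (hx 2).1 (hx 2).2, hK2,
      (h.new 1).recut_outside (hx 1).1 (hx 1).2, hK1, (h.new 0).recut_outside (hx 0).1 (hx 0).2]
  have houtf : ∀ x, Out x → (x ∈ frontier K3 ↔ x ∈ frontier K) := by
    intro x hx
    rw [hK3, (h.new 2).mem_frontier_recut_of_not_mem c2 c3 (hx 2).1 (hx 2).2, hK2,
      (h.new 1).mem_frontier_recut_of_not_mem c1 c2 (hx 1).1 (hx 1).2, hK1,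
      (h.new 0).mem_frontier_recut_of_not_mem hK c1 (hx 0).1 (hx 0).2]
  have hcone : ∀ j, ∀ x ∈ Cone (τ j s₀) (τ j s₁), x ≠ 0 →
      (x ∈ K3 ↔ x ∈ Sector (τ j) s₀ s₁) := by
    intro j x hx hx0
    have o := fun k (hk : j ≠ k) => h.cone_outside hk hx hx0
    fin_cases j
    · have o1 := o 1 (by decide)
      have o2 := o 2 (by decide)
      rw [hK3, (h.new 2).recut_outside o2.1 o2.2, hK2, (h.new 1).recut_outside o1.1 o1.2, hK1]
      exact (h.new 0).recut_cone hx
    · have o2 := o 2 (by decide)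
      rw [hK3, (h.new 2).recut_outside o2.1 o2.2, hK2]
      exact (h.new 1).recut_cone hx
    · exact (h.new 2).recut_cone hx
  have hτ : ∀ j, ∀ t ∈ Set.Icc s₀ s₁, τ j t ∈ K3 := by
    intro j t ht
    have hc := (h.new j).mem_cone ht zero_le_one
    rw [one_smul] at hc
    exact (hcone j _ hc ((h.new j).ne_zero ht)).2 ⟨1, by simp, t, ht, by simp⟩
  have hsumj : ∀ j, ∀ t ∈ Set.Icc s₀ s₁, τ j t + τ (j + 1) t ∈ K3 := by
    intro j t ht
    have e : τ j t + τ (j + 1) t = -τ (j + 2) t := by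
      have := h.sum t ht
      rw [eq_neg_iff_add_eq_zero]
      fin_cases j
      · exact this
      · rw [← this]; simp; abel
      · rw [← this]; simp; abel
    rw [e]
    exact c3.neg_mem (hτ _ t ht)
  have hfr : ∀ j, ∀ x ∈ Cone (τ j s₀) (τ j s₁), x ∈ frontier K3 → ∃ t ∈ Set.Icc s₀ s₁, x = τ j t := by
    intro j x hx hxf
    have hx0 := c3.frontier_ne_zero hxf
    have hxs := c3.mem_frontier_iff_smul.1 hxf
    obtain ⟨l, hl, t, ht, he⟩ := (hcone j x hx hx0).1 hxs.1
    have hl0 : 0 < l := hl.1.lt_of_ne (by rintro rfl; simp [he] at hx0)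
    refine ⟨t, ht, ?_⟩
    rcases hl.2.eq_or_lt with h1 | h1
    · rw [he, h1, one_smul]
    · refine absurd (hτ j t ht) ?_
      have := hxs.2 l⁻¹ ((one_lt_inv₀ hl0).2 h1)
      rwa [he, smul_smul, inv_mul_cancel₀ hl0.ne', one_smul] at this
  have hfrσ : ∀ j, ∀ x ∈ Cone (τ j s₀) (τ j s₁), x ∈ frontier K → ∃ t ∈ Set.Icc s₀ s₁, x = σ j t := by
    intro j x hx hxf
    obtain ⟨l, hl, t, ht, he⟩ := h.exists_old hx
    refine ⟨t, ht, ?_⟩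
    have f1 := hK.mem_frontier_iff_smul.1 hxf
    have f2 := hK.mem_frontier_iff_smul.1 ((h.hex.arc j).mem t (h.sub ht))
    have hx0 := hK.frontier_ne_zero hxf
    have hl0 : 0 < l := hl.lt_of_ne (by rintro rfl; simp [he] at hx0)
    rcases lt_trichotomy l 1 with h1 | h1 | h1
    · refine absurd f2.1 ?_
      have := f1.2 l⁻¹ ((one_lt_inv₀ hl0).2 h1)
      rwa [he, smul_smul, inv_mul_cancel₀ hl0.ne', one_smul] at this
    · rw [he, h1, one_smul]
    · exact absurd f1.1 (by rw [he]; exact f2.2 l h1)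
  have hσc : ∀ j, ∀ t ∈ Set.Icc s₀ s₁, σ j t ∈ Cone (τ j s₀) (τ j s₁) := by
    intro j t ht
    have hc := (h.old j).mem_cone ht zero_le_one
    rwa [one_smul, ← h.left, ← h.right] at hc
  have huniq : ∀ x ∈ frontier K, ∀ y, IsCompanion K x y → c ≤ |_root_.wedge x y| → Out y → Out x := by
    have half : ∀ x ∈ frontier K, ∀ y, IsCompanion K x y → c ≤ |_root_.wedge x y| → Out y →
        ∀ j, x ∉ Cone (τ j s₀) (τ j s₁) := by
      intro x hx y hy hc hOy j hxc
      obtain ⟨t, ht, rfl⟩ := hfrσ j x hxc hx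
      obtain ⟨k, hk | hk⟩ := h.hex.uniq j t (h.sub ht) y hy hc
      · exact (hOy k).1 (hk ▸ hσc k t ht)
      · exact (hOy k).2 (by rw [hk, neg_neg]; exact hσc k t ht)
    intro x hx y hy hc hOy j
    refine ⟨half x hx y hy hc hOy j, half (-x) (hK.neg_mem_frontier hx) (-y) ?_ ?_ ?_ j⟩
    · exact ⟨hK.neg_mem hy.1, by rw [← neg_add]; exact hK.neg_mem hy.2⟩
    · rwa [wedge_neg_left, wedge_neg_right, neg_neg]
    · exact fun k => ⟨(hOy k).2, by rw [neg_neg]; exact (hOy k).1⟩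
  have hadm : Adm K3 c := by
    intro x hx
    by_cases hO : Out x
    · have hxK := (houtf x hO).1 hx
      obtain ⟨w, hw⟩ := hK.exists_isMaxCompanion (hK.mem_frontier_iff.1 hxK).1
      obtain ⟨w', hw', hcw'⟩ := hM.2.2.1 x hxK
      have hcw : c ≤ _root_.wedge x w := hcw'.trans (hw.2 w' hw')
      have av := hK.lattice_avoid hxK hw
      have hwf : w ∈ frontier K := hK.mem_frontier_iff.2 ⟨hw.1.1, by simpa using av 0 1 (by simp)⟩
      have hxwf : x + w ∈ frontier K :=
        hK.mem_frontier_iff.2 ⟨hw.1.2, by simpa using av 1 1 (by simp)⟩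
      have hxm := (hK.mem_frontier_iff.1 hxK).1
      have o1 : Out w := huniq w hwf x ⟨hxm, by rw [add_comm]; exact hw.1.2⟩ (by
        rw [wedge_swap, abs_neg]; exact hcw.trans (le_abs_self _)) hO
      have o2 : Out (x + w) := huniq _ hxwf (-x) ⟨hK.neg_mem hxm, by simpa using hw.1.1⟩ (by
        rw [wedge_neg_right, wedge_add_left, wedge_self, zero_add, wedge_swap w x, neg_neg]
        exact hcw.trans (le_abs_self _))
        (fun k => ⟨(hO k).2, by rw [neg_neg]; exact (hO k).1⟩)
      exact ⟨w, ⟨(hout w o1).2 hw.1.1, (hout _ o2).2 hw.1.2⟩, hcw⟩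
    · have : ∃ j, x ∈ Cone (τ j s₀) (τ j s₁) ∨ -x ∈ Cone (τ j s₀) (τ j s₁) := by
        by_contra! hcon
        exact hO hcon
      obtain ⟨j, hj | hj⟩ := this
      · obtain ⟨t, ht, rfl⟩ := hfr j x hj hx
        exact ⟨τ (j + 1) t, ⟨hτ _ t ht, hsumj j t ht⟩, (h.wedge j t ht).ge⟩
      · obtain ⟨t, ht, he⟩ := hfr j _ hj (c3.neg_mem_frontier hx)
        obtain rfl : x = -τ j t := by rw [← he, neg_neg]
        refine ⟨-τ (j + 1) t, ⟨c3.neg_mem (hτ _ t ht), ?_⟩, ?_⟩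
        · rw [← neg_add]; exact c3.neg_mem (hsumj j t ht)
        · rw [wedge_neg_left, wedge_neg_right, neg_neg]; exact (h.wedge j t ht).ge
  have := hM.2.2.2 K3 c3 hadm
  rw [Fin.sum_univ_three, Fin.sum_univ_three]
  linarith

end HexVariation

section turn

variable {x x' : ℝ → ℝ × ℝ} {s₀ s₁ : ℝ} {k : ℝ × ℝ}

lemma hasDerivAt_wedge_div {s t : ℝ} (hx : HasDerivAt x (x' t) t) (hk : 0 < wedge k (x t)) :
    HasDerivAt (fun t => wedge (x s) (x t) / wedge k (x t))
      (wedge k (x s) * wedge (x t) (x' t) / wedge k (x t) ^ 2) t := by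
  refine ((hx.const_wedge (x s)).div (hx.const_wedge k) hk.ne').congr_deriv ?_
  congr 1
  simp only [wedge]; ring

/-- A direction moving in a half plane with nonnegative angular velocity turns to the left. -/
lemma wedge_nonneg_of_turn (hx : ∀ t ∈ Set.Icc s₀ s₁, HasDerivAt x (x' t) t)
    (hk : ∀ t ∈ Set.Icc s₀ s₁, 0 < wedge k (x t))
    (hturn : ∀ t ∈ Set.Icc s₀ s₁, 0 ≤ wedge (x t) (x' t)) {s t : ℝ} (hs : s ∈ Set.Icc s₀ s₁)
    (ht : t ∈ Set.Icc s₀ s₁) (hst : s ≤ t) : 0 ≤ wedge (x s) (x t) := by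
  have hd := fun t ht => hasDerivAt_wedge_div (s := s) (hx t ht) (hk t ht)
  have hm : MonotoneOn (fun t => wedge (x s) (x t) / wedge k (x t)) (Set.Icc s₀ s₁) := by
    refine monotoneOn_of_deriv_nonneg (convex_Icc _ _)
      (fun t ht => (hd t ht).continuousAt.continuousWithinAt)
      (fun t ht => (hd t (interior_subset ht)).differentiableAt.differentiableWithinAt) ?_
    intro t ht
    have ht := interior_subset ht
    rw [(hd t ht).deriv]
    exact div_nonneg (mul_nonneg (hk s hs).le (hturn t ht)) (sq_nonneg _)
  have := hm hs ht hst
  simp only [wedge_self, zero_div] at this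
  by_contra! hneg
  exact absurd (div_neg_of_neg_of_pos hneg (hk t ht)) (not_lt.2 this)

/-- A direction without angular velocity is constant. -/
lemma wedge_eq_zero_of_turn (hx : ∀ t ∈ Set.Ioo s₀ s₁, HasDerivAt x (x' t) t)
    (hk : ∀ t ∈ Set.Ioo s₀ s₁, 0 < wedge k (x t))
    (hturn : ∀ t ∈ Set.Ioo s₀ s₁, wedge (x t) (x' t) = 0) {s t : ℝ} (hs : s ∈ Set.Ioo s₀ s₁)
    (ht : t ∈ Set.Ioo s₀ s₁) : wedge (x s) (x t) = 0 := by
  have hd := fun t ht => hasDerivAt_wedge_div (s := s) (hx t ht) (hk t ht)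
  have := isOpen_Ioo.is_const_of_deriv_eq_zero (f := fun t => wedge (x s) (x t) / wedge k (x t))
    isPreconnected_Ioo (fun t ht => (hd t ht).differentiableAt.differentiableWithinAt)
    (fun t ht => by
      rw [(hd t ht).deriv, hturn t ht]; simp) hs ht
  simp only [wedge_self, zero_div] at this
  exact (div_eq_zero_iff.1 this.symm).resolve_right (hk t ht).ne'

end turn

/-- A shear in direction `e`. -/
def shear (a : ℝ) (e x : ℝ × ℝ) : ℝ × ℝ := x + (a * wedge e x) • e

lemma shear_zero (e x : ℝ × ℝ) : shear 0 e x = x := by simp [shear]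

lemma shear_add (a : ℝ) (e x y : ℝ × ℝ) : shear a e (x + y) = shear a e x + shear a e y := by
  simp only [shear, wedge_add_right]; module

lemma wedge_shear (a : ℝ) (e x y : ℝ × ℝ) : wedge (shear a e x) (shear a e y) = wedge x y := by
  simp only [shear, wedge, Prod.fst_add, Prod.snd_add, Prod.smul_fst, Prod.smul_snd, smul_eq_mul]
  ring

lemma wedge_shear_add (a a' : ℝ) (e x y : ℝ × ℝ) :
    wedge (shear a e x) (shear a e y + (a' * wedge e x) • e) = wedge x y - a' * wedge e x ^ 2 := by
  simp only [shear, wedge, Prod.fst_add, Prod.snd_add, Prod.smul_fst, Prod.smul_snd, smul_eq_mul]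
  ring

lemma HasDerivAt.shear {a : ℝ → ℝ} {a' : ℝ} {σ : ℝ → ℝ × ℝ} {σ' : ℝ × ℝ} {t : ℝ}
    (ha : HasDerivAt a a' t) (hσ : HasDerivAt σ σ' t) (e : ℝ × ℝ) :
    HasDerivAt (fun t => shear (a t) e (σ t)) (_root_.shear (a t) e σ' + (a' * _root_.wedge e (σ t)) • e) t := by
  have h1 := hσ.add ((ha.mul (hσ.const_wedge e)).smul_const e)
  refine h1.congr_deriv ?_
  simp only [_root_.shear]
  module

section perturb

variable {σ X Z : ℝ → ℝ × ℝ} {a b s₀ s₁ : ℝ}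

lemma continuousOn_comb {X Y Z : ℝ → ℝ × ℝ} {a b : ℝ} (hX : ContinuousOn X (Set.Ioo a b))
    (hY : ContinuousOn Y (Set.Ioo a b)) (hZ : ContinuousOn Z (Set.Ioo a b)) :
    ContinuousOn (fun p : ℝ × ℝ => X p.2 + p.1 • Y p.2 + p.1 ^ 2 • Z p.2)
      (Set.univ ×ˢ Set.Ioo a b) := by
  have h1 : Set.MapsTo (fun p : ℝ × ℝ => p.2) (Set.univ ×ˢ Set.Ioo a b) (Set.Ioo a b) :=
    fun p hp => hp.2
  exact ((hX.comp continuousOn_snd h1).add (continuousOn_fst.smul (hY.comp continuousOn_snd h1))).add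
    ((continuousOn_fst.pow 2).smul (hZ.comp continuousOn_snd h1))

lemma eventually_forall_pos {Y : Type*} [TopologicalSpace Y] {F : ℝ × Y → ℝ} {U S : Set Y}
    (hU : IsOpen U) (hS : IsCompact S) (hSU : S ⊆ U) (hF : ContinuousOn F (Set.univ ×ˢ U))
    (hpos : ∀ y ∈ S, 0 < F (0, y)) : ∀ᶠ ε in nhds (0 : ℝ), ∀ y ∈ S, 0 < F (ε, y) := by
  refine hS.eventually_forall_of_forall_eventually fun y hy => ?_
  have hm : ((0 : ℝ), y) ∈ (Set.univ : Set ℝ) ×ˢ U := ⟨trivial, hSU hy⟩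
  have := hF.continuousAt ((isOpen_univ.prod hU).mem_nhds hm)
  exact this.eventually_const_lt (hpos y hy)

lemma contDiffOn_comb (hσ : ContDiffOn ℝ 2 σ (Set.Ioo a b)) (hX : ContDiffOn ℝ 2 X (Set.Ioo a b))
    (hZ : ContDiffOn ℝ 2 Z (Set.Ioo a b)) (ε : ℝ) :
    ContDiffOn ℝ 2 (fun t => σ t + ε • X t + ε ^ 2 • Z t) (Set.Ioo a b) :=
  (hσ.add (hX.const_smul ε)).add (hZ.const_smul (ε ^ 2))

lemma deriv_comb (hσ : ContDiffOn ℝ 2 σ (Set.Ioo a b)) (hX : ContDiffOn ℝ 2 X (Set.Ioo a b))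
    (hZ : ContDiffOn ℝ 2 Z (Set.Ioo a b)) (ε : ℝ) {t : ℝ} (ht : t ∈ Set.Ioo a b) :
    deriv (fun t => σ t + ε • X t + ε ^ 2 • Z t) t = deriv σ t + ε • deriv X t + ε ^ 2 • deriv Z t :=
  (((hσ.hasDerivAt_Ioo ht).add ((hX.hasDerivAt_Ioo ht).const_smul ε)).add
    ((hZ.hasDerivAt_Ioo ht).const_smul (ε ^ 2))).deriv

lemma eventually_turning (hσ : ContDiffOn ℝ 2 σ (Set.Ioo a b)) (hX : ContDiffOn ℝ 2 X (Set.Ioo a b))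
    (hZ : ContDiffOn ℝ 2 Z (Set.Ioo a b)) (hlt : s₀ < s₁) (hsub : Set.Icc s₀ s₁ ⊆ Set.Ioo a b)
    (hpos : ∀ s ∈ Set.Icc s₀ s₁, ∀ t ∈ Set.Icc s₀ s₁, 0 < wedge (σ s) (deriv σ t)) :
    ∀ᶠ ε in nhds (0 : ℝ), Turning (fun t => σ t + ε • X t + ε ^ 2 • Z t) s₀ s₁ := by
  have hF : ContinuousOn (fun p : ℝ × (ℝ × ℝ) =>
      wedge (σ p.2.1 + p.1 • X p.2.1 + p.1 ^ 2 • Z p.2.1)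
        (deriv σ p.2.2 + p.1 • deriv X p.2.2 + p.1 ^ 2 • deriv Z p.2.2))
      (Set.univ ×ˢ (Set.Ioo a b ×ˢ Set.Ioo a b)) := by
    refine ContinuousOn.wedge ?_ ?_
    · exact (continuousOn_comb hσ.continuousOn hX.continuousOn hZ.continuousOn).comp
        (f := fun p : ℝ × (ℝ × ℝ) => (p.1, p.2.1)) (by fun_prop) fun p hp => ⟨trivial, hp.2.1⟩
    · exact (continuousOn_comb hσ.contDiffOn_deriv_Ioo.continuousOn
        hX.contDiffOn_deriv_Ioo.continuousOn hZ.contDiffOn_deriv_Ioo.continuousOn).comp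
        (f := fun p : ℝ × (ℝ × ℝ) => (p.1, p.2.2)) (by fun_prop) fun p hp => ⟨trivial, hp.2.2⟩
  have := eventually_forall_pos (isOpen_Ioo.prod isOpen_Ioo) (isCompact_Icc.prod isCompact_Icc)
    (Set.prod_mono hsub hsub) hF (fun y hy => by simpa using hpos y.1 hy.1 y.2 hy.2)
  filter_upwards [this] with ε hε
  have hC := contDiffOn_comb hσ hX hZ ε
  refine ⟨hlt, fun t ht => hC.hasDerivAt_Ioo (hsub ht),
    hC.contDiffOn_deriv_Ioo.continuousOn.mono hsub, fun s hs t ht => ?_⟩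
  rw [deriv_comb hσ hX hZ ε (hsub ht)]
  exact hε (s, t) ⟨hs, ht⟩

lemma Turning.leftTurning {τ : ℝ → ℝ × ℝ} (h : Turning τ s₀ s₁)
    (hd : ∀ t ∈ Set.Icc s₀ s₁, HasDerivAt (_root_.deriv τ) (_root_.deriv (_root_.deriv τ) t) t)
    (hturn : ∀ t ∈ Set.Icc s₀ s₁, 0 ≤ wedge (_root_.deriv τ t) (_root_.deriv (_root_.deriv τ) t)) :
    LeftTurning τ s₀ s₁ :=
  ⟨h, fun _ hs _ ht hst => wedge_nonneg_of_turn hd (fun t ht => h.pos s₀ h.left_mem t ht) hturn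
    hs ht hst⟩

lemma eventually_leftTurning (hσ : ContDiffOn ℝ 2 σ (Set.Ioo a b))
    (hX : ContDiffOn ℝ 2 X (Set.Ioo a b))
    (hZ : ContDiffOn ℝ 2 Z (Set.Ioo a b)) (hlt : s₀ < s₁) (hsub : Set.Icc s₀ s₁ ⊆ Set.Ioo a b)
    (hpos : ∀ s ∈ Set.Icc s₀ s₁, ∀ t ∈ Set.Icc s₀ s₁, 0 < wedge (σ s) (deriv σ t))
    (hcurv : ∀ t ∈ Set.Icc s₀ s₁, 0 < wedge (deriv σ t) (deriv (deriv σ) t)) :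
    ∀ᶠ ε in nhds (0 : ℝ), LeftTurning (fun t => σ t + ε • X t + ε ^ 2 • Z t) s₀ s₁ := by
  have hF : ContinuousOn (fun p : ℝ × ℝ =>
      wedge (deriv σ p.2 + p.1 • deriv X p.2 + p.1 ^ 2 • deriv Z p.2)
        (deriv (deriv σ) p.2 + p.1 • deriv (deriv X) p.2 + p.1 ^ 2 • deriv (deriv Z) p.2))
      (Set.univ ×ˢ Set.Ioo a b) :=
    (continuousOn_comb hσ.contDiffOn_deriv_Ioo.continuousOn
        hX.contDiffOn_deriv_Ioo.continuousOn hZ.contDiffOn_deriv_Ioo.continuousOn).wedge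
      (continuousOn_comb hσ.continuousOn_deriv_deriv_Ioo hX.continuousOn_deriv_deriv_Ioo
        hZ.continuousOn_deriv_deriv_Ioo)
  have := eventually_forall_pos isOpen_Ioo isCompact_Icc hsub hF
    (fun y hy => by simpa using hcurv y hy)
  filter_upwards [this, eventually_turning hσ hX hZ hlt hsub hpos] with ε hε hT
  have hC := contDiffOn_comb hσ hX hZ ε
  refine hT.leftTurning (fun t ht => hC.hasDerivAt_deriv_Ioo (hsub ht)) fun t ht => ?_
  have h2 : deriv (deriv fun t => σ t + ε • X t + ε ^ 2 • Z t) t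
      = deriv (deriv σ) t + ε • deriv (deriv X) t + ε ^ 2 • deriv (deriv Z) t := by
    have hd := ((hσ.hasDerivAt_deriv_Ioo (hsub ht)).add
      ((hX.hasDerivAt_deriv_Ioo (hsub ht)).const_smul ε)).add
      ((hZ.hasDerivAt_deriv_Ioo (hsub ht)).const_smul (ε ^ 2))
    refine (hd.congr_of_eventuallyEq ?_).deriv
    filter_upwards [isOpen_Ioo.mem_nhds (hsub ht)] with s hs
    exact deriv_comb hσ hX hZ ε hs
  rw [h2, deriv_comb hσ hX hZ ε (hsub ht)]
  exact (hε t ht).le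

end perturb

lemma ContDiffOn.wedge_vec {n : WithTop ℕ∞} {σ : ℝ → ℝ × ℝ} {s : Set ℝ} (h : ContDiffOn ℝ n σ s)
    (e : ℝ × ℝ) : ContDiffOn ℝ n (fun t => _root_.wedge e (σ t)) s :=
  (contDiffOn_const.mul h.snd).sub (contDiffOn_const.mul h.fst)

lemma wedge_eq_zero_of_parallel {e x y : ℝ × ℝ} (he : e ≠ 0) (hx : wedge e x = 0)
    (hy : wedge e y = 0) : wedge x y = 0 := by
  obtain ⟨l, rfl⟩ := eq_smul_of_wedge_eq_zero he hx
  rw [wedge_smul_left, hy, mul_zero]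

/-- A hexagon of arcs that are short enough to be varied. -/
structure ShortHex (K : Set (ℝ × ℝ)) (c : ℝ) (σ : Fin 3 → ℝ → ℝ × ℝ) (a b : ℝ) : Prop where
  hex : HexArc K c σ a b
  cross : ∀ j, ∀ s ∈ Set.Ioo a b, ∀ t ∈ Set.Ioo a b, 0 < wedge (σ j s) (σ (j + 1) t)
  turn : ∀ j, ∀ s ∈ Set.Ioo a b, ∀ t ∈ Set.Ioo a b, 0 < wedge (σ j s) (deriv (σ j) t)

lemma HexArc.exists_shortHex {K : Set (ℝ × ℝ)} {c : ℝ} {σ : Fin 3 → ℝ → ℝ × ℝ} {a b t : ℝ}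
    (h : HexArc K c σ a b) (hc : 0 < c) (ht : t ∈ Set.Ioo a b) :
    ∃ a' b', a' < t ∧ t < b' ∧ Set.Ioo a' b' ⊆ Set.Ioo a b ∧ ShortHex K c σ a' b' := by
  have key : ∀ f g : ℝ → ℝ × ℝ, ContinuousAt f t → ContinuousAt g t →
      0 < _root_.wedge (f t) (g t) →
      ∀ᶠ U in (nhds t).smallSets, ∀ s ∈ U, ∀ t ∈ U, 0 < _root_.wedge (f s) (g t) := by
    intro f g hf hg hp
    have h1 : ContinuousAt (fun p : ℝ × ℝ => _root_.wedge (f p.1) (g p.2)) (t, t) :=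
      ContinuousAt.wedge (hf.comp (f := fun p : ℝ × ℝ => p.1) (x := (t, t)) continuousAt_fst)
        (hg.comp (f := fun p : ℝ × ℝ => p.2) (x := (t, t)) continuousAt_snd)
    have h2 := h1.eventually_const_lt hp
    rw [nhds_prod_eq] at h2
    obtain ⟨U, hU, h2⟩ := Filter.eventually_prod_self_iff'.1 h2
    exact Filter.eventually_smallSets.2 ⟨U, hU, fun V hV s hs t ht => h2 s (hV hs) t (hV ht)⟩
  have hcont : ∀ j, ContinuousAt (σ j) t := fun j => ((h.arc j).smooth.hasDerivAt_Ioo ht).continuousAt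
  have hcont' : ∀ j, ContinuousAt (deriv (σ j)) t := fun j =>
    ((h.arc j).smooth.hasDerivAt_deriv_Ioo ht).continuousAt
  have h1 := Filter.eventually_all.2 fun j =>
    key (σ j) (σ (j + 1)) (hcont j) (hcont _) (by rw [h.wedge j t ht]; exact hc)
  have h2 := Filter.eventually_all.2 fun j =>
    key (σ j) (deriv (σ j)) (hcont j) (hcont' j) ((h.arc j).pos t ht)
  obtain ⟨U, hU, hUV⟩ := Filter.eventually_smallSets.1 (h1.and h2)
  obtain ⟨a', b', ha, hb, hs, hm⟩ := exists_Ioo_of_eventually ht (P := fun s => s ∈ U) hU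
  have := hUV (Set.Ioo a' b') hm
  exact ⟨a', b', ha, hb, hs, h.mono hs, this.1, this.2⟩

/-- Sheared hexagons are admissible variations, so they cannot reduce the area. -/
theorem ShortHex.area_shear_le {K : Set (ℝ × ℝ)} {c : ℝ} {σ : Fin 3 → ℝ → ℝ × ℝ} {a b s₀ s₁ : ℝ}
    (h : ShortHex K c σ a b) (hM : IsAreaMin K c) (hlt : s₀ < s₁)
    (hsub : Set.Icc s₀ s₁ ⊆ Set.Ioo a b) {α β : ℝ → ℝ} (hα : ContDiff ℝ 2 α)
    (hβ : ContDiff ℝ 2 β) (hα₀ : α s₀ = 0) (hα₁ : α s₁ = 0) (hα₀' : deriv α s₀ = 0)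
    (hα₁' : deriv α s₁ = 0) (hβ₀ : β s₀ = 0) (hβ₁ : β s₁ = 0) (hβ₀' : deriv β s₀ = 0)
    (hβ₁' : deriv β s₁ = 0) (e w : ℝ × ℝ)
    (hcase : ∀ j, (∀ t ∈ Set.Icc s₀ s₁, 0 < wedge (deriv (σ j) t) (deriv (deriv (σ j)) t)) ∨
      (w = 0 ∧ e ≠ 0 ∧ ∀ t ∈ Set.Icc s₀ s₁, wedge e (deriv (σ j) t) = 0)) :
    ∀ᶠ ε in nhds (0 : ℝ), ∫ t in s₀..s₁, ∑ j,
      (ε * deriv α t * wedge e (shear (ε * β t) w (σ j t)) ^ 2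
        + ε * deriv β t * wedge w (σ j t) ^ 2) ≤ 0 := by
  have hσ := fun j => (h.hex.arc j).smooth
  set X : Fin 3 → ℝ → ℝ × ℝ := fun j t =>
    (β t * wedge w (σ j t)) • w + (α t * wedge e (σ j t)) • e with hX
  set Z : Fin 3 → ℝ → ℝ × ℝ := fun j t => (α t * (β t * (wedge e w * wedge w (σ j t)))) • e with hZ
  have hXs : ∀ j, ContDiffOn ℝ 2 (X j) (Set.Ioo a b) := fun j =>
    ((hβ.contDiffOn.mul ((hσ j).wedge_vec w)).smul contDiffOn_const).add
      ((hα.contDiffOn.mul ((hσ j).wedge_vec e)).smul contDiffOn_const)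
  have hZs : ∀ j, ContDiffOn ℝ 2 (Z j) (Set.Ioo a b) := fun j =>
    (hα.contDiffOn.mul (hβ.contDiffOn.mul
      (contDiffOn_const.mul ((hσ j).wedge_vec w)))).smul contDiffOn_const
  have hform : ∀ (ε : ℝ) (j : Fin 3), (fun t => σ j t + ε • X j t + ε ^ 2 • Z j t)
      = fun t => shear (ε * α t) e (shear (ε * β t) w (σ j t)) := by
    intro ε j
    funext t
    simp only [hX, hZ, shear, wedge_add_right, wedge_smul_right]
    module
  have hα' : ∀ t, HasDerivAt α (deriv α t) t := fun t =>
    (hα.differentiable (by norm_num) t).hasDerivAt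
  have hβ' : ∀ t, HasDerivAt β (deriv β t) t := fun t =>
    (hβ.differentiable (by norm_num) t).hasDerivAt
  have hturn : ∀ j, ∀ s ∈ Set.Icc s₀ s₁, ∀ t ∈ Set.Icc s₀ s₁,
      0 < wedge (σ j s) (deriv (σ j) t) := fun j s hs t ht => h.turn j s (hsub hs) t (hsub ht)
  have hnew : ∀ᶠ ε in nhds (0 : ℝ), ∀ j,
      LeftTurning (fun t => shear (ε * α t) e (shear (ε * β t) w (σ j t))) s₀ s₁ := by
    refine Filter.eventually_all.2 fun j => ?_
    rcases hcase j with hj | ⟨rfl, he, hj⟩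
    · filter_upwards [eventually_leftTurning (hσ j) (hXs j) (hZs j) hlt hsub (hturn j) hj]
        with ε hε
      rwa [hform] at hε
    · filter_upwards [eventually_turning (hσ j) (hXs j) (hZs j) hlt hsub (hturn j)] with ε hε
      rw [hform] at hε
      have hz : ∀ t ∈ Set.Icc s₀ s₁, wedge e
          (deriv (fun t => shear (ε * α t) e (shear (ε * β t) 0 (σ j t))) t) = 0 := by
        intro t ht
        have hd := (((hβ' t).const_mul ε).shear ((hσ j).hasDerivAt_Ioo (hsub ht)) 0)
        have hd2 := ((hα' t).const_mul ε).shear hd e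
        rw [hd2.deriv]
        simp [shear, wedge_add_right, wedge_smul_right, wedge_self, wedge_zero_left, hj t ht]
      refine ⟨hε, fun s hs t ht _ => ?_⟩
      rw [wedge_eq_zero_of_parallel he (hz s hs) (hz t ht)]
  filter_upwards [hnew] with ε hε
  set τ : Fin 3 → ℝ → ℝ × ℝ := fun j t => shear (ε * α t) e (shear (ε * β t) w (σ j t)) with hτ
  have hτ' : ∀ j, ∀ t ∈ Set.Icc s₀ s₁, deriv (τ j) t
      = shear (ε * α t) e (shear (ε * β t) w (deriv (σ j) t)
          + (ε * deriv β t * wedge w (σ j t)) • w)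
        + (ε * deriv α t * wedge e (shear (ε * β t) w (σ j t))) • e := by
    intro j t ht
    have hd := (((hβ' t).const_mul ε).shear ((hσ j).hasDerivAt_Ioo (hsub ht)) w)
    exact (((hα' t).const_mul ε).shear hd e).deriv
  have m0 : s₀ ∈ Set.Icc s₀ s₁ := ⟨le_rfl, hlt.le⟩
  have m1 : s₁ ∈ Set.Icc s₀ s₁ := ⟨hlt.le, le_rfl⟩
  have hV : HexVariation K c σ τ a b s₀ s₁ := by
    refine ⟨h.hex, h.cross, hsub, fun j => ⟨hlt, fun t ht => (hσ j).hasDerivAt_Ioo (hsub ht),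
      (hσ j).contDiffOn_deriv_Ioo.continuousOn.mono hsub, hturn j⟩, hε, fun j => ?_, fun j => ?_,
      fun j => ?_, fun j => ?_, fun t ht => ?_, fun j t ht => ?_⟩
    · simp [hτ, hα₀, hβ₀, shear_zero]
    · simp [hτ, hα₁, hβ₁, shear_zero]
    · rw [hτ' j _ m0]; simp [hα₀, hβ₀, hα₀', hβ₀', shear_zero]
    · rw [hτ' j _ m1]; simp [hα₁, hβ₁, hα₁', hβ₁', shear_zero]
    · simp only [hτ]
      rw [← shear_add, ← shear_add, ← shear_add, ← shear_add, h.hex.sum t (hsub ht)]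
      simp [shear, wedge_zero_right]
    · simp only [hτ]
      rw [wedge_shear, wedge_shear, h.hex.wedge j t (hsub ht)]
  have harea := hV.area_le hM
  have hg : ∀ j, ∀ t ∈ Set.uIcc s₀ s₁,
      wedge (σ j t) (deriv (σ j) t) - wedge (τ j t) (deriv (τ j) t)
      = ε * deriv α t * wedge e (shear (ε * β t) w (σ j t)) ^ 2
        + ε * deriv β t * wedge w (σ j t) ^ 2 := by
    intro j t ht
    rw [Set.uIcc_of_le hlt.le] at ht
    rw [hτ' j t ht]
    simp only [hτ]
    rw [wedge_shear_add, wedge_shear_add]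
    ring
  have hi : ∀ {ρ : ℝ → ℝ × ℝ}, Turning ρ s₀ s₁ →
      IntervalIntegrable (fun t => wedge (ρ t) (deriv ρ t)) volume s₀ s₁ := by
    intro ρ hρ
    refine ContinuousOn.intervalIntegrable ?_
    rw [Set.uIcc_of_le hlt.le]
    exact ContinuousOn.wedge (fun t ht => (hρ.deriv t ht).continuousAt.continuousWithinAt) hρ.cont
  have hd : ∀ j, IntervalIntegrable (fun t => wedge (σ j t) (deriv (σ j) t)
      - wedge (τ j t) (deriv (τ j) t)) volume s₀ s₁ := fun j =>
    (hi (hV.old j)).sub (hi (hV.new j).toTurning)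
  calc _ = ∫ t in s₀..s₁, ∑ j, (wedge (σ j t) (deriv (σ j) t)
        - wedge (τ j t) (deriv (τ j) t)) :=
        intervalIntegral.integral_congr fun t ht =>
          Finset.sum_congr rfl fun j _ => (hg j t ht).symm
    _ = ∑ j, ((∫ t in s₀..s₁, wedge (σ j t) (deriv (σ j) t))
        - ∫ t in s₀..s₁, wedge (τ j t) (deriv (τ j) t)) := by
        rw [intervalIntegral.integral_finsetSum fun j _ => hd j]
        exact Finset.sum_congr rfl fun j _ =>
          intervalIntegral.integral_sub (hi (hV.old j)) (hi (hV.new j).toTurning)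
    _ ≤ 0 := by rw [Finset.sum_sub_distrib]; linarith

/-- A polynomial vanishing to third order at the ends of an interval. -/
def bump (s₀ s₁ t : ℝ) : ℝ := ((t - s₀) * (s₁ - t)) ^ 3

lemma contDiff_bump (s₀ s₁ : ℝ) {n : WithTop ℕ∞} : ContDiff ℝ n (bump s₀ s₁) :=
  ((contDiff_id.sub contDiff_const).mul (contDiff_const.sub contDiff_id)).pow 3

lemma deriv_bump (s₀ s₁ : ℝ) :
    deriv (bump s₀ s₁) = fun t => 3 * ((t - s₀) * (s₁ - t)) ^ 2 * (s₀ + s₁ - 2 * t) := by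
  funext t
  have h := ((((hasDerivAt_id t).sub_const s₀).mul ((hasDerivAt_id t).const_sub s₁)).pow 3).deriv
  refine h.trans ?_
  simp only [Pi.mul_apply, id]
  push_cast
  ring

lemma deriv_deriv_bump (s₀ s₁ : ℝ) :
    deriv (deriv (bump s₀ s₁)) = fun t => 6 * ((t - s₀) * (s₁ - t)) * (s₀ + s₁ - 2 * t) ^ 2
      - 6 * ((t - s₀) * (s₁ - t)) ^ 2 := by
  funext t
  rw [deriv_bump]
  have h := ((((((hasDerivAt_id t).sub_const s₀).mul
    ((hasDerivAt_id t).const_sub s₁)).pow 2).const_mul 3).mul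
    (((hasDerivAt_id t).const_mul 2).const_sub (s₀ + s₁))).deriv
  refine h.trans ?_
  simp
  ring

lemma bump_pos {s₀ s₁ t : ℝ} (ht : t ∈ Set.Ioo s₀ s₁) : 0 < bump s₀ s₁ t :=
  pow_pos (mul_pos (sub_pos.2 ht.1) (sub_pos.2 ht.2)) 3

lemma bump_nonneg {s₀ s₁ t : ℝ} (ht : t ∈ Set.Icc s₀ s₁) : 0 ≤ bump s₀ s₁ t :=
  pow_nonneg (mul_nonneg (sub_nonneg.2 ht.1) (sub_nonneg.2 ht.2)) 3

lemma exists_Icc_of_eventually {a b t : ℝ} {P : ℝ → Prop} (ht : t ∈ Set.Ioo a b)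
    (hP : ∀ᶠ s in nhds t, P s) :
    ∃ s₀ s₁, s₀ < s₁ ∧ Set.Icc s₀ s₁ ⊆ Set.Ioo a b ∧ ∀ s ∈ Set.Icc s₀ s₁, P s := by
  obtain ⟨a', b', ha, hb, hs, h⟩ := exists_Ioo_of_eventually ht hP
  have : Set.Icc ((a' + t) / 2) ((t + b') / 2) ⊆ Set.Ioo a' b' := fun x hx =>
    ⟨by linarith [hx.1], by linarith [hx.2]⟩
  exact ⟨(a' + t) / 2, (t + b') / 2, by linarith, this.trans hs, fun s hs => h s (this hs)⟩

lemma exists_pos_of_eventually_nhds_zero {P : ℝ → Prop} (h : ∀ᶠ ε in nhds (0 : ℝ), P ε) :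
    ∃ ε, 0 < ε ∧ P ε ∧ P (-ε) := by
  have hn : Filter.Tendsto (fun ε : ℝ => -ε) (nhds 0) (nhds 0) := by
    simpa using (continuous_neg (G := ℝ)).tendsto 0
  have h1 : ∀ᶠ ε in nhdsWithin (0 : ℝ) (Set.Ioi 0), P ε ∧ P (-ε) :=
    (h.and (hn.eventually h)).filter_mono nhdsWithin_le_nhds
  obtain ⟨ε, hε, h0⟩ := (h1.and self_mem_nhdsWithin).exists
  exact ⟨ε, h0, hε⟩

lemma HexArc.sum_wedge_mul_wedge {K : Set (ℝ × ℝ)} {c : ℝ} {σ : Fin 3 → ℝ → ℝ × ℝ} {a b t : ℝ}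
    (h : HexArc K c σ a b) (ht : t ∈ Set.Ioo a b) :
    ∑ j, _root_.wedge (σ 0 t) (σ j t) * _root_.wedge (σ 1 t) (σ j t) = -c ^ 2 := by
  have h0 := h.wedge 0 t ht
  have h1 := h.wedge 1 t ht
  have h2 := h.wedge 2 t ht
  simp only [zero_add, show (1 : Fin 3) + 1 = 2 from rfl, show (2 : Fin 3) + 1 = 0 from rfl]
    at h0 h1 h2
  rw [Fin.sum_univ_three, wedge_self, wedge_self, h0, h1, wedge_swap (σ 0 t) (σ 2 t), h2]
  ring

/-- The three arcs of a hexagon cannot all be curved. -/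
theorem ShortHex.not_all_curved {K : Set (ℝ × ℝ)} {c : ℝ} {σ : Fin 3 → ℝ → ℝ × ℝ} {a b : ℝ}
    (h : ShortHex K c σ a b) (hM : IsAreaMin K c) (hab : a < b)
    (hcurv : ∀ j, ∀ t ∈ Set.Ioo a b, 0 < wedge (deriv (σ j) t) (deriv (deriv (σ j)) t)) :
    False := by
  have hc := hM.2.1
  obtain ⟨t, ht⟩ : (Set.Ioo a b).Nonempty := Set.nonempty_Ioo.2 hab
  have hcont : ∀ j, ContinuousOn (σ j) (Set.Ioo a b) := fun j =>
    (h.hex.arc j).smooth.continuousOn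
  set e := σ 0 t with he
  set w := σ 1 t with hw
  have hew : wedge e w = c := h.hex.wedge 0 t ht
  have hwc : ∀ (u : ℝ × ℝ) j, ContinuousOn (fun s => wedge u (σ j s)) (Set.Ioo a b) := fun u j =>
    continuousOn_const.wedge (hcont j)
  set S : ℝ → ℝ := fun s => ∑ j, wedge e (σ j s) * wedge w (σ j s) with hS
  have hSc : ContinuousOn S (Set.Ioo a b) :=
    continuousOn_finsetSum _ fun j _ => (hwc e j).mul (hwc w j)
  have hSt : S t < 0 := by
    have := h.hex.sum_wedge_mul_wedge ht
    simp only [hS, he, hw]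
    rw [this]
    nlinarith
  obtain ⟨s₀, s₁, hlt, hsub, hneg⟩ := exists_Icc_of_eventually ht
    ((hSc.continuousAt (isOpen_Ioo.mem_nhds ht)).eventually_lt_const hSt)
  set α := bump s₀ s₁ with hα
  have hα' : ContDiff ℝ 2 (deriv α) := by
    have : ContDiff ℝ (2 + 1) α := contDiff_bump s₀ s₁
    exact (contDiff_succ_iff_deriv.1 this).2.2
  have hβd : deriv (fun t => -deriv α t) = fun t => -deriv (deriv α) t := by
    funext t; exact deriv.fun_neg
  have hev := h.area_shear_le hM hlt hsub (α := α) (β := fun t => -deriv α t)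
    (contDiff_bump s₀ s₁) hα'.neg (by simp [hα, bump]) (by simp [hα, bump])
    (by simp [hα, deriv_bump]) (by simp [hα, deriv_bump]) (by simp [hα, deriv_bump])
    (by simp [hα, deriv_bump]) (by rw [hβd]; simp [hα, deriv_deriv_bump])
    (by rw [hβd]; simp [hα, deriv_deriv_bump]) e w
    (fun j => Or.inl fun t ht => hcurv j t (hsub ht))
  obtain ⟨ε, hε, h1, h2⟩ := exists_pos_of_eventually_nhds_zero hev
  have hα'c : Continuous (deriv α) := hα'.continuous
  have hα''c : Continuous (deriv (deriv α)) := hα'.continuous_deriv (by norm_num)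
  have hi : ∀ ε : ℝ, IntervalIntegrable (fun t => ∑ j,
      (ε * deriv α t * wedge e (shear (ε * (-deriv α t)) w (σ j t)) ^ 2
        + ε * deriv (fun t => -deriv α t) t * wedge w (σ j t) ^ 2)) volume s₀ s₁ := by
    intro ε
    refine ContinuousOn.intervalIntegrable ?_
    rw [Set.uIcc_of_le hlt.le, hβd]
    refine ContinuousOn.mono (continuousOn_finsetSum _ fun j _ => ?_) hsub
    simp only [shear, wedge_add_right, wedge_smul_right]
    have e1 := hwc e j
    have e2 := hwc w j
    fun_prop
  have hsum := intervalIntegral.integral_add (hi ε) (hi (-ε))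
  have hcongr : ∀ t ∈ Set.uIcc s₀ s₁, (∑ j,
      (ε * deriv α t * wedge e (shear (ε * (-deriv α t)) w (σ j t)) ^ 2
        + ε * deriv (fun t => -deriv α t) t * wedge w (σ j t) ^ 2)) + (∑ j,
      (-ε * deriv α t * wedge e (shear (-ε * (-deriv α t)) w (σ j t)) ^ 2
        + -ε * deriv (fun t => -deriv α t) t * wedge w (σ j t) ^ 2))
      = (2 * ε * deriv α t) ^ 2 * (c * -S t) := by
    intro t _
    simp only [hS, shear, wedge_add_right, wedge_smul_right, hew, Fin.sum_univ_three]
    ring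
  rw [intervalIntegral.integral_congr hcongr] at hsum
  have hpos : 0 < ∫ t in s₀..s₁, (2 * ε * deriv α t) ^ 2 * (c * -S t) := by
    refine intervalIntegral.integral_pos hlt ?_ (fun t ht => ?_) ⟨(3 * s₀ + s₁) / 4, ?_, ?_⟩
    · have := hSc.mono hsub
      fun_prop
    · have := hneg t ⟨ht.1.le, ht.2⟩
      exact mul_nonneg (sq_nonneg _) (mul_nonneg hc.le (by linarith))
    · constructor <;> linarith
    · have hm : (3 * s₀ + s₁) / 4 ∈ Set.Icc s₀ s₁ := by constructor <;> linarith
      have h3 := hneg _ hm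
      refine mul_pos (pow_pos (mul_pos (by linarith) ?_) 2) (mul_pos hc (by linarith))
      rw [hα, deriv_bump]
      refine mul_pos (mul_pos (by norm_num) (pow_pos (mul_pos ?_ ?_) 2)) ?_ <;> linarith
  linarith

/-- If every arc is either curved or straight in direction `e`, then the sum of the squared
distances to the line spanned by `e` is constant. -/
theorem ShortHex.sum_wedge_mul_wedge_deriv {K : Set (ℝ × ℝ)} {c : ℝ} {σ : Fin 3 → ℝ → ℝ × ℝ}
    {a b : ℝ} (h : ShortHex K c σ a b) (hM : IsAreaMin K c) {e : ℝ × ℝ} (he : e ≠ 0)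
    (hcase : ∀ j, (∀ t ∈ Set.Ioo a b, 0 < wedge (deriv (σ j) t) (deriv (deriv (σ j)) t)) ∨
      ∀ t ∈ Set.Ioo a b, wedge e (deriv (σ j) t) = 0) {t : ℝ} (ht : t ∈ Set.Ioo a b) :
    ∑ j, wedge e (σ j t) * wedge e (deriv (σ j) t) = 0 := by
  by_contra hne
  have hσ := fun j => (h.hex.arc j).smooth
  set D : ℝ → ℝ := fun s => ∑ j, wedge e (σ j s) * wedge e (deriv (σ j) s) with hD
  have hDt : D t ≠ 0 := hne
  have hDc : ContinuousOn D (Set.Ioo a b) := continuousOn_finsetSum _ fun j _ =>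
    (continuousOn_const.wedge (hσ j).continuousOn).mul
      (continuousOn_const.wedge (hσ j).contDiffOn_deriv_Ioo.continuousOn)
  obtain ⟨s₀, s₁, hlt, hsub, hpos⟩ := exists_Icc_of_eventually ht
    (((hDc.continuousAt (isOpen_Ioo.mem_nhds ht)).const_mul (D t)).eventually_const_lt
      (mul_self_pos.2 hDt))
  set α := bump s₀ s₁ with hα
  set Y : ℝ → ℝ := fun s => ∑ j, wedge e (σ j s) ^ 2 with hY
  have hev := h.area_shear_le hM hlt hsub (α := α) (β := fun _ => 0)
    (contDiff_bump s₀ s₁) contDiff_const (by simp [hα, bump]) (by simp [hα, bump])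
    (by simp [hα, deriv_bump]) (by simp [hα, deriv_bump]) rfl rfl (by simp) (by simp) e 0
    (fun j => (hcase j).imp (fun hj t ht => hj t (hsub ht))
      fun hj => ⟨rfl, he, fun t ht => hj t (hsub ht)⟩)
  obtain ⟨ε, hε, h1, h2⟩ := exists_pos_of_eventually_nhds_zero hev
  have hrw : ∀ ε : ℝ, (∫ t in s₀..s₁, ∑ j,
      (ε * deriv α t * wedge e (shear (ε * 0) 0 (σ j t)) ^ 2
        + ε * deriv (fun _ : ℝ => (0 : ℝ)) t * wedge 0 (σ j t) ^ 2))
      = ε * ∫ t in s₀..s₁, deriv α t * Y t := by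
    intro ε
    rw [← intervalIntegral.integral_const_mul]
    refine intervalIntegral.integral_congr fun t _ => ?_
    simp only [hY, mul_zero, shear_zero, deriv_const', zero_mul, add_zero, Finset.mul_sum]
    exact Finset.sum_congr rfl fun j _ => by ring
  rw [hrw] at h1 h2
  have hz : ∫ t in s₀..s₁, deriv α t * Y t = 0 := by nlinarith
  have hαd : ∀ t, HasDerivAt α (deriv α t) t := fun t =>
    ((contDiff_bump s₀ s₁ (n := 2)).differentiable (by norm_num) t).hasDerivAt
  have hYd : ∀ t ∈ Set.uIcc s₀ s₁, HasDerivAt Y (2 * D t) t := by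
    intro t ht
    rw [Set.uIcc_of_le hlt.le] at ht
    have := HasDerivAt.fun_sum (u := Finset.univ) fun j _ =>
      (((hσ j).hasDerivAt_Ioo (hsub ht)).const_wedge e).pow 2
    refine this.congr_deriv ?_
    simp only [hD, Finset.mul_sum]
    exact Finset.sum_congr rfl fun j _ => by push_cast; ring
  have hparts := intervalIntegral.integral_mul_deriv_eq_deriv_mul (fun t _ => hαd t) hYd
    ((contDiff_bump s₀ s₁ (n := 2)).continuous_deriv (by norm_num)).continuousOn.intervalIntegrable
    (ContinuousOn.intervalIntegrable (by
      rw [Set.uIcc_of_le hlt.le]; exact continuousOn_const.mul (hDc.mono hsub)))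
  rw [hz, show α s₀ = 0 by simp [hα, bump], show α s₁ = 0 by simp [hα, bump]] at hparts
  have hp : 0 < ∫ t' in s₀..s₁, D t * (α t' * (2 * D t')) := by
    refine intervalIntegral.integral_pos hlt ?_ (fun t ht => ?_) ⟨(s₀ + s₁) / 2, ?_, ?_⟩
    · have := hDc.mono hsub
      have h4 : Continuous α := (contDiff_bump s₀ s₁ (n := 2)).continuous
      fun_prop
    · have h3 := hpos t ⟨ht.1.le, ht.2⟩
      have := mul_nonneg (bump_nonneg ⟨ht.1.le, ht.2⟩) h3.le
      simp only [hα]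
      linarith
    · constructor <;> linarith
    · have hm : (s₀ + s₁) / 2 ∈ Set.Ioo s₀ s₁ := by constructor <;> linarith
      have h3 := hpos _ (Set.Ioo_subset_Icc_self hm)
      have := mul_pos (bump_pos hm) h3
      simp only [hα]
      linarith
  rw [intervalIntegral.integral_const_mul, hparts] at hp
  simp at hp

lemma HexArc.sum_deriv {K : Set (ℝ × ℝ)} {c : ℝ} {σ : Fin 3 → ℝ → ℝ × ℝ} {a b t : ℝ}
    (h : HexArc K c σ a b) (ht : t ∈ Set.Ioo a b) :
    deriv (σ 0) t + deriv (σ 1) t + deriv (σ 2) t = 0 := by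
  have hσ := fun j => (h.arc j).smooth.hasDerivAt_Ioo ht
  have h1 := ((hσ 0).add (hσ 1)).add (hσ 2)
  have h2 : HasDerivAt (fun _ : ℝ => (0 : ℝ × ℝ)) 0 t := hasDerivAt_const _ _
  refine h1.unique (h2.congr_of_eventuallyEq ?_)
  filter_upwards [isOpen_Ioo.mem_nhds ht] with s hs
  exact h.sum s hs

lemma Arc.exists_wedge_deriv_ne_zero {K : Set (ℝ × ℝ)} {σ : ℝ → ℝ × ℝ} {a b : ℝ}
    (h : Arc K σ a b) {t : ℝ} (ht : t ∈ Set.Ioo a b)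
    (hcurv : wedge (deriv σ t) (deriv (deriv σ) t) ≠ 0) {e : ℝ × ℝ} (he : e ≠ 0) :
    ∃ t ∈ Set.Ioo a b, wedge e (deriv σ t) ≠ 0 := by
  by_contra! hz
  have h1 : HasDerivAt (fun s => wedge e (deriv σ s)) (wedge e (deriv (deriv σ) t)) t :=
    (h.smooth.hasDerivAt_deriv_Ioo ht).const_wedge e
  have h2 : wedge e (deriv (deriv σ) t) = 0 := by
    refine h1.unique ((hasDerivAt_const t (0 : ℝ)).congr_of_eventuallyEq ?_)
    filter_upwards [isOpen_Ioo.mem_nhds ht] with s hs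
    exact hz s hs
  exact hcurv (wedge_eq_zero_of_parallel he (hz t ht) h2)

/-- A hexagon of arcs cannot have exactly one straight pair of arcs. -/
theorem ShortHex.not_one_flat {K : Set (ℝ × ℝ)} {c : ℝ} {σ : Fin 3 → ℝ → ℝ × ℝ} {a b : ℝ}
    (h : ShortHex K c σ a b) (hM : IsAreaMin K c) (hab : a < b) {e : ℝ × ℝ} (he : e ≠ 0)
    (i : Fin 3) (hflat : ∀ t ∈ Set.Ioo a b, wedge e (deriv (σ i) t) = 0)
    (hcurv : ∀ j, j ≠ i →
      ∀ t ∈ Set.Ioo a b, 0 < wedge (deriv (σ j) t) (deriv (deriv (σ j)) t)) : False := by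
  have hσ := fun j => (h.hex.arc j).smooth
  have hsum : ∀ f : Fin 3 → ℝ, ∑ j, f j = f i + f (i + 1) + f (i + 2) := by
    intro f
    rw [Fin.sum_univ_three]
    fin_cases i <;> simp <;> ring
  have hsum_deriv : ∀ t ∈ Set.Ioo a b,
      wedge e (deriv (σ (i + 1)) t) + wedge e (deriv (σ (i + 2)) t) = 0 := by
    intro t ht
    have h1 := hsum fun j => wedge e (deriv (σ j) t)
    rw [Fin.sum_univ_three, ← wedge_add_right, ← wedge_add_right, h.hex.sum_deriv ht,
      wedge_zero_right, hflat t ht] at h1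
    linarith
  have hprod : ∀ t ∈ Set.Ioo a b, (wedge e (σ (i + 1) t) - wedge e (σ (i + 2) t))
      * wedge e (deriv (σ (i + 1)) t) = 0 := by
    intro t ht
    have h1 := h.sum_wedge_mul_wedge_deriv hM he (fun j => by
      rcases eq_or_ne j i with rfl | hj
      exacts [Or.inr hflat, Or.inl (hcurv j hj)]) ht
    rw [hsum, hflat t ht] at h1
    have h2 := hsum_deriv t ht
    linear_combination h1 - wedge e (σ (i + 2) t) * h2
  have hk : i + 1 ≠ i := by fin_cases i <;> decide
  obtain ⟨t₁, ht₁⟩ : (Set.Ioo a b).Nonempty := Set.nonempty_Ioo.2 hab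
  obtain ⟨t, ht, hne⟩ := (h.hex.arc (i + 1)).exists_wedge_deriv_ne_zero ht₁
    (hcurv _ hk t₁ ht₁).ne' he
  have hd1 := ((hσ (i + 1)).hasDerivAt_Ioo ht).const_wedge e
  have hd2 := ((hσ (i + 2)).hasDerivAt_Ioo ht).const_wedge e
  have hev : ∀ᶠ s in nhds t, wedge e (deriv (σ (i + 1)) s) ≠ 0 :=
    (((hσ (i + 1)).hasDerivAt_deriv_Ioo ht).const_wedge e).continuousAt.eventually_ne hne
  have h0 : wedge e (deriv (σ (i + 1)) t) - wedge e (deriv (σ (i + 2)) t) = 0 := by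
    refine (hd1.sub hd2).unique ((hasDerivAt_const t (0 : ℝ)).congr_of_eventuallyEq ?_)
    filter_upwards [isOpen_Ioo.mem_nhds ht, hev] with s hs hs'
    exact (mul_eq_zero.1 (hprod s hs)).resolve_right hs'
  have := hsum_deriv t ht
  exact hne (by linarith)

lemma Arc.exists_curved_or_flat {K : Set (ℝ × ℝ)} {σ : ℝ → ℝ × ℝ} {a b : ℝ}
    (h : Arc K σ a b) (hK : IsCSCD K) (hab : a < b) :
    ∃ a' b', a' < b' ∧ Set.Ioo a' b' ⊆ Set.Ioo a b ∧
      ((∀ t ∈ Set.Ioo a' b', 0 < wedge (deriv σ t) (deriv (deriv σ) t)) ∨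
        ∀ t ∈ Set.Ioo a' b', wedge (deriv σ t) (deriv (deriv σ) t) = 0) := by
  by_cases hz : ∀ t ∈ Set.Ioo a b, wedge (deriv σ t) (deriv (deriv σ) t) = 0
  · exact ⟨a, b, hab, subset_rfl, Or.inr hz⟩
  · push Not at hz
    obtain ⟨t, ht, hne⟩ := hz
    have hpos := (h.curvature_nonneg hK ht).lt_of_ne' hne
    have hc : ContinuousOn (fun t => wedge (deriv σ t) (deriv (deriv σ) t)) (Set.Ioo a b) :=
      h.smooth.contDiffOn_deriv_Ioo.continuousOn.wedge h.smooth.continuousOn_deriv_deriv_Ioo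
    obtain ⟨a', b', ha, hb, hs, hP⟩ := exists_Ioo_of_eventually ht
      ((hc.continuousAt (isOpen_Ioo.mem_nhds ht)).eventually_const_lt hpos)
    exact ⟨a', b', ha.trans hb, hs, Or.inl hP⟩

lemma ShortHex.exists_direction {K : Set (ℝ × ℝ)} {c : ℝ} {σ : Fin 3 → ℝ → ℝ × ℝ} {a b : ℝ}
    (h : ShortHex K c σ a b) (hab : a < b) {j : Fin 3}
    (hflat : ∀ t ∈ Set.Ioo a b, wedge (deriv (σ j) t) (deriv (deriv (σ j)) t) = 0) :
    ∃ e : ℝ × ℝ, e ≠ 0 ∧ ∀ t ∈ Set.Ioo a b, wedge e (deriv (σ j) t) = 0 := by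
  obtain ⟨t, ht⟩ : (Set.Ioo a b).Nonempty := Set.nonempty_Ioo.2 hab
  refine ⟨deriv (σ j) t, fun h0 => ?_, fun s hs => ?_⟩
  · have := h.turn j t ht t ht
    rw [h0, wedge_zero_right] at this
    exact this.false
  · exact wedge_eq_zero_of_turn (fun u hu => (h.hex.arc j).smooth.hasDerivAt_deriv_Ioo hu)
      (fun u hu => h.turn j t ht u hu) hflat ht hs

lemma wedge_const_of_deriv {σ : ℝ → ℝ × ℝ} {a b : ℝ} (hσ : ContDiffOn ℝ 2 σ (Set.Ioo a b))
    {e : ℝ × ℝ} (h : ∀ t ∈ Set.Ioo a b, wedge e (deriv σ t) = 0) {s t : ℝ}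
    (hs : s ∈ Set.Ioo a b) (ht : t ∈ Set.Ioo a b) : wedge e (σ s) = wedge e (σ t) := by
  have hd := fun t ht => (hσ.hasDerivAt_Ioo ht).const_wedge e (t := t)
  exact isOpen_Ioo.is_const_of_deriv_eq_zero (f := fun t => wedge e (σ t)) isPreconnected_Ioo
    (fun t ht => (hd t ht).differentiableAt.differentiableWithinAt)
    (fun t ht => by rw [(hd t ht).deriv, h t ht]; rfl) hs ht

/-- Every curved arc in the boundary of an area minimizer contains an arc of a hyperbola. -/
theorem IsAreaMin.exists_hyperbola {K : Set (ℝ × ℝ)} {c : ℝ} (hM : IsAreaMin K c)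
    {p : ℝ → ℝ × ℝ} {a b : ℝ} (hab : a < b) (hp : Arc K p a b)
    (hcurv : ∀ t ∈ Set.Ioo a b, wedge (deriv p t) (deriv (deriv p) t) ≠ 0)
    {E : Set (ℝ × ℝ)} (hE : E.Finite)
    (hcov : ∀ z ∈ frontier K, z ∉ E → ∃ (g : ℝ → ℝ × ℝ) (u : ℝ), g u = z ∧ ContDiffAt ℝ 2 g u ∧
      deriv g u ≠ 0 ∧ ∀ᶠ s in nhds u, g s ∈ frontier K) :
    ∃ a' b', a' < b' ∧ Set.Ioo a' b' ⊆ Set.Ioo a b ∧ ∃ (e f : ℝ × ℝ) (h k m : ℝ), wedge e f ≠ 0 ∧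
      ∀ t ∈ Set.Ioo a' b', (h + wedge e (p t)) * (k + wedge f (p t)) = m := by
  obtain ⟨a₁, b₁, hab₁, hs₁, σ, hσ0, H₁⟩ := hM.exists_hexArc hab hp hcurv hE hcov
  obtain ⟨a₂, b₂, hab₂, hs₂, hc₁⟩ := (H₁.arc 1).exists_curved_or_flat hM.1 hab₁
  have H₂ := H₁.mono hs₂
  obtain ⟨a₃, b₃, hab₃, hs₃, hc₂⟩ := (H₂.arc 2).exists_curved_or_flat hM.1 hab₂
  have H₃ := H₂.mono hs₃
  obtain ⟨t, ht⟩ : (Set.Ioo a₃ b₃).Nonempty := Set.nonempty_Ioo.2 hab₃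
  obtain ⟨a', b', ha, hb, hs, H⟩ := H₃.exists_shortHex hM.2.1 ht
  have hab' := ha.trans hb
  have hsub : Set.Ioo a' b' ⊆ Set.Ioo a b := hs.trans (hs₃.trans (hs₂.trans hs₁))
  have hc₀ : ∀ t ∈ Set.Ioo a' b', 0 < wedge (deriv (σ 0) t) (deriv (deriv (σ 0)) t) :=
    fun t ht => ((H.hex.arc 0).curvature_nonneg hM.1 ht).lt_of_ne'
      (by rw [hσ0]; exact hcurv t (hsub ht))
  have hc₁ := hc₁.imp (fun h t ht => h t (hs₃ (hs ht))) (fun h t ht => h t (hs₃ (hs ht)))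
    (c := ∀ t ∈ Set.Ioo a' b', 0 < wedge (deriv (σ 1) t) (deriv (deriv (σ 1)) t))
    (d := ∀ t ∈ Set.Ioo a' b', wedge (deriv (σ 1) t) (deriv (deriv (σ 1)) t) = 0)
  have hc₂ := hc₂.imp (fun h t ht => h t (hs ht)) (fun h t ht => h t (hs ht))
    (c := ∀ t ∈ Set.Ioo a' b', 0 < wedge (deriv (σ 2) t) (deriv (deriv (σ 2)) t))
    (d := ∀ t ∈ Set.Ioo a' b', wedge (deriv (σ 2) t) (deriv (deriv (σ 2)) t) = 0)
  refine ⟨a', b', hab', hsub, ?_⟩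
  rcases hc₁ with h1 | h1
  · rcases hc₂ with h2 | h2
    · refine (H.not_all_curved hM hab' fun j => ?_).elim
      fin_cases j
      exacts [hc₀, h1, h2]
    · obtain ⟨e, he, hflat⟩ := H.exists_direction hab' h2
      refine (H.not_one_flat hM hab' he 2 hflat fun j hj => ?_).elim
      fin_cases j
      exacts [hc₀, h1, absurd rfl hj]
  · obtain ⟨e, he, hflat⟩ := H.exists_direction hab' h1
    rcases hc₂ with h2 | h2
    · refine (H.not_one_flat hM hab' he 1 hflat fun j hj => ?_).elim
      fin_cases j
      exacts [hc₀, absurd rfl hj, h2]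
    · obtain ⟨f, hf, hflat'⟩ := H.exists_direction hab' h2
      obtain ⟨t, ht⟩ : (Set.Ioo a' b').Nonempty := Set.nonempty_Ioo.2 hab'
      refine ⟨e, f, wedge e (σ 1 t), wedge f (σ 2 t),
        wedge e (σ 1 t) * wedge f (σ 2 t) - c * wedge e f, fun hef => ?_, fun s hs => ?_⟩
      · obtain ⟨s, hs, hne⟩ := (H.hex.arc 0).exists_wedge_deriv_ne_zero ht (hc₀ t ht).ne' he
        have h3 := congrArg (wedge e) (H.hex.sum_deriv hs)
        obtain ⟨l, rfl⟩ := eq_smul_of_wedge_eq_zero he hef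
        have h4 := hflat' s hs
        have hl : l ≠ 0 := by rintro rfl; simp at hf
        rw [wedge_smul_left] at h4
        rw [wedge_add_right, wedge_add_right, hflat s hs, (mul_eq_zero.1 h4).resolve_left hl,
          wedge_zero_right] at h3
        exact hne (by linarith)
      · have e1 := wedge_const_of_deriv (H.hex.arc 1).smooth hflat hs ht
        have e2 := wedge_const_of_deriv (H.hex.arc 2).smooth hflat' hs ht
        have e3 := H.hex.wedge 1 s hs
        have e4 : p s = -σ 1 s - σ 2 s := by
          rw [← hσ0]
          have := H.hex.sum s hs
          rw [add_assoc] at this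
          rw [eq_neg_of_add_eq_zero_left this]
          abel
        rw [← e1, ← e2, e4, ← e3]
        simp only [wedge, Prod.fst_sub, Prod.snd_sub, Prod.fst_neg, Prod.snd_neg,
          show (1 : Fin 3) + 1 = 2 from rfl]
        ring

lemma AnalyticAt.wedge_vec {g : ℝ → ℝ × ℝ} {t : ℝ} (h : AnalyticAt ℝ g t) (e : ℝ × ℝ) :
    AnalyticAt ℝ (fun t => _root_.wedge e (g t)) t := by
  have h1 : AnalyticAt ℝ (fun t => (g t).1) t :=
    ((ContinuousLinearMap.fst ℝ ℝ ℝ).analyticAt _).comp h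
  have h2 : AnalyticAt ℝ (fun t => (g t).2) t :=
    ((ContinuousLinearMap.snd ℝ ℝ ℝ).analyticAt _).comp h
  exact (analyticAt_const.mul h2).sub (analyticAt_const.mul h1)

lemma AnalyticOnNhd.eq_zero_of_eq_zero_Ioo {G : ℝ → ℝ} {s₀ s₁ a b : ℝ}
    (hG : AnalyticOnNhd ℝ G (Set.Icc s₀ s₁)) (hab : a < b)
    (hsub : Set.Ioo a b ⊆ Set.Icc s₀ s₁) (h0 : ∀ t ∈ Set.Ioo a b, G t = 0) :
    ∀ t ∈ Set.Icc s₀ s₁, G t = 0 := by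
  obtain ⟨t, ht⟩ : (Set.Ioo a b).Nonempty := Set.nonempty_Ioo.2 hab
  refine hG.eqOn_zero_of_preconnected_of_eventuallyEq_zero isPreconnected_Icc (hsub ht) ?_
  filter_upwards [isOpen_Ioo.mem_nhds ht] with s hs
  exact h0 s hs

/-- A curve segment contained in a line is a line segment. -/
lemma isSegment_image_of_wedge {g : ℝ → ℝ × ℝ} {s₀ s₁ : ℝ} (hs : s₀ ≤ s₁)
    (hg : ContinuousOn g (Set.Icc s₀ s₁)) {e : ℝ × ℝ} (he : e ≠ 0) {m : ℝ}
    (h : ∀ t ∈ Set.Icc s₀ s₁, wedge e (g t) = m) : IsSegment (g '' Set.Icc s₀ s₁) := by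
  have hn : e.1 ^ 2 + e.2 ^ 2 ≠ 0 := by
    intro h0
    apply he
    ext
    · simp only [Prod.fst_zero]; nlinarith [sq_nonneg e.1, sq_nonneg e.2]
    · simp only [Prod.snd_zero]; nlinarith [sq_nonneg e.1, sq_nonneg e.2]
  set φ : ℝ → ℝ := fun t =>
    (e.1 * ((g t).1 - (g s₀).1) + e.2 * ((g t).2 - (g s₀).2)) / (e.1 ^ 2 + e.2 ^ 2) with hφ
  have hφc : ContinuousOn φ (Set.Icc s₀ s₁) := by fun_prop
  have hgφ : ∀ t ∈ Set.Icc s₀ s₁, g t = AffineMap.lineMap (g s₀) (g s₀ + e) (φ t) := by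
    intro t ht
    obtain ⟨l, hl⟩ := eq_smul_of_wedge_eq_zero (x := g t - g s₀) he (by
      rw [wedge_sub_right, h t ht, h s₀ ⟨le_rfl, hs⟩, sub_self])
    have h1 : (g t).1 - (g s₀).1 = l * e.1 := congrArg Prod.fst hl
    have h2 : (g t).2 - (g s₀).2 = l * e.2 := congrArg Prod.snd hl
    have : φ t = l := by
      simp only [hφ]
      rw [h1, h2, div_eq_iff hn]
      ring
    rw [this, AffineMap.lineMap_apply, vsub_eq_sub, vadd_eq_add, add_sub_cancel_left, ← hl]
    abel
  have him : g '' Set.Icc s₀ s₁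
      = (AffineMap.lineMap (k := ℝ) (g s₀) (g s₀ + e)) '' (φ '' Set.Icc s₀ s₁) := by
    rw [Set.image_image]
    exact Set.image_congr hgφ
  have hle : sInf (φ '' Set.Icc s₀ s₁) ≤ sSup (φ '' Set.Icc s₀ s₁) :=
    Real.sInf_le_sSup _ (isCompact_Icc.image_of_continuousOn hφc).bddBelow
      (isCompact_Icc.image_of_continuousOn hφc).bddAbove
  rw [him, hφc.image_Icc hs, ← segment_eq_Icc hle, image_segment]
  exact ⟨_, _, rfl⟩

lemma isHyperbolicArc_of_product {S : Set (ℝ × ℝ)} (hS : IsConnected S) {e f : ℝ × ℝ}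
    {h k m : ℝ} (hef : wedge e f ≠ 0)
    (heq : ∀ v ∈ S, (h + wedge e v) * (k + wedge f v) = m) : IsHyperbolicArc S := by
  refine ⟨e.2 * f.2, -(e.2 * f.1 + e.1 * f.2), e.1 * f.1, -(h * f.2 + k * e.2),
    h * f.1 + k * e.1, h * k - m, ?_, hS, fun v hv => ?_⟩
  · have := pow_pos (abs_pos.2 hef) 2
    rw [sq_abs] at this
    simp only [wedge] at this
    nlinarith
  · have := heq v hv
    simp only [wedge] at this
    simp only [Set.mem_ofPred_eq]
    linear_combination this

section analytic

variable {K : Set (ℝ × ℝ)} {c : ℝ} {g : ℝ → ℝ × ℝ} {s₀ s₁ : ℝ}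

/-- An analytic curve without curvature lies on a line. -/
lemma exists_line_of_flat (hs : s₀ < s₁) (hg : AnalyticOnNhd ℝ g (Set.Icc s₀ s₁))
    (hd : ∀ t ∈ Set.Icc s₀ s₁, deriv g t ≠ 0)
    (hz : ∀ t ∈ Set.Ioo s₀ s₁, wedge (deriv g t) (deriv (deriv g) t) = 0) :
    ∃ (e : ℝ × ℝ) (m : ℝ), e ≠ 0 ∧ ∀ t ∈ Set.Icc s₀ s₁, wedge e (g t) = m := by
  obtain ⟨t, ht⟩ : (Set.Ioo s₀ s₁).Nonempty := Set.nonempty_Ioo.2 hs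
  set e := deriv g t with he
  have hne : e ≠ 0 := hd t (Set.Ioo_subset_Icc_self ht)
  have hC : ContDiffOn ℝ 2 g (Set.Ioo s₀ s₁) := fun s hs =>
    (hg s (Set.Ioo_subset_Icc_self hs)).contDiffAt.contDiffWithinAt
  have hpos : 0 < wedge (e.2, -e.1) (deriv g t) := by
    rw [← he]
    by_contra! h0
    apply hne
    simp only [wedge] at h0
    ext
    · simp only [Prod.fst_zero]; nlinarith [sq_nonneg e.1, sq_nonneg e.2]
    · simp only [Prod.snd_zero]; nlinarith [sq_nonneg e.1, sq_nonneg e.2]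
  have hcont := ((hC.hasDerivAt_deriv_Ioo ht).const_wedge (e.2, -e.1)).continuousAt
  obtain ⟨a, b, ha, hb, hab, hP⟩ := exists_Ioo_of_eventually ht (hcont.eventually_const_lt hpos)
  have hflat : ∀ s ∈ Set.Ioo a b, wedge e (deriv g s) = 0 := fun s hs =>
    wedge_eq_zero_of_turn (fun u hu => hC.hasDerivAt_deriv_Ioo (hab hu)) hP
      (fun u hu => hz u (hab hu)) ⟨ha, hb⟩ hs
  refine ⟨e, wedge e (g t), hne, fun s hs => sub_eq_zero.1 ?_⟩
  refine AnalyticOnNhd.eq_zero_of_eq_zero_Ioo (G := fun s => wedge e (g s) - wedge e (g t))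
    (fun s hs => ((hg s hs).wedge_vec e).sub analyticAt_const) (ha.trans hb)
    (hab.trans Set.Ioo_subset_Icc_self) (fun s hs => sub_eq_zero.2 ?_) s hs
  exact wedge_const_of_deriv (hC.mono hab) hflat hs ⟨ha, hb⟩

/-- A curved regular curve in the boundary contains an arc of a hyperbola. -/
lemma IsAreaMin.exists_hyperbola_of_curve (hM : IsAreaMin K c) {t : ℝ} (ht : t ∈ Set.Ioo s₀ s₁)
    (hC : ContDiffOn ℝ 2 g (Set.Ioo s₀ s₁)) (hd : ∀ t ∈ Set.Ioo s₀ s₁, deriv g t ≠ 0)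
    (hgK : ∀ t ∈ Set.Ioo s₀ s₁, g t ∈ frontier K)
    (hcurv : wedge (deriv g t) (deriv (deriv g) t) ≠ 0)
    {E : Set (ℝ × ℝ)} (hE : E.Finite)
    (hcov : ∀ z ∈ frontier K, z ∉ E → ∃ (g : ℝ → ℝ × ℝ) (u : ℝ), g u = z ∧ ContDiffAt ℝ 2 g u ∧
      deriv g u ≠ 0 ∧ ∀ᶠ s in nhds u, g s ∈ frontier K) :
    ∃ a b, a < b ∧ Set.Ioo a b ⊆ Set.Ioo s₀ s₁ ∧ ∃ (e f : ℝ × ℝ) (h k m : ℝ), wedge e f ≠ 0 ∧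
      ∀ t ∈ Set.Ioo a b, (h + wedge e (g t)) * (k + wedge f (g t)) = m := by
  have hK := hM.1
  have hcc : ContinuousAt (fun t => wedge (deriv g t) (deriv (deriv g) t)) t :=
    (hC.contDiffOn_deriv_Ioo.continuousOn.wedge hC.continuousOn_deriv_deriv_Ioo).continuousAt
      (isOpen_Ioo.mem_nhds ht)
  have hca : ContinuousAt (fun t => wedge (g t) (deriv g t)) t :=
    (hC.continuousOn.wedge hC.contDiffOn_deriv_Ioo.continuousOn).continuousAt
      (isOpen_Ioo.mem_nhds ht)
  have hne : wedge (g t) (deriv g t) ≠ 0 := by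
    refine hK.wedge_deriv_ne_zero (hC.hasDerivAt_Ioo ht) ?_
      (hK.mem_frontier_iff.1 (hgK t ht)).2 (hd t ht)
    filter_upwards [isOpen_Ioo.mem_nhds ht] with s hs
    exact (hK.mem_frontier_iff.1 (hgK s hs)).1
  rcases hne.lt_or_gt with hneg | hpos
  · obtain ⟨a, b, ha, hb, hab, hP⟩ := exists_Ioo_of_eventually ht
      ((hcc.eventually_ne hcurv).and (hca.eventually_lt_const hneg))
    have hmem : ∀ {s}, s ∈ Set.Ioo (-b) (-a) → -s ∈ Set.Ioo a b := fun hs =>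
      ⟨by linarith [hs.2], by linarith [hs.1]⟩
    have hd1 : deriv (fun s => g (-s)) = fun s => -deriv g (-s) := by
      funext s; exact deriv_comp_neg g s
    have hd2 : deriv (deriv (fun s => g (-s))) = fun s => deriv (deriv g) (-s) := by
      rw [hd1]
      funext s
      rw [deriv.fun_neg, deriv_comp_neg (deriv g) s, neg_neg]
    have hA : Arc K (fun s => g (-s)) (-b) (-a) := by
      refine ⟨(hC.mono hab).comp contDiff_neg.contDiffOn fun s hs => hmem hs,
        fun s hs => hgK _ (hab (hmem hs)), fun s hs => ?_⟩
      rw [hd1]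
      simp only [wedge_neg_right]
      linarith [(hP _ (hmem hs)).2]
    obtain ⟨a', b', hab', hs', e, f, h, k, m, hef, heq⟩ :=
      hM.exists_hyperbola (by linarith) hA (fun s hs => by
        rw [hd2, hd1]
        simp only [wedge_neg_left]
        exact neg_ne_zero.2 (hP _ (hmem hs)).1) hE hcov
    have hmem' : ∀ {s}, s ∈ Set.Ioo (-b') (-a') → -s ∈ Set.Ioo a' b' := fun hs =>
      ⟨by linarith [hs.2], by linarith [hs.1]⟩
    refine ⟨-b', -a', by linarith, fun s hs => hab ?_, e, f, h, k, m, hef, fun s hs => ?_⟩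
    · have := hmem (hs' (hmem' hs))
      rwa [neg_neg] at this
    · have := heq _ (hmem' hs)
      rwa [neg_neg] at this
  · obtain ⟨a, b, ha, hb, hab, hP⟩ := exists_Ioo_of_eventually ht
      ((hcc.eventually_ne hcurv).and (hca.eventually_const_lt hpos))
    have hA : Arc K g a b :=
      ⟨hC.mono hab, fun s hs => hgK _ (hab hs), fun s hs => (hP s hs).2⟩
    obtain ⟨a', b', hab', hs', hyp⟩ :=
      hM.exists_hyperbola (ha.trans hb) hA (fun s hs => (hP s hs).1) hE hcov
    exact ⟨a', b', hab', hs'.trans hab, hyp⟩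

lemma IsAreaMin.isSegment_or_isHyperbolicArc (hM : IsAreaMin K c) (hs : s₀ < s₁)
    (hg : AnalyticOnNhd ℝ g (Set.Icc s₀ s₁)) (hd : ∀ t ∈ Set.Icc s₀ s₁, deriv g t ≠ 0)
    (hgK : ∀ t ∈ Set.Icc s₀ s₁, g t ∈ frontier K)
    {E : Set (ℝ × ℝ)} (hE : E.Finite)
    (hcov : ∀ z ∈ frontier K, z ∉ E → ∃ (g : ℝ → ℝ × ℝ) (u : ℝ), g u = z ∧ ContDiffAt ℝ 2 g u ∧
      deriv g u ≠ 0 ∧ ∀ᶠ s in nhds u, g s ∈ frontier K) :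
    IsSegment (g '' Set.Icc s₀ s₁) ∨ IsHyperbolicArc (g '' Set.Icc s₀ s₁) := by
  by_cases hz : ∀ t ∈ Set.Ioo s₀ s₁, wedge (deriv g t) (deriv (deriv g) t) = 0
  · obtain ⟨e, m, he, hline⟩ := exists_line_of_flat hs hg hd hz
    exact Or.inl (isSegment_image_of_wedge hs.le hg.continuousOn he hline)
  · push Not at hz
    obtain ⟨t, ht, hcurv⟩ := hz
    obtain ⟨a, b, hab, hsub, e, f, h, k, m, hef, heq⟩ := hM.exists_hyperbola_of_curve ht
      (fun s hs => (hg s (Set.Ioo_subset_Icc_self hs)).contDiffAt.contDiffWithinAt)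
      (fun s hs => hd s (Set.Ioo_subset_Icc_self hs))
      (fun s hs => hgK s (Set.Ioo_subset_Icc_self hs)) hcurv hE hcov
    have hall := AnalyticOnNhd.eq_zero_of_eq_zero_Ioo
      (G := fun s => (h + wedge e (g s)) * (k + wedge f (g s)) - m)
      (fun s hs => ((analyticAt_const.add ((hg s hs).wedge_vec e)).mul
        (analyticAt_const.add ((hg s hs).wedge_vec f))).sub analyticAt_const)
      hab (hsub.trans Set.Ioo_subset_Icc_self) (fun s hs => sub_eq_zero.2 (heq s hs))
    refine Or.inr (isHyperbolicArc_of_product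
      ((isConnected_Icc hs.le).image _ hg.continuousOn) hef ?_ (h := h) (k := k) (m := m))
    rintro _ ⟨s, hs, rfl⟩
    exact sub_eq_zero.1 (hall s hs)

end analytic

lemma IsCSCD.frontier_nonempty {K : Set (ℝ × ℝ)} (hK : IsCSCD K) : (frontier K).Nonempty := by
  obtain ⟨l, -, h⟩ := hK.exists_frontier_ray (x := (1, 0)) (by simp)
  exact ⟨_, h⟩

/-- A miserly domain with piecewise analytic boundary is a smoothed polygon:
its boundary is a finite union of line segments and arcs of hyperbolas. -/
theorem miserly_piecewise_analytic_is_smoothed_polygon (K : Set (ℝ × ℝ))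
    (hK : IsMiserly K)
    (hpa : ∃ (n : ℕ) (f : Fin n → ℝ → ℝ × ℝ) (t₀ t₁ : Fin n → ℝ),
      frontier K = ⋃ i, f i '' Set.Icc (t₀ i) (t₁ i) ∧
      ∀ i, AnalyticOnNhd ℝ (f i) (Set.Icc (t₀ i) (t₁ i)) ∧
        ∀ t ∈ Set.Icc (t₀ i) (t₁ i), deriv (f i) t ≠ 0) :
    ∃ (n : ℕ) (S : Fin n → Set (ℝ × ℝ)),
      frontier K = ⋃ i, S i ∧
      ∀ i, IsSegment (S i) ∨ IsHyperbolicArc (S i) := by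
  obtain ⟨c, hM⟩ := hK.exists_isAreaMin
  obtain ⟨n, f, t₀, t₁, hfr, hf⟩ := hpa
  have hmem : ∀ i, ∀ t ∈ Set.Icc (t₀ i) (t₁ i), f i t ∈ frontier K := fun i t ht => by
    rw [hfr]
    exact Set.mem_iUnion.2 ⟨i, t, ht, rfl⟩
  set E : Set (ℝ × ℝ) := ⋃ i, {f i (t₀ i), f i (t₁ i)} with hEdef
  have hE : E.Finite := Set.finite_iUnion fun i => (Set.finite_singleton _).insert _
  have hcov : ∀ z ∈ frontier K, z ∉ E → ∃ (g : ℝ → ℝ × ℝ) (u : ℝ), g u = z ∧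
      ContDiffAt ℝ 2 g u ∧ deriv g u ≠ 0 ∧ ∀ᶠ s in nhds u, g s ∈ frontier K := by
    intro z hz hzE
    rw [hfr] at hz
    obtain ⟨i, u, hu, rfl⟩ := Set.mem_iUnion.1 hz
    have h0 : t₀ i ≠ u := by
      intro h
      exact hzE (Set.mem_iUnion.2 ⟨i, by rw [h]; exact Set.mem_insert _ _⟩)
    have h1 : u ≠ t₁ i := by
      intro h
      exact hzE (Set.mem_iUnion.2 ⟨i, by rw [← h]; exact Set.mem_insert_of_mem _ rfl⟩)
    refine ⟨f i, u, rfl, ((hf i).1 u hu).contDiffAt, (hf i).2 u hu, ?_⟩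
    filter_upwards [Icc_mem_nhds (hu.1.lt_of_ne h0) (hu.2.lt_of_ne h1)] with s hs
    exact hmem i s hs
  obtain ⟨z, hz⟩ := hM.1.frontier_nonempty
  refine ⟨n, fun i => if t₀ i ≤ t₁ i then f i '' Set.Icc (t₀ i) (t₁ i) else {z}, ?_, fun i => ?_⟩
  · apply Set.Subset.antisymm
    · intro x hx
      rw [hfr] at hx
      obtain ⟨i, u, hu, rfl⟩ := Set.mem_iUnion.1 hx
      refine Set.mem_iUnion.2 ⟨i, ?_⟩
      rw [if_pos (hu.1.trans hu.2)]
      exact ⟨u, hu, rfl⟩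
    · refine Set.iUnion_subset fun i => ?_
      split_ifs
      · rintro _ ⟨u, hu, rfl⟩
        exact hmem i u hu
      · exact Set.singleton_subset_iff.2 hz
  · dsimp only
    split_ifs with hle
    · rcases hle.eq_or_lt with h | h
      · exact Or.inl ⟨f i (t₀ i), f i (t₀ i), by rw [← h, Set.Icc_self, Set.image_singleton,
          segment_same]⟩
      · exact hM.isSegment_or_isHyperbolicArc h (hf i).1 (hf i).2 (hmem i) hE hcov
    · exact Or.inl ⟨z, z, (segment_same ℝ z).symm⟩
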